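/- arXiv:math/0607059 — 4 statements merged into one kernel-verified Lean document; each statement's English description precedes it below -/
import Mathlib

section
/- Let γ : I → ℝ^d be a C² curve parametrized by arclength on a compact interval, with |γ''(s)| bounded below by c₀ > 0 for all s ∈ I (so γ'(s) and γ''(s) are linearly independent, and γ'(s) ⟂ γ''(s)). Then for s₁, s₂ ∈ I sufficiently close and l ≥ 0, the spherical measure of U_{2^{-l}}(γ'(s₁), γ'(s₂)) = {ω ∈ S^{d-1} : |⟨ω, γ'(s₁)⟩| ≤ 2^{-l}, |⟨ω, γ'(s₂)⟩| ≤ 2^{-l}} is at most C·min{2^{-l}, 2^{-2l}|s₁ - s₂|^{-1}}. -/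
open MeasureTheory Real
open scoped RealInnerProductSpace

/-- A map with `dist x y ≤ K * dist (P x) (P y)` on `T` controls the Hausdorff measure of `T` by
that of its image. -/
theorem hausdorffMeasure_le_of_dist_le {X Y : Type*} [MetricSpace X] [MeasurableSpace X]
    [BorelSpace X] [MetricSpace Y] [MeasurableSpace Y] [BorelSpace Y] {T : Set X} {P : X → Y}
    {K : NNReal} {r : ℝ} (hr : 0 ≤ r)
    (h : ∀ x ∈ T, ∀ y ∈ T, dist x y ≤ K * dist (P x) (P y)) :
    μH[r] T ≤ (K : ENNReal) ^ r * μH[r] (P '' T) := by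
  have hanti : AntilipschitzWith K (T.domRestrict P) :=
    AntilipschitzWith.of_le_mul_dist fun x y => h x x.2 y y.2
  have h1 := hanti.le_hausdorffMeasure_image hr Set.univ
  have h2 := (isometry_subtype_coe (s := T)).hausdorffMeasure_image (Or.inl hr) Set.univ
  rw [Set.image_univ, Subtype.range_coe] at h2
  rwa [← h2, Set.image_univ, Set.range_domRestrict] at h1

section SphereBox

variable {E : Type*} [NormedAddCommGroup E] [InnerProductSpace ℝ E] {n : ℕ}

/-- The part of the unit sphere where the `i`-th coordinate has sign `σ` and is not small. -/
def spherePatch (b : OrthonormalBasis (Fin (n + 1)) ℝ E) (i : Fin (n + 1)) (σ : ℝ) : Set E :=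
  {x | ‖x‖ = 1 ∧ 1 / ((n : ℝ) + 1) ≤ σ * ⟪b i, x⟫}

theorem sum_sq_inner_eq_one (b : OrthonormalBasis (Fin (n + 1)) ℝ E) {x : E} (hx : ‖x‖ = 1) :
    ∑ j, ⟪b j, x⟫ ^ 2 = 1 := by
  have h := b.sum_sq_norm_inner_right x
  simpa [hx] using h

theorem exists_mem_spherePatch (b : OrthonormalBasis (Fin (n + 1)) ℝ E) {x : E} (hx : ‖x‖ = 1) :
    ∃ i, ∃ σ ∈ ({1, -1} : Finset ℝ), x ∈ spherePatch b i σ := by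
  have hn : (0 : ℝ) < n + 1 := by positivity
  have key : ∃ i, 1 / ((n : ℝ) + 1) ≤ |⟪b i, x⟫| := by
    by_contra! hc
    have h1 : ∑ j, ⟪b j, x⟫ ^ 2 < ∑ _j : Fin (n + 1), 1 / ((n : ℝ) + 1) := by
      refine Finset.sum_lt_sum_of_nonempty Finset.univ_nonempty fun j _ => ?_
      have hle : 1 / ((n : ℝ) + 1) ≤ 1 := by
        rw [div_le_one hn]; linarith [n.cast_nonneg (α := ℝ)]
      rw [← sq_abs]
      nlinarith [hc j, abs_nonneg ⟪b j, x⟫]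
    rw [sum_sq_inner_eq_one b hx] at h1
    simp only [Finset.sum_const, Finset.card_univ, Fintype.card_fin, nsmul_eq_mul] at h1
    push_cast at h1
    rw [mul_one_div_cancel hn.ne'] at h1
    exact lt_irrefl _ h1
  obtain ⟨i, hi⟩ := key
  rcases abs_choice ⟪b i, x⟫ with h | h
  · exact ⟨i, 1, by simp, hx, by rw [one_mul, ← h]; exact hi⟩
  · exact ⟨i, -1, by simp, hx, by rw [neg_one_mul, ← h]; exact hi⟩

/-- The coordinates of a vector other than the `i`-th. -/
noncomputable def dropCoord (b : OrthonormalBasis (Fin (n + 1)) ℝ E) (i : Fin (n + 1)) (x : E) : Fin n → ℝ :=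
  fun j => ⟪b (i.succAbove j), x⟫

theorem dist_le_dist_dropCoord (b : OrthonormalBasis (Fin (n + 1)) ℝ E) (i : Fin (n + 1))
    {σ : ℝ} (hσ : |σ| = 1) {x y : E} (hx : x ∈ spherePatch b i σ) (hy : y ∈ spherePatch b i σ) :
    dist x y ≤ (n * (n + 2) : ℝ) * dist (dropCoord b i x) (dropCoord b i y) := by
  obtain ⟨hx1, hxi⟩ := hx
  obtain ⟨hy1, hyi⟩ := hy
  have hn : (0 : ℝ) < n + 1 := by positivity
  set D := dist (dropCoord b i x) (dropCoord b i y) with hD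
  have hD0 : 0 ≤ D := dist_nonneg
  have hcoord : ∀ j, |⟪b (i.succAbove j), x⟫ - ⟪b (i.succAbove j), y⟫| ≤ D := fun j => by
    have := dist_le_pi_dist (dropCoord b i x) (dropCoord b i y) j
    rwa [Real.dist_eq] at this
  have hle1 : ∀ z : E, ‖z‖ = 1 → ∀ j, |⟪b j, z⟫| ≤ 1 := fun z hz j => by
    have := abs_real_inner_le_norm (b j) z
    rwa [hz, b.norm_eq_one, one_mul] at this
  have hsq : |⟪b i, x⟫ ^ 2 - ⟪b i, y⟫ ^ 2| ≤ n * (2 * D) := by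
    have ex := sum_sq_inner_eq_one b hx1
    have ey := sum_sq_inner_eq_one b hy1
    rw [Fin.sum_univ_succAbove _ i] at ex ey
    have heq : ⟪b i, x⟫ ^ 2 - ⟪b i, y⟫ ^ 2 =
        ∑ j : Fin n, (⟪b (i.succAbove j), y⟫ ^ 2 - ⟪b (i.succAbove j), x⟫ ^ 2) := by
      rw [Finset.sum_sub_distrib]; linarith
    rw [heq]
    calc _ ≤ ∑ j : Fin n, |⟪b (i.succAbove j), y⟫ ^ 2 - ⟪b (i.succAbove j), x⟫ ^ 2| :=
          Finset.abs_sum_le_sum_abs _ _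
      _ ≤ ∑ _j : Fin n, 2 * D := by
          refine Finset.sum_le_sum fun j _ => ?_
          rw [sq_sub_sq, abs_mul]
          refine mul_le_mul ?_ ?_ (abs_nonneg _) (by norm_num)
          · have h1 := abs_add_le ⟪b (i.succAbove j), y⟫ ⟪b (i.succAbove j), x⟫
            linarith [hle1 x hx1 (i.succAbove j), hle1 y hy1 (i.succAbove j)]
          · rw [abs_sub_comm]; exact hcoord j
      _ = n * (2 * D) := by simp
  have hi : |⟪b i, x⟫ - ⟪b i, y⟫| ≤ (n + 1) * (n * D) := by
    have hs : 2 / ((n : ℝ) + 1) ≤ |⟪b i, x⟫ + ⟪b i, y⟫| := by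
      have h1 : 2 / ((n : ℝ) + 1) ≤ σ * (⟪b i, x⟫ + ⟪b i, y⟫) := by
        have : 2 / ((n : ℝ) + 1) = 1 / ((n : ℝ) + 1) + 1 / ((n : ℝ) + 1) := by ring
        rw [this, mul_add]; exact add_le_add hxi hyi
      have h2 := h1.trans (le_abs_self _)
      rwa [abs_mul, hσ, one_mul] at h2
    rw [sq_sub_sq, abs_mul] at hsq
    have h3 := (mul_le_mul_of_nonneg_right hs (abs_nonneg (⟪b i, x⟫ - ⟪b i, y⟫))).trans hsq
    rw [div_mul_eq_mul_div, div_le_iff₀ hn] at h3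
    nlinarith
  have hnorm : dist x y ≤ ∑ j, |⟪b j, x - y⟫| := by
    rw [dist_eq_norm]
    conv_lhs => rw [← b.sum_repr' (x - y)]
    refine (norm_sum_le _ _).trans (Finset.sum_le_sum fun j _ => ?_)
    rw [norm_smul, b.norm_eq_one, mul_one, Real.norm_eq_abs]
  rw [Fin.sum_univ_succAbove _ i] at hnorm
  simp only [inner_sub_right] at hnorm
  have hsum : ∑ j : Fin n, |⟪b (i.succAbove j), x⟫ - ⟪b (i.succAbove j), y⟫| ≤ n * D := by
    calc _ ≤ ∑ _j : Fin n, D := Finset.sum_le_sum fun j _ => hcoord j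
      _ = n * D := by simp
  nlinarith

variable [MeasurableSpace E] [BorelSpace E]

theorem hausdorffMeasure_spherePatch_inter_box_le (b : OrthonormalBasis (Fin (n + 1)) ℝ E)
    (i : Fin (n + 1)) {σ : ℝ} (hσ : |σ| = 1) {β : Fin (n + 1) → ℝ} (hβ : ∀ j, 0 ≤ β j) :
    μH[(n : ℝ)] (spherePatch b i σ ∩ {x | ∀ j, |⟪b j, x⟫| ≤ β j}) ≤
      ENNReal.ofReal ((n * (n + 2) : ℝ) ^ n * 2 ^ n * (n + 1) * ∏ j, β j) := by
  set T := spherePatch b i σ ∩ {x | ∀ j, |⟪b j, x⟫| ≤ β j} with hT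
  rcases T.eq_empty_or_nonempty with h0 | ⟨x, ⟨-, hxi⟩, hxβ⟩
  · simp [h0]
  have hn : (0 : ℝ) < n + 1 := by positivity
  have hβi : 1 ≤ (n + 1) * β i := by
    have h1 : 1 / ((n : ℝ) + 1) ≤ β i := by
      refine hxi.trans ((le_abs_self _).trans ?_)
      rw [abs_mul, hσ, one_mul]
      exact hxβ i
    rwa [div_le_iff₀' hn] at h1
  have hK : (0 : ℝ) ≤ n * (n + 2) := by positivity
  have h1 := hausdorffMeasure_le_of_dist_le (T := T) (P := dropCoord b i)
    (K := (n * (n + 2) : ℝ).toNNReal) (r := n) n.cast_nonneg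
    (fun x hx y hy => by
      rw [Real.coe_toNNReal _ hK]
      exact dist_le_dist_dropCoord b i hσ hx.1 hy.1)
  have himg : dropCoord b i '' T ⊆
      Set.Icc (fun j => -β (i.succAbove j)) (fun j => β (i.succAbove j)) := by
    rintro _ ⟨z, hz, rfl⟩
    exact ⟨fun j => (abs_le.1 (hz.2 _)).1, fun j => (abs_le.1 (hz.2 _)).2⟩
  have hvol : μH[(n : ℝ)] (dropCoord b i '' T) ≤
      ENNReal.ofReal (∏ j : Fin n, (2 * β (i.succAbove j))) := by
    refine (measure_mono himg).trans ?_
    have := hausdorffMeasure_pi_real (ι := Fin n)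
    rw [Fintype.card_fin] at this
    rw [this, Real.volume_Icc_pi, ENNReal.ofReal_prod_of_nonneg]
    · refine le_of_eq (Finset.prod_congr rfl fun j _ => ?_)
      congr 1; ring
    · intro j _
      have := hβ (i.succAbove j)
      positivity
  refine h1.trans ((mul_le_mul_right hvol _).trans ?_)
  rw [ENNReal.rpow_natCast]
  change ENNReal.ofReal _ ^ n * _ ≤ _
  rw [← ENNReal.ofReal_pow hK, ← ENNReal.ofReal_mul (by positivity)]
  refine ENNReal.ofReal_le_ofReal ?_
  rw [Finset.prod_mul_distrib, Fin.prod_univ_succAbove β i]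
  simp only [Finset.prod_const, Finset.card_univ, Fintype.card_fin]
  have hp : 0 ≤ ∏ j : Fin n, β (i.succAbove j) := Finset.prod_nonneg fun j _ => hβ _
  have hM : (0 : ℝ) ≤ (n * (n + 2) : ℝ) ^ n * 2 ^ n * ∏ j : Fin n, β (i.succAbove j) := by
    positivity
  nlinarith [mul_le_mul_of_nonneg_left hβi hM]

/-- The part of the unit sphere inside a box has Hausdorff measure bounded by a multiple of the
volume of the box. -/
theorem exists_hausdorffMeasure_sphere_inter_box_le (n : ℕ) (E : Type*) [NormedAddCommGroup E]
    [InnerProductSpace ℝ E] [MeasurableSpace E] [BorelSpace E] :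
    ∃ C : ℝ, 0 < C ∧ ∀ (b : OrthonormalBasis (Fin (n + 1)) ℝ E) (β : Fin (n + 1) → ℝ),
      (∀ j, 0 ≤ β j) →
      μH[(n : ℝ)] {x | ‖x‖ = 1 ∧ ∀ j, |⟪b j, x⟫| ≤ β j} ≤ ENNReal.ofReal (C * ∏ j, β j) := by
  set M : ℝ := (n * (n + 2) : ℝ) ^ n * 2 ^ n * (n + 1) with hM
  have hM0 : 0 ≤ M := by positivity
  refine ⟨2 * (n + 1) * M + 1, by positivity, fun b β hβ => ?_⟩
  have hp : 0 ≤ ∏ j, β j := Finset.prod_nonneg fun j _ => hβ _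
  set S : Finset (Fin (n + 1) × ℝ) := Finset.univ ×ˢ {1, -1} with hS
  have hcover : {x | ‖x‖ = 1 ∧ ∀ j, |⟪b j, x⟫| ≤ β j} ⊆
      ⋃ p ∈ S, (spherePatch b p.1 p.2 ∩ {x | ∀ j, |⟪b j, x⟫| ≤ β j}) := by
    rintro x ⟨hx, hxβ⟩
    obtain ⟨i, σ, hσ, hxp⟩ := exists_mem_spherePatch b hx
    exact Set.mem_biUnion (x := (i, σ))
      (Finset.mem_product.2 ⟨Finset.mem_univ _, hσ⟩) ⟨hxp, hxβ⟩
  have hcard : S.card = (n + 1) * 2 := by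
    rw [hS, Finset.card_product, Finset.card_univ, Fintype.card_fin,
      Finset.card_pair (by norm_num)]
  calc _ ≤ _ := measure_mono hcover
    _ ≤ _ := measure_biUnion_finset_le _ _
    _ ≤ ∑ _p ∈ S, ENNReal.ofReal (M * ∏ j, β j) := by
        refine Finset.sum_le_sum fun p hp => ?_
        refine hausdorffMeasure_spherePatch_inter_box_le b p.1 ?_ hβ
        have := (Finset.mem_product.1 hp).2
        rcases Finset.mem_insert.1 this with h | h
        · simp [h]
        · simp [Finset.mem_singleton.1 h]
    _ = ENNReal.ofReal (2 * (n + 1) * M * ∏ j, β j) := by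
        rw [Finset.sum_const, hcard, ← ENNReal.ofReal_nsmul, nsmul_eq_mul]
        congr 1; push_cast; ring
    _ ≤ _ := ENNReal.ofReal_le_ofReal (by nlinarith)

end SphereBox

/-- The slab estimate for one and for two directions; `‖v - ⟪u, v⟫ • u‖` is the sine of the angle
between `u` and `v`. -/
theorem exists_hausdorffMeasure_sphere_slab_le {n : ℕ} (hn : 1 ≤ n) (E : Type*)
    [NormedAddCommGroup E] [InnerProductSpace ℝ E] [FiniteDimensional ℝ E] [MeasurableSpace E]
    [BorelSpace E] (hE : Module.finrank ℝ E = n + 1) :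
    ∃ C : ℝ, 0 < C ∧ ∀ (u v : E) (δ : ℝ), ‖u‖ = 1 → ‖v‖ = 1 → 0 ≤ δ →
      μH[(n : ℝ)] {x | ‖x‖ = 1 ∧ |⟪x, u⟫| ≤ δ ∧ |⟪x, v⟫| ≤ δ} ≤ ENNReal.ofReal (C * δ) ∧
      (0 < ‖v - ⟪u, v⟫ • u‖ →
        μH[(n : ℝ)] {x | ‖x‖ = 1 ∧ |⟪x, u⟫| ≤ δ ∧ |⟪x, v⟫| ≤ δ} ≤
          ENNReal.ofReal (C * (δ * (2 * δ / ‖v - ⟪u, v⟫ • u‖)))) := by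
  obtain ⟨m, rfl⟩ : ∃ m, n = m + 1 := ⟨n - 1, by omega⟩
  obtain ⟨C, hC, hbox⟩ := exists_hausdorffMeasure_sphere_inter_box_le (m + 1) E
  have hcoord_le : ∀ (b : OrthonormalBasis (Fin (m + 1 + 1)) ℝ E) (j) (x : E), ‖x‖ = 1 →
      |⟪b j, x⟫| ≤ 1 := fun b j x hx => by
    have := abs_real_inner_le_norm (b j) x
    rwa [hx, b.norm_eq_one, one_mul] at this
  have hcard : Module.finrank ℝ E = Fintype.card (Fin (m + 1 + 1)) := by
    rw [hE, Fintype.card_fin]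
  refine ⟨C, hC, fun u v δ hu hv hδ => ⟨?_, fun hσ => ?_⟩⟩
  · have horth : Orthonormal ℝ (({0} : Set (Fin (m + 1 + 1))).domRestrict fun _ => u) :=
      ⟨fun _ => hu, fun i j hij => absurd (Subsingleton.elim i j) hij⟩
    obtain ⟨b, hb⟩ := horth.exists_orthonormalBasis_extension_of_card_eq hcard
    have hb0 : b 0 = u := hb 0 rfl
    refine (measure_mono ?_).trans ((hbox b (Fin.cons δ fun _ => 1) ?_).trans ?_)
    · rintro x ⟨hx, hxu, -⟩
      refine ⟨hx, Fin.cases ?_ fun j => ?_⟩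
      · simpa [hb0, real_inner_comm] using hxu
      · simpa using hcoord_le b j.succ x hx
    · exact Fin.cases (by simpa using hδ) fun j => by simp
    · simp [Fin.prod_univ_succ]
  · set w := v - ⟪u, v⟫ • u with hw
    set e := (‖w‖⁻¹ : ℝ) • w with he
    have huu : ⟪u, u⟫ = 1 := by rw [real_inner_self_eq_norm_sq, hu]; norm_num
    have huw : ⟪u, w⟫ = 0 := by
      rw [hw, inner_sub_right, inner_smul_right, huu, mul_one, sub_self]
    have hue : ⟪u, e⟫ = 0 := by rw [he, inner_smul_right, huw, mul_zero]
    have hen : ‖e‖ = 1 := by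
      rw [he, norm_smul, norm_inv, norm_norm, inv_mul_cancel₀ hσ.ne']
    have heu : ⟪e, u⟫ = 0 := by rw [real_inner_comm]; exact hue
    have horth : Orthonormal ℝ (({0, 1} : Set (Fin (m + 1 + 1))).domRestrict
        (Fin.cons u fun _ => e : Fin (m + 1 + 1) → E)) := by
      refine ⟨fun ⟨i, hi⟩ => ?_, fun ⟨i, hi⟩ ⟨j, hj⟩ hij => ?_⟩
      · rcases hi with rfl | rfl
        · exact hu
        · exact hen
      · rcases hi with rfl | rfl <;> rcases hj with rfl | rfl
        · exact absurd rfl hij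
        · exact hue
        · exact heu
        · exact absurd rfl hij
    obtain ⟨b, hb⟩ := horth.exists_orthonormalBasis_extension_of_card_eq hcard
    have hb0 : b 0 = u := by simpa using hb 0 (by simp)
    have hb1 : b 1 = e := by
      have := hb 1 (by simp)
      rwa [← Fin.succ_zero_eq_one, Fin.cons_succ] at this
    have hq : 0 ≤ 2 * δ / ‖w‖ := by positivity
    refine (measure_mono ?_).trans
      ((hbox b (Fin.cons δ (Fin.cons (2 * δ / ‖w‖) fun _ => 1)) ?_).trans ?_)
    · rintro x ⟨hx, hxu, hxv⟩
      refine ⟨hx, Fin.cases ?_ (Fin.cases ?_ fun j => ?_)⟩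
      · simpa [hb0, real_inner_comm] using hxu
      · have huv : |⟪u, v⟫| ≤ 1 := by
          have := abs_real_inner_le_norm u v
          rwa [hu, hv, one_mul] at this
        rw [Fin.cons_succ, Fin.cons_zero, Fin.succ_zero_eq_one, hb1, he, inner_smul_left,
          real_inner_comm, hw, inner_sub_right, inner_smul_right, ← hw]
        simp only [conj_trivial]
        rw [abs_mul, abs_inv, abs_norm, inv_mul_eq_div]
        refine div_le_div_of_nonneg_right ?_ hσ.le
        refine (abs_sub _ _).trans ?_
        rw [abs_mul]
        nlinarith [abs_nonneg ⟪u, v⟫, abs_nonneg ⟪x, u⟫]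
      · simpa using hcoord_le b j.succ.succ x hx
    · exact Fin.cases (by simpa using hδ) (Fin.cases (by simpa using hq) fun j => by simp)
    · simp [Fin.prod_univ_succ]

/-- For nearby unit vectors the sine of the angle is comparable to the distance. -/
theorem norm_sub_le_two_mul_norm_sub_inner_smul {E : Type*} [NormedAddCommGroup E]
    [InnerProductSpace ℝ E] {u v : E} (hu : ‖u‖ = 1) (hv : ‖v‖ = 1) (huv : ‖v - u‖ ≤ 1) :
    ‖v - u‖ ≤ 2 * ‖v - ⟪u, v⟫ • u‖ := by
  have h1 : ‖v - u‖ ^ 2 = 2 - 2 * ⟪u, v⟫ := by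
    rw [norm_sub_sq_real, hu, hv, real_inner_comm]; ring
  have h2 : ‖v - ⟪u, v⟫ • u‖ ^ 2 = 1 - ⟪u, v⟫ ^ 2 := by
    rw [norm_sub_sq_real, inner_smul_right, norm_smul, hu, hv, real_inner_comm u v, mul_one,
      Real.norm_eq_abs, sq_abs]
    ring
  have h0 := norm_nonneg (v - u)
  refine abs_le_of_sq_le_sq' ?_ (by positivity) |>.2
  have h3 : 0 ≤ 1 - ⟪u, v⟫ := by nlinarith
  have h4 : 1 / 2 ≤ ⟪u, v⟫ := by nlinarith
  rw [mul_pow, h1, h2]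
  nlinarith

/-- A `C¹` map on a compact interval with derivative bounded below in norm is locally
uniformly expanding. -/
theorem exists_mul_abs_sub_le_norm_sub {E : Type*} [NormedAddCommGroup E] [NormedSpace ℝ E]
    {f : ℝ → E} (hf : ContDiff ℝ 1 f) {a b c : ℝ} (hc : 0 < c)
    (hbound : ∀ s ∈ Set.Icc a b, c ≤ ‖deriv f s‖) :
    ∃ ε > 0, ∀ s ∈ Set.Icc a b, ∀ t ∈ Set.Icc a b, |s - t| ≤ ε →
      c / 2 * |s - t| ≤ ‖f t - f s‖ := by
  have hcont : Continuous (deriv f) := hf.continuous_deriv le_rfl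
  obtain ⟨η, hη, hunif⟩ := Metric.uniformContinuousOn_iff.1
    (isCompact_Icc.uniformContinuousOn_of_continuous hcont.continuousOn (s := Set.Icc a b))
    (c / 2) (by positivity)
  refine ⟨η / 2, by positivity, fun s hs t ht hst => ?_⟩
  have hsub : Set.uIcc s t ⊆ Set.Icc a b := (Set.ordConnected_Icc).uIcc_subset hs ht
  have hd : ∀ r ∈ Set.uIcc s t,
      HasDerivWithinAt (fun r => f r - r • deriv f s) (deriv f r - deriv f s) (Set.uIcc s t) r := by
    intro r _
    have h1 := ((hf.differentiable one_ne_zero) r).hasDerivAt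
    have h2 := (hasDerivAt_id r).smul_const (deriv f s)
    rw [one_smul] at h2
    exact (h1.sub h2).hasDerivWithinAt
  have hmv := (convex_uIcc s t).norm_image_sub_le_of_norm_hasDerivWithin_le (C := c / 2) hd
    (fun r hr => by
      rw [← dist_eq_norm]
      refine (hunif r (hsub hr) s hs ?_).le
      rw [Real.dist_eq]
      have := Set.abs_sub_left_of_mem_uIcc hr
      rw [abs_sub_comm t s] at this
      linarith) Set.left_mem_uIcc Set.right_mem_uIcc
  have heq : f t - t • deriv f s - (f s - s • deriv f s) =
      (f t - f s) - (t - s) • deriv f s := by rw [sub_smul]; abel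
  rw [heq, Real.norm_eq_abs] at hmv
  have h3 := norm_sub_norm_le ((t - s) • deriv f s) (f t - f s)
  rw [norm_sub_rev _ (f t - f s), norm_smul, Real.norm_eq_abs] at h3
  rw [abs_sub_comm s t]
  nlinarith [mul_le_mul_of_nonneg_left (hbound s hs) (abs_nonneg (t - s))]

/-- For an arclength-parametrized `C²` curve with curvature bounded below, the
set of directions `ω` with `|⟨ω,γ'(s₁)⟩| ≤ 2^{-l}` and `|⟨ω,γ'(s₂)⟩| ≤ 2^{-l}`
has spherical measure at most `C·min{2^{-l}, 2^{-2l}|s₁-s₂|⁻¹}`, stated as the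
pair of inequalities `μ ≤ C·2^{-l}` and `|s₁-s₂|·μ ≤ C·2^{-2l}`. -/
theorem stmt2 (d : ℕ) (hd : 2 ≤ d) (a b : ℝ) (hab : a < b) (c₀ : ℝ) (hc₀ : 0 < c₀)
    (γ : ℝ → EuclideanSpace ℝ (Fin d)) (hγ : ContDiff ℝ 2 γ)
    (harc : ∀ s ∈ Set.Icc a b, ‖deriv γ s‖ = 1)
    (hcurv : ∀ s ∈ Set.Icc a b, c₀ ≤ ‖deriv (deriv γ) s‖) :
    ∃ ε > 0, ∃ C > 0, ∀ s₁ ∈ Set.Icc a b, ∀ s₂ ∈ Set.Icc a b, |s₁ - s₂| ≤ ε →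
      ∀ l : ℕ,
      (μH[(d:ℝ)-1] {ω : EuclideanSpace ℝ (Fin d) |
            ω ∈ Metric.sphere (0 : EuclideanSpace ℝ (Fin d)) 1 ∧
            |⟪ω, deriv γ s₁⟫| ≤ (2:ℝ)^(-(l:ℝ)) ∧ |⟪ω, deriv γ s₂⟫| ≤ (2:ℝ)^(-(l:ℝ))}
          ≤ ENNReal.ofReal (C * (2:ℝ)^(-(l:ℝ)))) ∧
      (ENNReal.ofReal |s₁ - s₂| *
          μH[(d:ℝ)-1] {ω : EuclideanSpace ℝ (Fin d) |
            ω ∈ Metric.sphere (0 : EuclideanSpace ℝ (Fin d)) 1 ∧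
            |⟪ω, deriv γ s₁⟫| ≤ (2:ℝ)^(-(l:ℝ)) ∧ |⟪ω, deriv γ s₂⟫| ≤ (2:ℝ)^(-(l:ℝ))}
          ≤ ENNReal.ofReal (C * (2:ℝ)^(-(2:ℝ)*l))) := by
  obtain ⟨n, rfl⟩ : ∃ n, d = n + 1 := ⟨d - 1, by omega⟩
  have hf : ContDiff ℝ 1 (deriv γ) := hγ.deriv'
  obtain ⟨ε₁, hε₁, hexp⟩ := exists_mul_abs_sub_le_norm_sub hf hc₀ hcurv
  obtain ⟨ε₂, hε₂, hclose⟩ := Metric.uniformContinuousOn_iff.1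
    (isCompact_Icc.uniformContinuousOn_of_continuous hf.continuous.continuousOn
      (s := Set.Icc a b)) 1 one_pos
  obtain ⟨C, hC, hslab⟩ := exists_hausdorffMeasure_sphere_slab_le (n := n) (by omega)
    (EuclideanSpace ℝ (Fin (n + 1))) (by simp)
  refine ⟨min ε₁ (ε₂ / 2), by positivity, C + 8 * C / c₀, by positivity,
    fun s₁ hs₁ s₂ hs₂ hs l => ?_⟩
  have hdim : (((n + 1 : ℕ) : ℝ) - 1) = n := by push_cast; ring
  rw [hdim]
  simp only [mem_sphere_zero_iff_norm]
  set δ : ℝ := (2 : ℝ) ^ (-(l : ℝ)) with hδ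
  have hδ0 : 0 < δ := by positivity
  have hδ2 : (2 : ℝ) ^ (-(2 : ℝ) * l) = δ * δ := by
    rw [hδ, ← Real.rpow_add two_pos]; congr 1; ring
  rw [hδ2]
  set v₁ := deriv γ s₁
  set v₂ := deriv γ s₂
  have hv₁ : ‖v₁‖ = 1 := harc s₁ hs₁
  have hv₂ : ‖v₂‖ = 1 := harc s₂ hs₂
  obtain ⟨h1, h2⟩ := hslab v₁ v₂ δ hv₁ hv₂ hδ0.le
  have hCc : 0 ≤ 8 * C / c₀ := by positivity
  refine ⟨h1.trans (ENNReal.ofReal_le_ofReal (by nlinarith)), ?_⟩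
  rcases eq_or_ne s₁ s₂ with heq | hne
  · simp [heq]
  have hpos : 0 < |s₁ - s₂| := abs_pos.2 (sub_ne_zero.2 hne)
  have hlow := hexp s₁ hs₁ s₂ hs₂ (hs.trans (min_le_left _ _))
  have hup : ‖v₂ - v₁‖ ≤ 1 := by
    rw [← dist_eq_norm]
    refine (hclose s₂ hs₂ s₁ hs₁ ?_).le
    rw [Real.dist_eq, abs_sub_comm]
    linarith [hs.trans (min_le_right _ _)]
  have hsin := hlow.trans (norm_sub_le_two_mul_norm_sub_inner_smul hv₁ hv₂ hup)
  set w := ‖v₂ - ⟪v₁, v₂⟫ • v₁‖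
  have hw : 0 < w := by nlinarith [mul_pos hc₀ hpos]
  refine (mul_le_mul_right (h2 hw) _).trans ?_
  rw [← ENNReal.ofReal_mul hpos.le]
  refine ENNReal.ofReal_le_ofReal ?_
  have hratio : |s₁ - s₂| / w ≤ 4 / c₀ := by
    rw [div_le_div_iff₀ hw hc₀]; linarith
  calc |s₁ - s₂| * (C * (δ * (2 * δ / w))) = 2 * C * (δ * δ) * (|s₁ - s₂| / w) := by ring
    _ ≤ 2 * C * (δ * δ) * (4 / c₀) := by gcongr
    _ = 8 * C / c₀ * (δ * δ) := by ring
    _ ≤ (C + 8 * C / c₀) * (δ * δ) := by gcongr; linarith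
end

section
/- The Airy function satisfies the asymptotic Ai(−t) = π^{-1/2} t^{-1/4} cos((2/3)t^{3/2} − π/4)(1 + O(t^{-3/4})) as t → +∞; i.e., there exist C, t₀ > 0 such that |Ai(−t) − π^{-1/2} t^{-1/4} cos((2/3)t^{3/2} − π/4)| ≤ C t^{-1/4} · t^{-3/4} for t ≥ t₀. -/
open Real Filter MeasureTheory

/-- The Airy function, defined as the (improper) oscillatory integral
`Ai(τ) = (1/2π) ∫ exp(i(x³/3 + τx)) dx`. -/
noncomputable def airy (τ : ℝ) : ℂ :=
  limUnder atTop (fun A : ℝ =>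
    ((1/(2*π) : ℝ) : ℂ) * ∫ x in (-A)..A, Complex.exp (Complex.I * ((x^3/3 + τ*x : ℝ) : ℂ)))

open Complex in
/-- The oscillating Gaussian tail is small even without decay of the exponential. -/
theorem norm_integral_cexp_neg_mul_sq_le {b : ℂ} (hb : 0 ≤ b.re) (hb0 : b ≠ 0) {W M : ℝ}
    (hW : 0 < W) (hWM : W ≤ M) :
    ‖∫ x in W..M, cexp (-b * (x : ℂ) ^ 2)‖ ≤ 1 / (‖b‖ * W) := by
  have hpos : ∀ x ∈ Set.uIcc W M, 0 < x := fun x hx => by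
    rw [Set.uIcc_of_le hWM] at hx; exact hW.trans_le hx.1
  have hM : 0 < M := hW.trans_le hWM
  have hbn : 0 < ‖b‖ := norm_pos_iff.2 hb0
  have hexp : ∀ x : ℝ, ‖cexp (-b * (x : ℂ) ^ 2)‖ ≤ 1 := fun x => by
    rw [norm_cexp_neg_mul_sq, Real.exp_le_one_iff]
    nlinarith [mul_nonneg hb (sq_nonneg x)]
  have hrem : ContinuousOn (fun x : ℝ => cexp (-b * (x : ℂ) ^ 2) / (2 * b * (x : ℂ) ^ 2))
      (Set.uIcc W M) := by
    refine ContinuousOn.div (by fun_prop) (by fun_prop) fun x hx => ?_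
    have := (hpos x hx).ne'
    simp [hb0, this]
  have hcont : Continuous (fun x : ℝ => cexp (-b * (x : ℂ) ^ 2)) := by fun_prop
  have hparts : ∫ x in W..M, (cexp (-b * (x : ℂ) ^ 2) +
      cexp (-b * (x : ℂ) ^ 2) / (2 * b * (x : ℂ) ^ 2)) =
      -cexp (-b * (M : ℂ) ^ 2) / (2 * b * M) - -cexp (-b * (W : ℂ) ^ 2) / (2 * b * W) := by
    refine intervalIntegral.integral_eq_sub_of_hasDerivAt
      (f := fun x : ℝ => -cexp (-b * (x : ℂ) ^ 2) / (2 * b * x)) (fun x hx => ?_)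
      ((hcont.continuousOn.add hrem).intervalIntegrable)
    have hx0 : (x : ℂ) ≠ 0 := by exact_mod_cast (hpos x hx).ne'
    have h1 : HasDerivAt (fun z : ℂ => -cexp (-b * z ^ 2) / (2 * b * z))
        (cexp (-b * (x : ℂ) ^ 2) + cexp (-b * (x : ℂ) ^ 2) / (2 * b * (x : ℂ) ^ 2)) (x : ℂ) := by
      have := ((((hasDerivAt_id (x : ℂ)).pow 2).const_mul (-b)).cexp.neg).div
        ((hasDerivAt_id (x : ℂ)).const_mul (2 * b)) (by simp [hb0, hx0])
      refine this.congr_deriv ?_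
      simp only [id, Nat.cast_ofNat, mul_one, Pi.pow_apply, Pi.neg_apply]
      field_simp
      ring
    exact h1.comp_ofReal
  rw [intervalIntegral.integral_add (hcont.intervalIntegrable _ _) hrem.intervalIntegrable]
    at hparts
  have hremle : ‖∫ x in W..M, cexp (-b * (x : ℂ) ^ 2) / (2 * b * (x : ℂ) ^ 2)‖ ≤
      1 / (2 * ‖b‖ * W) - 1 / (2 * ‖b‖ * M) := by
    have hc : ContinuousOn (fun x : ℝ => 1 / (2 * ‖b‖ * x ^ 2)) (Set.uIcc W M) := by
      refine ContinuousOn.div (by fun_prop) (by fun_prop) fun x hx => ?_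
      have := hpos x hx
      positivity
    have hint : ∫ x in W..M, 1 / (2 * ‖b‖ * x ^ 2) = 1 / (2 * ‖b‖ * W) - 1 / (2 * ‖b‖ * M) := by
      rw [intervalIntegral.integral_eq_sub_of_hasDerivAt
        (f := fun x : ℝ => -(1 / (2 * ‖b‖ * x))) (fun x hx => ?_) hc.intervalIntegrable]
      · ring
      have hx0 := hpos x hx
      have := ((hasDerivAt_const x (1 : ℝ)).div ((hasDerivAt_id x).const_mul (2 * ‖b‖))
        (by positivity)).neg
      refine this.congr_deriv ?_
      simp only [id]
      field_simp
      ring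
    rw [← hint]
    refine intervalIntegral.norm_integral_le_of_norm_le hWM (.of_forall fun x hx => ?_)
      hc.intervalIntegrable
    have hx0 : 0 < x := hW.trans hx.1
    rw [norm_div]
    simp only [norm_mul, norm_pow, Complex.norm_ofNat, norm_real, Real.norm_eq_abs, abs_of_pos hx0]
    gcongr
    exact hexp x
  have hend : ∀ x : ℝ, 0 < x → ‖-cexp (-b * (x : ℂ) ^ 2) / (2 * b * x)‖ ≤ 1 / (2 * ‖b‖ * x) :=
    fun x hx => by
      rw [norm_div, norm_neg]
      simp only [norm_mul, Complex.norm_ofNat, norm_real, Real.norm_eq_abs, abs_of_pos hx]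
      gcongr
      exact hexp x
  calc _ = ‖-cexp (-b * (M : ℂ) ^ 2) / (2 * b * M) - -cexp (-b * (W : ℂ) ^ 2) / (2 * b * W) -
        ∫ x in W..M, cexp (-b * (x : ℂ) ^ 2) / (2 * b * (x : ℂ) ^ 2)‖ := by
        rw [← hparts, add_sub_cancel_right]
    _ ≤ 1 / (2 * ‖b‖ * M) + 1 / (2 * ‖b‖ * W) + (1 / (2 * ‖b‖ * W) - 1 / (2 * ‖b‖ * M)) :=
        norm_sub_le_of_le (norm_sub_le_of_le (hend M hM) (hend W hW)) hremle
    _ = 1 / (‖b‖ * W) := by field_simp; ring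

open Complex in
theorem norm_integral_cexp_neg_mul_sq_sub_le_of_re_pos {b : ℂ} (hb : 0 < b.re) {W : ℝ}
    (hW : 0 < W) :
    ‖(∫ x in (0 : ℝ)..W, cexp (-b * (x : ℂ) ^ 2)) - (π / b) ^ (1 / 2 : ℂ) / 2‖ ≤
      1 / (‖b‖ * W) := by
  have hb0 : b ≠ 0 := by rintro rfl; simp at hb
  have hcont : Continuous (fun x : ℝ => cexp (-b * (x : ℂ) ^ 2)) := by fun_prop
  have hlim := intervalIntegral_tendsto_integral_Ioi 0
    (integrable_cexp_neg_mul_sq hb).integrableOn tendsto_id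
  rw [integral_gaussian_complex_Ioi hb] at hlim
  refine le_of_tendsto (hlim.const_sub (∫ x in (0 : ℝ)..W, cexp (-b * (x : ℂ) ^ 2))).norm ?_
  filter_upwards [eventually_ge_atTop W] with M hM
  rw [norm_sub_rev, id, intervalIntegral.integral_interval_sub_left (hcont.intervalIntegrable _ _)
    (hcont.intervalIntegrable _ _)]
  exact norm_integral_cexp_neg_mul_sq_le hb.le hb0 hW hM

open Complex in
/-- Truncated Gaussian integrals with purely oscillating exponent included. -/
theorem norm_integral_cexp_neg_mul_sq_sub_le {b : ℂ} (hb : 0 ≤ b.re) (hb0 : b ≠ 0) {W : ℝ}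
    (hW : 0 < W) :
    ‖(∫ x in (0 : ℝ)..W, cexp (-b * (x : ℂ) ^ 2)) - (π / b) ^ (1 / 2 : ℂ) / 2‖ ≤
      1 / (‖b‖ * W) := by
  have hint : Continuous fun c : ℂ => ∫ x in (0 : ℝ)..W, cexp (-c * (x : ℂ) ^ 2) :=
    intervalIntegral.continuous_parametric_intervalIntegral_of_continuous' (by fun_prop) _ _
  have hslit : (π / b : ℂ) ∈ slitPlane := by
    have hn : 0 < normSq b := normSq_pos.2 hb0
    rw [mem_slitPlane_iff, div_re, div_im]
    simp only [ofReal_re, ofReal_im, zero_mul, zero_div, add_zero, zero_sub]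
    rcases hb.lt_or_eq with h | h
    · exact .inl (by positivity)
    · have him : b.im ≠ 0 := fun h' => hb0 (Complex.ext h.symm h')
      exact .inr (by simp [him, hb0, Real.pi_ne_zero])
  have hshift : Tendsto (fun ε : ℝ => b + (ε : ℂ)) (nhdsWithin 0 (Set.Ioi 0)) (nhds b) := by
    have : Continuous fun ε : ℝ => b + (ε : ℂ) := by fun_prop
    simpa using (this.tendsto 0).mono_left nhdsWithin_le_nhds
  have hL : ContinuousAt (fun c : ℂ => (π / c : ℂ) ^ (1 / 2 : ℂ) / 2) b :=
    ((continuousAt_const.div continuousAt_id hb0).cpow continuousAt_const hslit).div_const 2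
  have hR : ContinuousAt (fun c : ℂ => 1 / (‖c‖ * W)) b :=
    continuousAt_const.div (continuous_norm.continuousAt.mul continuousAt_const)
      (mul_ne_zero (norm_ne_zero_iff.2 hb0) hW.ne')
  refine le_of_tendsto_of_tendsto (((hint.continuousAt.sub hL).norm).tendsto.comp hshift)
    (hR.tendsto.comp hshift) ?_
  filter_upwards [self_mem_nhdsWithin] with ε hε
  refine norm_integral_cexp_neg_mul_sq_sub_le_of_re_pos ?_ hW
  have : 0 < ε := hε
  simp only [add_re, ofReal_re]
  linarith

open Complex in
theorem norm_integral_cexp_I_mul_sq_sub_le {l W : ℝ} (hl : 0 < l) (hW : 0 < W) :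
    ‖(∫ x in (0 : ℝ)..W, cexp (I * ((l * x ^ 2 : ℝ) : ℂ))) -
      (√(π / l) : ℂ) * cexp (I * ((π / 4 : ℝ) : ℂ)) / 2‖ ≤ 1 / (l * W) := by
  have h := norm_integral_cexp_neg_mul_sq_sub_le (b := -I * l) (by simp)
    (by simp [hl.ne']) hW
  have hn : ‖-I * (l : ℂ)‖ = l := by simp [abs_of_pos hl]
  have hpl : 0 < π / l := div_pos Real.pi_pos hl
  have hroot : (π / (-I * l) : ℂ) ^ (1 / 2 : ℂ) =
      (√(π / l) : ℂ) * cexp (I * ((π / 4 : ℝ) : ℂ)) := by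
    have hdiv : (π / (-I * l) : ℂ) = ((π / l : ℝ) : ℂ) * I := by
      have : (l : ℂ) ≠ 0 := by exact_mod_cast hl.ne'
      push_cast
      field_simp
      simp
    rw [hdiv, cpow_def_of_ne_zero (mul_ne_zero (by exact_mod_cast hpl.ne') I_ne_zero),
      log_ofReal_mul hpl I_ne_zero, log_I, add_mul, Complex.exp_add, Real.sqrt_eq_rpow,
      Real.rpow_def_of_pos hpl]
    push_cast
    congr 2
    ring
  rw [hn, hroot] at h
  have hfun : ∀ x : ℝ, -(-I * l) * (x : ℂ) ^ 2 = I * ((l * x ^ 2 : ℝ) : ℂ) := fun x => by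
    push_cast
    ring
  simpa only [hfun] using h

/-- The signed square root of the Airy phase in the variable `r`, where the integration variable is
`3 * r ^ 2 - 2`. -/
def airyPhaseRoot (r : ℝ) : ℝ := 3 * (r ^ 3 - r)

/-- The amplitude left over by the change of variable `airyPhaseRoot`. -/
noncomputable def airyAmplitude (r : ℝ) : ℝ := -(3 * r + 1) / (6 * r * (r + 1) * (3 * r ^ 2 - 1))

/-- The derivative of `airyAmplitude`. -/
noncomputable def airyAmplitudeDeriv (r : ℝ) : ℝ :=
  6 * (27 * r ^ 4 + 30 * r ^ 3 + 6 * r ^ 2 - 2 * r - 1) / (6 * r * (r + 1) * (3 * r ^ 2 - 1)) ^ 2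

theorem hasDerivAt_airyPhaseRoot (r : ℝ) :
    HasDerivAt airyPhaseRoot (3 * (3 * r ^ 2 - 1)) r := by
  refine ((((hasDerivAt_id r).pow 3).sub (hasDerivAt_id r)).const_mul 3).congr_deriv ?_
  simp

theorem two_thirds_le_sq_of_sqrt_le {r : ℝ} (hr : √(2 / 3) ≤ r) : 0 < r ∧ 2 / 3 ≤ r ^ 2 :=
  ⟨(by positivity : (0 : ℝ) < √(2 / 3)).trans_le hr, (Real.sqrt_le_left
    ((Real.sqrt_nonneg _).trans hr)).1 hr⟩

theorem airyAmplitude_denom_pos {r : ℝ} (hr : √(2 / 3) ≤ r) :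
    0 < 6 * r * (r + 1) * (3 * r ^ 2 - 1) := by
  obtain ⟨h0, h1⟩ := two_thirds_le_sq_of_sqrt_le hr
  have : 0 < 3 * r ^ 2 - 1 := by linarith
  positivity

theorem hasDerivAt_airyAmplitude {r : ℝ} (hr : √(2 / 3) ≤ r) :
    HasDerivAt airyAmplitude (airyAmplitudeDeriv r) r := by
  have hid := hasDerivAt_id r
  have h := (((hid.const_mul 3).add_const 1).neg).div
    (((hid.const_mul 6).mul (hid.add_const 1)).mul (((hid.pow 2).const_mul 3).sub_const 1))
    (airyAmplitude_denom_pos hr).ne'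
  refine h.congr_deriv ?_
  simp only [airyAmplitudeDeriv, id, Pi.neg_apply, Pi.mul_apply, Pi.pow_apply]
  congr 1
  push_cast
  ring

theorem airyAmplitudeDeriv_nonneg {r : ℝ} (hr : √(2 / 3) ≤ r) : 0 ≤ airyAmplitudeDeriv r := by
  obtain ⟨h0, h1⟩ := two_thirds_le_sq_of_sqrt_le hr
  refine div_nonneg ?_ (sq_nonneg _)
  nlinarith [mul_le_mul_of_nonneg_left h1 h0.le, sq_nonneg (r ^ 2)]

theorem tendsto_airyAmplitude_atTop : Tendsto airyAmplitude atTop (nhds 0) := by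
  refine squeeze_zero_norm' ?_ tendsto_inv_atTop_zero
  filter_upwards [eventually_ge_atTop 1] with r hr
  have h2 : 0 < 3 * r ^ 2 - 1 := by nlinarith
  have h3 : 0 < 6 * r * (r + 1) * (3 * r ^ 2 - 1) := by positivity
  rw [airyAmplitude, norm_div, norm_neg, Real.norm_of_nonneg (by positivity),
    Real.norm_of_nonneg h3.le, div_le_iff₀ h3]
  have : r⁻¹ * (6 * r * (r + 1) * (3 * r ^ 2 - 1)) = 6 * (r + 1) * (3 * r ^ 2 - 1) := by
    field_simp
  rw [this]
  nlinarith

theorem integrableOn_airyAmplitudeDeriv :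
    IntegrableOn airyAmplitudeDeriv (Set.Ioi √(2 / 3)) :=
  integrableOn_Ioi_deriv_of_nonneg' (fun _ hr => hasDerivAt_airyAmplitude hr)
    (fun _ hr => airyAmplitudeDeriv_nonneg (le_of_lt hr)) tendsto_airyAmplitude_atTop

theorem continuousOn_airyAmplitudeDeriv :
    ContinuousOn airyAmplitudeDeriv (Set.Ici √(2 / 3)) :=
  ContinuousOn.div (by fun_prop) (by fun_prop) fun _ hr =>
    pow_ne_zero _ (airyAmplitude_denom_pos hr).ne'

theorem continuous_airyPhaseRoot : Continuous airyPhaseRoot := by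
  unfold airyPhaseRoot; fun_prop

open Complex in
theorem integral_cexp_airyPhaseRoot {l R : ℝ} (hl : 0 < l) (hR : √(2 / 3) ≤ R) :
    ∫ r in √(2 / 3)..R, cexp (I * ((l * airyPhaseRoot r ^ 2 : ℝ) : ℂ)) * ((6 * r : ℝ) : ℂ) =
      (∫ v in airyPhaseRoot √(2 / 3)..airyPhaseRoot R, cexp (I * ((l * v ^ 2 : ℝ) : ℂ))) +
      (I * l)⁻¹ * (cexp (I * ((l * airyPhaseRoot R ^ 2 : ℝ) : ℂ)) * (airyAmplitude R : ℂ) -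
        cexp (I * ((l * airyPhaseRoot √(2 / 3) ^ 2 : ℝ) : ℂ)) * (airyAmplitude √(2 / 3) : ℂ) -
        ∫ r in √(2 / 3)..R,
          cexp (I * ((l * airyPhaseRoot r ^ 2 : ℝ) : ℂ)) * (airyAmplitudeDeriv r : ℂ)) := by
  have hmem : ∀ r ∈ Set.uIcc √(2 / 3) R, √(2 / 3) ≤ r := fun r hr => by
    rw [Set.uIcc_of_le hR] at hr; exact hr.1
  have hIl : I * (l : ℂ) ≠ 0 := mul_ne_zero I_ne_zero (by exact_mod_cast hl.ne')
  have hw := continuous_airyPhaseRoot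
  have hsubst := intervalIntegral.integral_deriv_smul_comp (a := √(2 / 3)) (b := R)
    (g := fun v : ℝ => cexp (I * ((l * v ^ 2 : ℝ) : ℂ)))
    (fun r _ => hasDerivAt_airyPhaseRoot r) (by fun_prop) (by fun_prop)
  have hk : ContinuousOn (fun r => cexp (I * ((l * airyPhaseRoot r ^ 2 : ℝ) : ℂ)) *
      (airyAmplitudeDeriv r : ℂ)) (Set.uIcc √(2 / 3) R) :=
    ContinuousOn.mul (by fun_prop) (continuous_ofReal.comp_continuousOn
      (continuousOn_airyAmplitudeDeriv.mono hmem))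
  have hg : Continuous fun r => (I * l) * (cexp (I * ((l * airyPhaseRoot r ^ 2 : ℝ) : ℂ)) *
      ((6 * r - 3 * (3 * r ^ 2 - 1) : ℝ) : ℂ)) := by fun_prop
  have hparts : ∫ r in √(2 / 3)..R, ((I * l) * (cexp (I * ((l * airyPhaseRoot r ^ 2 : ℝ) : ℂ)) *
      ((6 * r - 3 * (3 * r ^ 2 - 1) : ℝ) : ℂ)) +
      cexp (I * ((l * airyPhaseRoot r ^ 2 : ℝ) : ℂ)) * (airyAmplitudeDeriv r : ℂ)) =
      cexp (I * ((l * airyPhaseRoot R ^ 2 : ℝ) : ℂ)) * (airyAmplitude R : ℂ) -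
      cexp (I * ((l * airyPhaseRoot √(2 / 3) ^ 2 : ℝ) : ℂ)) * (airyAmplitude √(2 / 3) : ℂ) := by
    refine intervalIntegral.integral_eq_sub_of_hasDerivAt
      (f := fun r : ℝ => cexp (I * ((l * airyPhaseRoot r ^ 2 : ℝ) : ℂ)) * (airyAmplitude r : ℂ))
      (fun r hr => ?_) (hg.continuousOn.add hk).intervalIntegrable
    have h1 := ((((hasDerivAt_airyPhaseRoot r).pow 2).const_mul l).ofReal_comp.const_mul I).cexp
    have h2 := h1.mul (hasDerivAt_airyAmplitude (hmem r hr)).ofReal_comp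
    refine h2.congr_deriv ?_
    have key : 2 * airyPhaseRoot r * (3 * (3 * r ^ 2 - 1)) * airyAmplitude r =
        6 * r - 3 * (3 * r ^ 2 - 1) := by
      have := (airyAmplitude_denom_pos (hmem r hr)).ne'
      rw [airyPhaseRoot, airyAmplitude, mul_div_assoc', div_eq_iff this]
      ring
    rw [← key]
    simp only [Pi.pow_apply]
    push_cast
    ring
  rw [intervalIntegral.integral_add (hg.intervalIntegrable _ _) hk.intervalIntegrable,
    intervalIntegral.integral_const_mul] at hparts
  rw [← hparts, add_sub_cancel_right, inv_mul_cancel_left₀ hIl, ← hsubst,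
    ← intervalIntegral.integral_add (Continuous.intervalIntegrable (by fun_prop) _ _)
      (Continuous.intervalIntegrable (by fun_prop) _ _)]
  refine intervalIntegral.integral_congr fun r _ => ?_
  simp only [Function.comp, real_smul]
  push_cast
  ring

theorem airyPhaseRoot_sqrt_two_thirds : airyPhaseRoot √(2 / 3) = -√(2 / 3) := by
  have h : √(2 / 3 : ℝ) ^ 2 = 2 / 3 := Real.sq_sqrt (by norm_num)
  rw [airyPhaseRoot, pow_succ, h]
  ring

theorem tendsto_airyPhaseRoot_atTop : Tendsto airyPhaseRoot atTop atTop := by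
  refine tendsto_atTop_mono' _ ?_ tendsto_id
  filter_upwards [eventually_ge_atTop 2] with r hr
  simp only [airyPhaseRoot, id]
  nlinarith [sq_nonneg r]

open Complex in
theorem exists_tendsto_integral_cexp_airyPhaseRoot :
    ∃ C > 0, ∀ l : ℝ, 0 < l → ∃ J : ℂ,
      Tendsto (fun R : ℝ => ∫ r in √(2 / 3)..R,
        cexp (I * ((l * airyPhaseRoot r ^ 2 : ℝ) : ℂ)) * ((6 * r : ℝ) : ℂ)) atTop (nhds J) ∧
      ‖J - (√(π / l) : ℂ) * cexp (I * ((π / 4 : ℝ) : ℂ))‖ ≤ C / l := by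
  have hnorm : ∀ x : ℝ, ‖cexp (I * (x : ℂ))‖ = 1 := fun x => by
    rw [mul_comm]; exact norm_exp_ofReal_mul_I x
  refine ⟨1 / √(2 / 3) + |airyAmplitude √(2 / 3)| +
    ∫ r in Set.Ioi √(2 / 3), |airyAmplitudeDeriv r|, ?_, fun l hl => ?_⟩
  · have : 0 ≤ ∫ r in Set.Ioi √(2 / 3), |airyAmplitudeDeriv r| :=
      integral_nonneg fun _ => abs_nonneg _
    positivity
  set L : ℂ := (√(π / l) : ℂ) * cexp (I * ((π / 4 : ℝ) : ℂ)) with hL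
  have hcont : Continuous fun v : ℝ => cexp (I * ((l * v ^ 2 : ℝ) : ℂ)) := by fun_prop
  have hF : Tendsto (fun W : ℝ => ∫ v in (0 : ℝ)..W, cexp (I * ((l * v ^ 2 : ℝ) : ℂ)))
      atTop (nhds (L / 2)) := by
    rw [tendsto_iff_norm_sub_tendsto_zero]
    refine squeeze_zero' (.of_forall fun _ => norm_nonneg _) ?_
      ((tendsto_id.const_mul_atTop hl).const_div_atTop 1)
    filter_upwards [eventually_gt_atTop 0] with W hW
    exact norm_integral_cexp_I_mul_sq_sub_le hl hW
  have hneg : ∫ v in -√(2 / 3)..0, cexp (I * ((l * v ^ 2 : ℝ) : ℂ)) =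
      ∫ v in (0 : ℝ)..√(2 / 3), cexp (I * ((l * v ^ 2 : ℝ) : ℂ)) := by
    rw [← neg_zero, ← intervalIntegral.integral_comp_neg, neg_zero]
    refine intervalIntegral.integral_congr fun v _ => ?_
    simp only [neg_sq]
  have hw := continuous_airyPhaseRoot
  have hdom : ∀ r, ‖cexp (I * ((l * airyPhaseRoot r ^ 2 : ℝ) : ℂ)) * (airyAmplitudeDeriv r : ℂ)‖ =
      |airyAmplitudeDeriv r| := fun r => by rw [norm_mul, hnorm, one_mul, norm_real, norm_eq_abs]
  have hint : IntegrableOn (fun r => cexp (I * ((l * airyPhaseRoot r ^ 2 : ℝ) : ℂ)) *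
      (airyAmplitudeDeriv r : ℂ)) (Set.Ioi √(2 / 3)) := by
    refine Integrable.mono' integrableOn_airyAmplitudeDeriv.abs
      (Continuous.aestronglyMeasurable (by fun_prop) |>.mul
        (continuous_ofReal.comp_aestronglyMeasurable integrableOn_airyAmplitudeDeriv.1))
      (.of_forall fun r => (hdom r).le)
  have hE : Tendsto (fun R => cexp (I * ((l * airyPhaseRoot R ^ 2 : ℝ) : ℂ)) *
      (airyAmplitude R : ℂ)) atTop (nhds 0) := by
    rw [tendsto_zero_iff_norm_tendsto_zero]
    simpa [hnorm, -ofReal_mul, -ofReal_pow] using tendsto_airyAmplitude_atTop.norm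
  have hlim := ((hF.comp tendsto_airyPhaseRoot_atTop).const_add
    (∫ v in (0 : ℝ)..√(2 / 3), cexp (I * ((l * v ^ 2 : ℝ) : ℂ)))).add
    (((hE.sub_const (cexp (I * ((l * airyPhaseRoot √(2 / 3) ^ 2 : ℝ) : ℂ)) *
      (airyAmplitude √(2 / 3) : ℂ))).sub
    (intervalIntegral_tendsto_integral_Ioi _ hint tendsto_id)).const_mul (I * (l : ℂ))⁻¹)
  refine ⟨_, hlim.congr' ?_, ?_⟩
  · filter_upwards [eventually_ge_atTop √(2 / 3)] with R hR
    rw [integral_cexp_airyPhaseRoot hl hR, airyPhaseRoot_sqrt_two_thirds,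
      ← intervalIntegral.integral_add_adjacent_intervals (a := -√(2 / 3)) (b := 0)
        (hcont.intervalIntegrable _ _) (hcont.intervalIntegrable _ _), hneg]
    rfl
  · have h1 := norm_integral_cexp_I_mul_sq_sub_le hl (W := √(2 / 3)) (by positivity)
    rw [← hL] at h1
    have h2 : ‖∫ r in Set.Ioi √(2 / 3), cexp (I * ((l * airyPhaseRoot r ^ 2 : ℝ) : ℂ)) *
        (airyAmplitudeDeriv r : ℂ)‖ ≤ ∫ r in Set.Ioi √(2 / 3), |airyAmplitudeDeriv r| :=
      (norm_integral_le_integral_norm _).trans_eq (integral_congr_ae (.of_forall hdom))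
    have h3 : ‖cexp (I * ((l * airyPhaseRoot √(2 / 3) ^ 2 : ℝ) : ℂ)) *
        (airyAmplitude √(2 / 3) : ℂ)‖ ≤ |airyAmplitude √(2 / 3)| := by
      rw [norm_mul, hnorm, one_mul, norm_real, Real.norm_eq_abs]
    have h4 : ‖(I * (l : ℂ))⁻¹‖ = 1 / l := by simp [abs_of_pos hl]
    have hsplit : ∀ a b c d : ℂ, a + L / 2 + d * (0 - b - c) - L = (a - L / 2) - d * (b + c) :=
      fun a b c d => by ring
    rw [hsplit]
    refine (norm_sub_le_of_le h1 ((norm_mul_le _ _).trans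
      (mul_le_mul h4.le (norm_add_le_of_le h3 h2) (norm_nonneg _) (by positivity)))).trans_eq ?_
    field_simp
    ring

open Complex in
theorem integral_cexp_airy_phase (s R : ℝ) :
    ∫ x in (0 : ℝ)..s * (3 * R ^ 2 - 2), cexp (I * ((x ^ 3 / 3 + -s ^ 2 * x : ℝ) : ℂ)) =
      s * cexp (I * ((-(2 / 3 * s ^ 3) : ℝ) : ℂ)) * ∫ r in √(2 / 3)..R,
        cexp (I * ((s ^ 3 * airyPhaseRoot r ^ 2 : ℝ) : ℂ)) * ((6 * r : ℝ) : ℂ) := by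
  have hsubst := intervalIntegral.integral_deriv_smul_comp (a := √(2 / 3)) (b := R)
    (g := fun x : ℝ => cexp (I * ((x ^ 3 / 3 + -s ^ 2 * x : ℝ) : ℂ)))
    (f := fun r => s * (3 * r ^ 2 - 2)) (f' := fun r => s * (6 * r))
    (fun r _ => by
      refine ((((hasDerivAt_pow 2 r).const_mul 3).sub_const 2).const_mul s).congr_deriv ?_
      push_cast
      ring) (by fun_prop) (by fun_prop)
  have h0 : s * (3 * √(2 / 3) ^ 2 - 2) = 0 := by
    rw [Real.sq_sqrt (by norm_num)]; norm_num
  rw [h0] at hsubst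
  rw [← hsubst, ← intervalIntegral.integral_const_mul]
  refine intervalIntegral.integral_congr fun r _ => ?_
  have hphase : (s * (3 * r ^ 2 - 2)) ^ 3 / 3 + -s ^ 2 * (s * (3 * r ^ 2 - 2)) =
      -(2 / 3 * s ^ 3) + s ^ 3 * airyPhaseRoot r ^ 2 := by
    rw [airyPhaseRoot]; ring
  simp only [Function.comp, real_smul]
  rw [hphase, ofReal_add, mul_add, Complex.exp_add, ofReal_mul s]
  ring

open Complex in
theorem integral_cexp_odd_phase (c A : ℝ) :
    ∫ x in (-A)..A, cexp (I * ((x ^ 3 / 3 + c * x : ℝ) : ℂ)) =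
      ((2 * (∫ x in (0 : ℝ)..A, cexp (I * ((x ^ 3 / 3 + c * x : ℝ) : ℂ))).re : ℝ) : ℂ) := by
  have hcont : Continuous fun x : ℝ => cexp (I * ((x ^ 3 / 3 + c * x : ℝ) : ℂ)) := by fun_prop
  have hneg : ∫ x in (-A)..0, cexp (I * ((x ^ 3 / 3 + c * x : ℝ) : ℂ)) =
      (starRingEnd ℂ) (∫ x in (0 : ℝ)..A, cexp (I * ((x ^ 3 / 3 + c * x : ℝ) : ℂ))) := by
    rw [← neg_zero, ← intervalIntegral.integral_comp_neg, neg_zero,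
      ← intervalIntegral.intervalIntegral_conj]
    refine intervalIntegral.integral_congr fun x _ => ?_
    simp only [← Complex.exp_conj, map_mul, conj_I, conj_ofReal]
    congr 1
    push_cast
    ring
  rw [← intervalIntegral.integral_add_adjacent_intervals (hcont.intervalIntegrable (-A) 0)
    (hcont.intervalIntegrable _ _), hneg, add_comm, add_conj]

open Complex in
theorem airy_neg_sq_eq {s : ℝ} (hs : 0 < s) {J : ℂ}
    (hJ : Tendsto (fun R : ℝ => ∫ r in √(2 / 3)..R,
      cexp (I * ((s ^ 3 * airyPhaseRoot r ^ 2 : ℝ) : ℂ)) * ((6 * r : ℝ) : ℂ)) atTop (nhds J)) :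
    airy (-s ^ 2) =
      ((1 / π * (s * cexp (I * ((-(2 / 3 * s ^ 3) : ℝ) : ℂ)) * J).re : ℝ) : ℂ) := by
  have hR : Tendsto (fun A : ℝ => √((A / s + 2) / 3)) atTop atTop :=
    tendsto_sqrt_atTop.comp ((tendsto_atTop_add_const_right _ 2
      (tendsto_id.atTop_div_const hs)).atTop_div_const (by norm_num))
  have hhalf : Tendsto (fun A : ℝ => ∫ x in (0 : ℝ)..A,
      cexp (I * ((x ^ 3 / 3 + -s ^ 2 * x : ℝ) : ℂ))) atTop
      (nhds (s * cexp (I * ((-(2 / 3 * s ^ 3) : ℝ) : ℂ)) * J)) := by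
    refine ((hJ.comp hR).const_mul _).congr' ?_
    filter_upwards [eventually_ge_atTop 0] with A hA
    rw [Function.comp, ← integral_cexp_airy_phase, Real.sq_sqrt (by positivity)]
    congr 1
    field_simp
    ring
  refine Tendsto.limUnder_eq ?_
  simp_rw [integral_cexp_odd_phase]
  have hlim := ((continuous_ofReal.comp continuous_re).tendsto _).comp hhalf
  refine (hlim.const_mul ((1 / π : ℝ) : ℂ)).congr' (.of_forall fun A => ?_) |>.trans_eq ?_
  · simp only [Function.comp]
    push_cast
    field_simp
  · rw [ofReal_mul]
    rfl

open Complex in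
theorem airy_main_term_eq {s : ℝ} (hs : 0 < s) :
    1 / π * (s * cexp (I * ((-(2 / 3 * s ^ 3) : ℝ) : ℂ)) *
      ((√(π / s ^ 3) : ℂ) * cexp (I * ((π / 4 : ℝ) : ℂ)))).re =
    π ^ (-(1 : ℝ) / 2) * (s ^ 2) ^ (-(1 : ℝ) / 4) *
      Real.cos (2 / 3 * (s ^ 2) ^ ((3 : ℝ) / 2) - π / 4) := by
  have hpow : ∀ a : ℝ, (s ^ 2) ^ a = s ^ (2 * a) := fun a => by
    rw [← Real.rpow_natCast, ← Real.rpow_mul hs.le, Nat.cast_ofNat]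
  have hprod : (s * cexp (I * ((-(2 / 3 * s ^ 3) : ℝ) : ℂ)) *
      ((√(π / s ^ 3) : ℂ) * cexp (I * ((π / 4 : ℝ) : ℂ)))) =
      ((s * √(π / s ^ 3) : ℝ) : ℂ) * cexp ((-(2 / 3 * s ^ 3 - π / 4) : ℝ) * I) := by
    rw [mul_mul_mul_comm, ← Complex.exp_add, ofReal_mul]
    congr 2
    push_cast
    ring
  have hthree : (s ^ 2) ^ ((3 : ℝ) / 2) = s ^ 3 := by
    rw [hpow, ← Real.rpow_natCast]; norm_num
  rw [hprod, re_ofReal_mul, exp_ofReal_mul_I_re, Real.cos_neg, hthree, ← mul_assoc, hpow]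
  congr 1
  have hpi := Real.pi_pos
  rw [Real.sqrt_eq_rpow, Real.div_rpow hpi.le (by positivity), ← Real.rpow_natCast s 3,
    ← Real.rpow_mul hs.le, one_div π, ← Real.rpow_neg_one π]
  calc _ = (π ^ (-1 : ℝ) * π ^ (1 / 2 : ℝ)) * (s ^ (1 : ℝ) * (s ^ (((3 : ℕ) : ℝ) * (1 / 2)))⁻¹) := by
        rw [Real.rpow_one]; ring
    _ = _ := by
        rw [← Real.rpow_neg hs.le, ← Real.rpow_add hpi, ← Real.rpow_add hs]
        norm_num

/-- Asymptotics of the Airy function: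
`Ai(−t) = π^{-1/2} t^{-1/4} cos((2/3)t^{3/2} − π/4)(1 + O(t^{-3/4}))` as `t → ∞`. -/
theorem stmt7 :
    ∃ C > 0, ∃ t₀ > 0, ∀ t : ℝ, t₀ ≤ t →
      ‖airy (-t) - ((π ^ (-(1:ℝ)/2) * t ^ (-(1:ℝ)/4) *
          Real.cos ((2/3) * t ^ ((3:ℝ)/2) - π/4) : ℝ) : ℂ)‖ ≤
        C * t ^ (-(1:ℝ)/4) * t ^ (-(3:ℝ)/4) := by
  obtain ⟨C, hC, h⟩ := exists_tendsto_integral_cexp_airyPhaseRoot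
  refine ⟨C / π, div_pos hC Real.pi_pos, 1, one_pos, fun t ht => ?_⟩
  have htpos : 0 < t := one_pos.trans_le ht
  obtain ⟨s, hs, rfl⟩ : ∃ s : ℝ, 0 < s ∧ t = s ^ 2 :=
    ⟨√t, Real.sqrt_pos.2 htpos, (Real.sq_sqrt htpos.le).symm⟩
  obtain ⟨J, hJ, hbound⟩ := h (s ^ 3) (by positivity)
  have hunit : ‖Complex.exp (Complex.I * ((-(2 / 3 * s ^ 3) : ℝ) : ℂ))‖ = 1 := by
    rw [mul_comm]; exact Complex.norm_exp_ofReal_mul_I _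
  rw [airy_neg_sq_eq hs hJ, ← airy_main_term_eq hs, ← Complex.ofReal_sub, Complex.norm_real,
    ← mul_sub, ← Complex.sub_re, ← mul_sub, norm_mul, Real.norm_of_nonneg (by positivity),
    mul_assoc (C / π), ← Real.rpow_add htpos]
  have hexponent : (s ^ 2) ^ (-(1 : ℝ) / 4 + -(3 : ℝ) / 4) = (s ^ 2)⁻¹ := by
    rw [← Real.rpow_neg_one]; norm_num
  rw [hexponent]
  calc _ ≤ 1 / π * (s * (C / s ^ 3)) := by
        gcongr
        refine (Complex.abs_re_le_norm _).trans ?_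
        rw [norm_mul, norm_mul, hunit, mul_one, Complex.norm_real, Real.norm_of_nonneg hs.le]
        gcongr
    _ = C / π * (s ^ 2)⁻¹ := by field_simp
end

section
/- Let γ ∈ C²(I) on a compact interval I ⊂ ℝ with values in ℝ^d, d ≥ 2, with γ'(t) and γ''(t) linearly independent for every t ∈ I, and suppose there is N ∈ ℕ such that for every ω ∈ S^{d-1} the function s ↦ ⟨ω, γ''(s)⟩ changes sign at most N times on I. Let χ ∈ C^∞ be supported in the interior of I and let μ̂(ξ) = ∫ e^{-i⟨ξ,γ(t)⟩} χ(t) dt. Then for 2 ≤ q < 4 there is C such that (∫_{S^{d-1}} |μ̂(Rω)|^q dω)^{1/q} ≤ C R^{-1/2} for all R ≥ 2. -/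
open Real MeasureTheory
open scoped RealInnerProductSpace

/-- `f` changes sign at most `N` times on `I`. -/
def ChangesSignAtMost (f : ℝ → ℝ) (I : Set ℝ) (N : ℕ) : Prop :=
  ¬ ∃ t : Fin (N + 2) → ℝ, StrictMono t ∧ (∀ i, t i ∈ I) ∧
      ∀ i : Fin (N + 1), f (t i.castSucc) * f (t i.succ) < 0

theorem norm_normalize_sub_le {E : Type*} [NormedAddCommGroup E] [NormedSpace ℝ E] {κ : ℝ}
    (hκ : 0 < κ) {x y : E} (hx : κ ≤ ‖x‖) (hy : y ≠ 0) :
    ‖‖x‖⁻¹ • x - ‖y‖⁻¹ • y‖ ≤ 2 * κ⁻¹ * ‖x - y‖ := by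
  have hx0 : 0 < ‖x‖ := hκ.trans_le hx
  have hy0 : 0 < ‖y‖ := norm_pos_iff.2 hy
  have hsplit : ‖x‖⁻¹ • x - ‖y‖⁻¹ • y = ‖x‖⁻¹ • (x - y) + (‖x‖⁻¹ - ‖y‖⁻¹) • y := by
    module
  have hsecond : ‖(‖x‖⁻¹ - ‖y‖⁻¹) • y‖ ≤ ‖x‖⁻¹ * ‖x - y‖ := by
    have h : ‖x‖⁻¹ - ‖y‖⁻¹ = ‖x‖⁻¹ * (‖y‖ - ‖x‖) * ‖y‖⁻¹ := by field_simp
    rw [h, norm_smul, norm_mul, norm_mul, norm_inv, norm_inv, norm_norm, norm_norm, mul_assoc,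
      inv_mul_cancel₀ hy0.ne', mul_one]
    gcongr
    rw [norm_sub_rev x y]
    exact abs_norm_sub_norm_le y x
  rw [hsplit]
  calc _ ≤ ‖x‖⁻¹ * ‖x - y‖ + ‖x‖⁻¹ * ‖x - y‖ := by
        refine (norm_add_le _ _).trans (add_le_add ?_ hsecond)
        rw [norm_smul, norm_inv, norm_norm]
    _ = 2 * ‖x‖⁻¹ * ‖x - y‖ := by ring
    _ ≤ _ := by gcongr

/-- The radial projection of a face of the cube, read in linear coordinates `L`. -/
theorem lipschitzWith_normalize_face {n : ℕ} {E : Type*} [NormedAddCommGroup E] [NormedSpace ℝ E]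
    (L : (Fin (n + 1) → ℝ) →ₗ[ℝ] E) {K : NNReal}
    (hL : ∀ z, ‖L z‖ ≤ K * ‖z‖) (hL' : ∀ z, ‖z‖ ≤ K * ‖L z‖) (hK : 0 < K)
    (i : Fin (n + 1)) {ε : ℝ} (hε : |ε| = 1) :
    LipschitzWith (2 * K * K) fun y : Fin n → ℝ =>
      ‖L (i.insertNth ε y)‖⁻¹ • L (i.insertNth (α := fun _ => ℝ) ε y) := by
  have hK' : (0 : ℝ) < K := hK
  have hlow : ∀ y : Fin n → ℝ, (K : ℝ)⁻¹ ≤ ‖L (i.insertNth ε y)‖ := by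
    intro y
    have h1 : 1 ≤ ‖(i.insertNth ε y : Fin (n + 1) → ℝ)‖ := by
      have := norm_le_pi_norm (i.insertNth ε y : Fin (n + 1) → ℝ) i
      rwa [Fin.insertNth_apply_same, Real.norm_eq_abs, hε] at this
    rw [inv_le_iff_one_le_mul₀ hK', mul_comm]
    exact h1.trans (hL' _)
  refine LipschitzWith.of_dist_le_mul fun x y => ?_
  have hne : L (i.insertNth ε y) ≠ 0 :=
    norm_pos_iff.1 ((inv_pos.2 hK').trans_le (hlow y))
  rw [dist_eq_norm]
  refine (norm_normalize_sub_le (inv_pos.2 hK') (hlow x) hne).trans ?_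
  have hdiff : ‖L (i.insertNth ε x) - L (i.insertNth ε y)‖ ≤ K * dist x y := by
    rw [← map_sub]
    refine (hL _).trans ?_
    gcongr
    refine (pi_norm_le_iff_of_nonneg dist_nonneg).2 fun k => ?_
    refine Fin.succAboveCases i ?_ (fun j => ?_) k
    · simp
    · simpa [dist_eq_norm] using norm_le_pi_norm (x - y) j
  rw [inv_inv]
  push_cast
  calc 2 * (K : ℝ) * ‖L (i.insertNth ε x) - L (i.insertNth ε y)‖
      ≤ 2 * K * (K * dist x y) := by gcongr
    _ = _ := by ring

theorem hausdorffMeasure_sphere_box_le {n : ℕ}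
    {E : Type*} [NormedAddCommGroup E] [NormedSpace ℝ E] [MeasurableSpace E] [BorelSpace E]
    (L : (Fin (n + 1) → ℝ) ≃ₗ[ℝ] E) {K : NNReal}
    (hL : ∀ z, ‖L z‖ ≤ K * ‖z‖) (hL' : ∀ z, ‖z‖ ≤ K * ‖L z‖) (hK : 0 < K)
    (c : Fin (n + 1) → ℝ) (hc : ∀ k, 0 ≤ c k) :
    μH[(n : ℝ)] {ω : E | ‖ω‖ = 1 ∧ ∀ k, |L.symm ω k| ≤ c k * ‖L.symm ω‖} ≤
      ENNReal.ofReal (2 * (n + 1) * (4 * K * K) ^ n * ∏ k, c k) := by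
  classical
  set face : Fin (n + 1) → ℝ → (Fin n → ℝ) → E := fun i ε y =>
    ‖L (i.insertNth ε y)‖⁻¹ • L (i.insertNth (α := fun _ => ℝ) ε y) with hface
  set box : Fin (n + 1) → Set (Fin n → ℝ) := fun i =>
    Set.Icc (fun j => -c (i.succAbove j)) (fun j => c (i.succAbove j)) with hbox
  set I : Finset (Fin (n + 1) × ℝ) := (Finset.univ.filter fun i => 1 ≤ c i) ×ˢ {1, -1} with hI
  have hcover : {ω : E | ‖ω‖ = 1 ∧ ∀ k, |L.symm ω k| ≤ c k * ‖L.symm ω‖} ⊆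
      ⋃ p ∈ I, face p.1 p.2 '' box p.1 := by
    rintro ω ⟨hω, hωc⟩
    set z := L.symm ω with hz
    have hz0 : z ≠ 0 := by
      intro h
      have : ω = 0 := by simpa [hz] using h
      simp [this] at hω
    obtain ⟨i, -, hi⟩ := Finset.exists_max_image Finset.univ (fun k => |z k|) Finset.univ_nonempty
    have hzi : ‖z‖ = |z i| := le_antisymm
      ((pi_norm_le_iff_of_nonneg (abs_nonneg _)).2 fun k => hi k (Finset.mem_univ k))
      (norm_le_pi_norm z i)
    have hpos : 0 < |z i| := hzi ▸ norm_pos_iff.2 hz0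
    have hci : 1 ≤ c i := by
      have := hωc i
      rw [hzi] at this
      exact le_of_mul_le_mul_right (by simpa using this) hpos
    have hzL : L z = ω := by simp [hz]
    refine Set.mem_iUnion₂.2 ⟨(i, z i / |z i|), ?_, fun j => z (i.succAbove j) / |z i|, ?_, ?_⟩
    · simp only [hI, Finset.mem_product, Finset.mem_filter, Finset.mem_univ, true_and,
        Finset.mem_insert, Finset.mem_singleton]
      refine ⟨hci, ?_⟩
      rcases abs_choice (z i) with h | h
      · left; rw [h, div_self]; exact abs_pos.1 hpos
      · right; rw [h, div_neg, div_self]; exact abs_pos.1 hpos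
    · have habs : ∀ j, abs (z (i.succAbove j) / |z i|) ≤ c (i.succAbove j) := fun j => by
        rw [abs_div, abs_abs, div_le_iff₀ hpos, ← hzi]
        exact hωc _
      exact ⟨fun j => (abs_le.1 (habs j)).1, fun j => (abs_le.1 (habs j)).2⟩
    · have hins : (i.insertNth (z i / |z i|) fun j => z (i.succAbove j) / |z i| :
          Fin (n + 1) → ℝ) = |z i|⁻¹ • z := by
        funext k
        refine Fin.succAboveCases i ?_ (fun j => ?_) k <;> simp [div_eq_inv_mul]
      simp only [hface, hins, map_smul, hzL, norm_smul, hω, norm_inv, Real.norm_eq_abs, abs_abs,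
        mul_one, inv_inv, smul_smul]
      rw [mul_inv_cancel₀ hpos.ne', one_smul]
  have hpiece : ∀ p ∈ I, μH[(n : ℝ)] (face p.1 p.2 '' box p.1) ≤
      ENNReal.ofReal ((4 * K * K) ^ n * ∏ k, c k) := by
    rintro ⟨i, ε⟩ hp
    simp only [hI, Finset.mem_product, Finset.mem_filter, Finset.mem_univ, true_and,
      Finset.mem_insert, Finset.mem_singleton] at hp
    have hε : |ε| = 1 := by rcases hp.2 with h | h <;> simp [h]
    have hlip := (lipschitzWith_normalize_face L.toLinearMap hL hL' hK i hε).hausdorffMeasure_image_le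
      (d := n) (Nat.cast_nonneg n) (box i)
    refine hlip.trans ?_
    have hvol : μH[(n : ℝ)] (box i) ≤ ENNReal.ofReal (2 ^ n * ∏ k, c k) := by
      have h := hausdorffMeasure_pi_real (ι := Fin n)
      rw [Fintype.card_fin] at h
      rw [h, hbox, Real.volume_Icc_pi,
        ← ENNReal.ofReal_prod_of_nonneg fun j _ => by linarith [hc (i.succAbove j)]]
      apply ENNReal.ofReal_le_ofReal
      have h2 : ∀ j : Fin n, c (i.succAbove j) - -c (i.succAbove j) = 2 * c (i.succAbove j) :=
        fun j => by ring
      simp only [h2, Finset.prod_mul_distrib, Finset.prod_const, Finset.card_univ,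
        Fintype.card_fin]
      rw [Fin.prod_univ_succAbove c i]
      gcongr
      exact le_mul_of_one_le_left (Finset.prod_nonneg fun _ _ => hc _) hp.1
    calc _ ≤ ((2 * K * K : NNReal) : ENNReal) ^ (n : ℝ) * ENNReal.ofReal (2 ^ n * ∏ k, c k) := by
          gcongr
      _ = ENNReal.ofReal ((2 * K * K) ^ n) * ENNReal.ofReal (2 ^ n * ∏ k, c k) := by
          rw [ENNReal.rpow_natCast, ENNReal.ofReal_pow (by positivity), ← ENNReal.ofReal_coe_nnreal]
          push_cast
          rfl
      _ = _ := by
          rw [← ENNReal.ofReal_mul (by positivity)]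
          congr 1
          rw [show (4 * (K : ℝ) * K) = (2 * K * K) * 2 by ring, mul_pow (2 * (K : ℝ) * K) 2]
          ring
  refine (measure_mono hcover).trans ((measure_biUnion_finset_le _ _).trans ?_)
  refine (Finset.sum_le_card_nsmul _ _ _ hpiece).trans ?_
  have hcard : (I.card : ℝ) ≤ 2 * (n + 1) := by
    have h1 : I.card ≤ (n + 1) * 2 := by
      rw [hI, Finset.card_product]
      refine Nat.mul_le_mul ((Finset.card_filter_le _ _).trans (by simp)) Finset.card_le_two
    have h2 : (I.card : ℝ) ≤ ((n + 1) * 2 : ℕ) := by exact_mod_cast h1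
    push_cast at h2
    linarith
  rw [nsmul_eq_mul, ← ENNReal.ofReal_natCast, ← ENNReal.ofReal_mul (Nat.cast_nonneg _)]
  apply ENNReal.ofReal_le_ofReal
  have hP : 0 ≤ ∏ k, c k := Finset.prod_nonneg fun k _ => hc k
  calc (I.card : ℝ) * ((4 * K * K) ^ n * ∏ k, c k)
      ≤ (2 * (n + 1)) * ((4 * K * K) ^ n * ∏ k, c k) := by gcongr
    _ = _ := by ring

theorem exists_linearIndependent_extend_pair {E : Type*} [AddCommGroup E] [Module ℝ E]
    {u w : E} (h : LinearIndependent ℝ ![u, w]) (m : ℕ) (hm : m + 2 ≤ Module.finrank ℝ E) :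
    ∃ b : Fin (m + 2) → E, LinearIndependent ℝ b ∧ b 0 = u ∧ b 1 = w := by
  induction m with
  | zero => exact ⟨_, h, rfl, rfl⟩
  | succ m ih =>
    obtain ⟨b, hb, h0, h1⟩ := ih (by omega)
    obtain ⟨x, hx⟩ := exists_linearIndependent_snoc_of_lt_finrank hb (by omega)
    refine ⟨_, hx, ?_, ?_⟩
    · rw [← h0]; exact Fin.snoc_castSucc (α := fun _ => E) x b 0
    · rw [← h1]; exact Fin.snoc_castSucc (α := fun _ => E) x b 1

/-- Two slabs with nearly fixed, linearly independent normals meet the unit sphere in a set of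
size at most the product of their widths. -/
theorem exists_hausdorffMeasure_sphere_slabs_le {E : Type*} [NormedAddCommGroup E]
    [InnerProductSpace ℝ E] [FiniteDimensional ℝ E] [MeasurableSpace E] [BorelSpace E] {m : ℕ}
    (hm : Module.finrank ℝ E = m + 2) {u₀ w₀ : E} (h : LinearIndependent ℝ ![u₀, w₀]) :
    ∃ ε > 0, ∃ C ≥ 0, ∀ u w : E, ‖u - u₀‖ ≤ ε → ‖w - w₀‖ ≤ ε → ∀ x y : ℝ, 0 ≤ x → 0 ≤ y →
      μH[((m + 1 : ℕ) : ℝ)] {ω : E | ‖ω‖ = 1 ∧ |⟪ω, u⟫| ≤ x ∧ |⟪ω, w⟫| ≤ y} ≤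
        ENNReal.ofReal (C * (x * y)) := by
  obtain ⟨b, hb, hb0, hb1⟩ := exists_linearIndependent_extend_pair h m hm.ge
  have hspan := hb.span_eq_top_of_card_eq_finrank (by simp [hm])
  let T (v : Fin (m + 2) → E) : E →ₗ[ℝ] (Fin (m + 2) → ℝ) := LinearMap.pi fun k => innerₛₗ ℝ (v k)
  have hT : ∀ v ω k, T v ω k = ⟪v k, ω⟫ := fun v ω k => rfl
  have hker : (T b).ker = ⊥ := by
    refine LinearMap.ker_eq_bot'.2 fun ω hω => ?_
    have hmem : ω ∈ (Submodule.span ℝ (Set.range b))ᗮ := by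
      rw [Submodule.mem_orthogonal]
      intro v hv
      induction hv using Submodule.span_induction with
      | mem v hv =>
        obtain ⟨k, rfl⟩ := hv
        exact congrFun hω k
      | zero => simp
      | add v v' _ _ h h' => rw [inner_add_left, h, h', add_zero]
      | smul r v _ h => rw [inner_smul_left, h, mul_zero]
    simpa [hspan] using hmem
  obtain ⟨K₀, hK₀, hanti⟩ := (T b).exists_antilipschitzWith hker
  have hK₀' : (0 : ℝ) < K₀ := hK₀
  set ε : ℝ := (2 * K₀)⁻¹ with hε
  have hε0 : 0 < ε := by positivity
  set K : NNReal := 2 * K₀ + ∑ k, ‖b k‖₊ + (2 * K₀)⁻¹ with hKdef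
  have hK0 : 0 < K := by positivity
  have hKr : (K : ℝ) = 2 * K₀ + ∑ k, ‖b k‖ + ε := by simp [hKdef, hε]
  have hsum0 : 0 ≤ ∑ k, ‖b k‖ := Finset.sum_nonneg fun _ _ => norm_nonneg _
  refine ⟨ε, hε0, 2 * ((m + 1 : ℕ) + 1) * (4 * K * K) ^ (m + 1) * (K * K), by positivity, ?_⟩
  intro u w hu hw x y hx hy
  set v : Fin (m + 2) → E := Function.update (Function.update b 0 u) 1 w with hv
  have hv0 : v 0 = u := by
    rw [hv, Function.update_of_ne (by simp), Function.update_self]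
  have hv1 : v 1 = w := by rw [hv, Function.update_self]
  have hvb : ∀ k, ‖v k - b k‖ ≤ ε := by
    intro k
    by_cases h1 : k = 1
    · subst h1; rwa [hv1, hb1]
    · by_cases h0 : k = 0
      · subst h0; rwa [hv0, hb0]
      · rw [hv, Function.update_of_ne h1, Function.update_of_ne h0]; simpa using hε0.le
  have hdiff : ∀ ω, ‖T v ω - T b ω‖ ≤ ε * ‖ω‖ := by
    intro ω
    refine (pi_norm_le_iff_of_nonneg (by positivity)).2 fun k => ?_
    rw [Pi.sub_apply, hT, hT, ← inner_sub_left]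
    exact (norm_inner_le_norm _ _).trans (by gcongr; exact hvb k)
  have hlow : ∀ ω, ‖ω‖ ≤ K * ‖T v ω‖ := by
    intro ω
    have h1 : ‖ω‖ ≤ K₀ * ‖T b ω‖ := by simpa using hanti.le_mul_dist ω 0
    have h2 : ‖T b ω‖ ≤ ‖T v ω‖ + ε * ‖ω‖ := by
      have := norm_sub_norm_le (T b ω) (T v ω)
      rw [norm_sub_rev] at this
      linarith [hdiff ω]
    have h3 : (K₀ : ℝ) * (ε * ‖ω‖) = ‖ω‖ / 2 := by rw [hε]; field_simp
    have h4 : ‖ω‖ ≤ 2 * K₀ * ‖T v ω‖ := by nlinarith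
    refine h4.trans (mul_le_mul_of_nonneg_right ?_ (norm_nonneg _))
    rw [hKr]; linarith
  have hup : ∀ ω, ‖T v ω‖ ≤ K * ‖ω‖ := by
    intro ω
    refine (pi_norm_le_iff_of_nonneg (by positivity)).2 fun k => ?_
    rw [hT]
    refine (norm_inner_le_norm _ _).trans (mul_le_mul_of_nonneg_right ?_ (norm_nonneg _))
    have h1 : ‖v k‖ ≤ ‖b k‖ + ε := by
      linarith [norm_sub_norm_le (v k) (b k), hvb k]
    have h2 : ‖b k‖ ≤ ∑ k, ‖b k‖ :=
      Finset.single_le_sum (f := fun k => ‖b k‖) (fun _ _ => norm_nonneg _) (Finset.mem_univ k)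
    rw [hKr]; linarith
  have hinj : Function.Injective (T v) := by
    refine (injective_iff_map_eq_zero _).2 fun ω hω => ?_
    have := hlow ω
    rw [hω, norm_zero, mul_zero] at this
    exact norm_le_zero_iff.1 this
  set e := LinearMap.linearEquivOfInjective (T v) hinj (by simp [hm]) with he
  have heT : ∀ ω, e ω = T v ω := fun ω => rfl
  set c : Fin (m + 1 + 1) → ℝ := fun k => if k = 0 then K * x else if k = 1 then K * y else 1 with hc
  have hcprod : ∏ k, c k = (K * K) * (x * y) := by
    rw [Fin.prod_univ_succ, Fin.prod_univ_succ]
    have : ∀ k : Fin m, c k.succ.succ = 1 := fun k => by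
      have h1 : k.succ.succ ≠ 1 := by
        rw [← Fin.succ_zero_eq_one]; exact fun h => Fin.succ_ne_zero _ (Fin.succ_injective _ h)
      simp only [hc, if_neg (Fin.succ_ne_zero k.succ), if_neg h1]
    simp only [this, Finset.prod_const_one, mul_one]
    simp [hc]
    ring
  have hbox := hausdorffMeasure_sphere_box_le (n := m + 1) e.symm (K := K)
    (fun z => by simpa [← heT] using hlow (e.symm z))
    (fun z => by simpa [← heT] using hup (e.symm z)) hK0 c
    (fun k => by simp only [hc]; split_ifs <;> positivity)
  rw [hcprod] at hbox
  refine (measure_mono ?_).trans (hbox.trans (ENNReal.ofReal_le_ofReal (le_of_eq (by ring))))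
  rintro ω ⟨hω, hωu, hωw⟩
  refine ⟨hω, fun k => ?_⟩
  rw [LinearEquiv.symm_symm, heT]
  have hone : 1 ≤ K * ‖T v ω‖ := hω ▸ hlow ω
  simp only [hc]
  split_ifs with h0 h1
  · rw [h0, hT, hv0, real_inner_comm]; nlinarith
  · rw [h1, hT, hv1, real_inner_comm]; nlinarith
  · rw [one_mul]; exact norm_le_pi_norm (T v ω) k

theorem exists_hausdorffMeasure_sphere_near_le {E : Type*} [NormedAddCommGroup E]
    [InnerProductSpace ℝ E] [FiniteDimensional ℝ E] [MeasurableSpace E] [BorelSpace E] {m : ℕ}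
    (hm : Module.finrank ℝ E = m + 2) {g : ℝ → E} (hg : ContDiff ℝ 1 g) {a b : ℝ}
    (hind : ∀ t ∈ Set.Icc a b, LinearIndependent ℝ ![g t, deriv g t]) :
    ∃ δ > 0, ∃ C ≥ 0, ∀ s ∈ Set.Icc a b, ∀ t, s < t → t ≤ s + δ → ∀ r : ℝ, 0 ≤ r →
      μH[((m + 1 : ℕ) : ℝ)] {ω : E | ‖ω‖ = 1 ∧ |⟪ω, g s⟫| ≤ r ∧ |⟪ω, g t⟫| ≤ r} ≤
        ENNReal.ofReal (C * (r ^ 2 / (t - s))) := by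
  refine isCompact_Icc.induction_on (p := fun S : Set ℝ => ∃ δ > 0, ∃ C ≥ 0, ∀ s ∈ S, ∀ t, s < t →
    t ≤ s + δ → ∀ r : ℝ, 0 ≤ r →
      μH[((m + 1 : ℕ) : ℝ)] {ω : E | ‖ω‖ = 1 ∧ |⟪ω, g s⟫| ≤ r ∧ |⟪ω, g t⟫| ≤ r} ≤
        ENNReal.ofReal (C * (r ^ 2 / (t - s)))) ?_ ?_ ?_ ?_
  · exact ⟨1, one_pos, 0, le_rfl, by simp⟩
  · rintro S S' hSS' ⟨δ, hδ, C, hC, h⟩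
    exact ⟨δ, hδ, C, hC, fun s hs => h s (hSS' hs)⟩
  · rintro S S' ⟨δ, hδ, C, hC, h⟩ ⟨δ', hδ', C', hC', h'⟩
    refine ⟨min δ δ', lt_min hδ hδ', max C C', le_max_of_le_left hC, ?_⟩
    intro s hs t hst ht r hr
    have hpos : 0 ≤ r ^ 2 / (t - s) := div_nonneg (sq_nonneg r) (sub_nonneg.2 hst.le)
    rcases hs with hs | hs
    · refine (h s hs t hst (ht.trans (by gcongr; exact min_le_left _ _)) r hr).trans ?_
      exact ENNReal.ofReal_le_ofReal (mul_le_mul_of_nonneg_right (le_max_left _ _) hpos)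
    · refine (h' s hs t hst (ht.trans (by gcongr; exact min_le_right _ _)) r hr).trans ?_
      exact ENNReal.ofReal_le_ofReal (mul_le_mul_of_nonneg_right (le_max_right _ _) hpos)
  · intro τ hτ
    obtain ⟨ε, hε, C, hC, h⟩ := exists_hausdorffMeasure_sphere_slabs_le hm (hind τ hτ)
    have hstrict := (hg.hasStrictDerivAt (x := τ) one_ne_zero).hasStrictFDerivAt.isLittleO.def hε
    obtain ⟨δ₁, hδ₁, h₁⟩ := Metric.eventually_nhds_iff_ball.1 hstrict
    obtain ⟨δ₂, hδ₂, h₂⟩ := Metric.eventually_nhds_iff_ball.1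
      (hg.continuous.continuousAt.eventually (Metric.closedBall_mem_nhds (g τ) hε))
    set δ := min δ₁ δ₂ / 2 with hδ
    have hδ0 : 0 < δ := half_pos (lt_min hδ₁ hδ₂)
    refine ⟨Metric.ball τ δ, mem_nhdsWithin_of_mem_nhds (Metric.ball_mem_nhds τ hδ0), δ, hδ0,
      2 * C, by positivity, ?_⟩
    intro s hs t hst ht r hr
    have hts : 0 < t - s := sub_pos.2 hst
    rw [Metric.mem_ball, Real.dist_eq, abs_lt] at hs
    have hmin₁ := min_le_left δ₁ δ₂
    have hmin₂ := min_le_right δ₁ δ₂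
    have hu : ‖g s - g τ‖ ≤ ε := by
      have := h₂ s (by rw [Metric.mem_ball, Real.dist_eq, abs_lt]; constructor <;> linarith)
      rwa [dist_eq_norm] at this
    have hw : ‖(t - s)⁻¹ • (g t - g s) - deriv g τ‖ ≤ ε := by
      have := h₁ (t, s) (by
        rw [← ball_prod_same, Set.mem_prod, Metric.mem_ball, Metric.mem_ball, Real.dist_eq,
          Real.dist_eq, abs_lt, abs_lt]
        refine ⟨⟨?_, ?_⟩, ?_, ?_⟩ <;> dsimp only <;> linarith)
      simp only [ContinuousLinearMap.toSpanSingleton_apply] at this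
      rw [Real.norm_of_nonneg hts.le] at this
      have hfac : (t - s)⁻¹ • (g t - g s) - deriv g τ =
          (t - s)⁻¹ • (g t - g s - (t - s) • deriv g τ) := by
        rw [smul_sub _ (g t - g s), smul_smul, inv_mul_cancel₀ hts.ne', one_smul]
      rw [hfac, norm_smul, norm_inv, Real.norm_of_nonneg hts.le, inv_mul_le_iff₀ hts, mul_comm]
      exact this
    refine (measure_mono ?_).trans ((h _ _ hu hw r (2 * r / (t - s)) hr (by positivity)).trans
      (ENNReal.ofReal_le_ofReal (le_of_eq (by ring))))
    rintro ω ⟨hω, hs', ht'⟩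
    refine ⟨hω, hs', ?_⟩
    rw [inner_smul_right, inner_sub_right, abs_mul, abs_of_pos (inv_pos.2 hts), inv_mul_eq_div]
    gcongr
    exact (abs_sub _ _).trans (by linarith)

/-- A grid argument: the directions for which `⟪ω, g⟫` stays small on an interval of length
more than `ℓ`. -/
theorem exists_hausdorffMeasure_sphere_long_sublevel_le {E : Type*} [NormedAddCommGroup E]
    [InnerProductSpace ℝ E] [FiniteDimensional ℝ E] [MeasurableSpace E] [BorelSpace E] {m : ℕ}
    (hm : Module.finrank ℝ E = m + 2) {g : ℝ → E} (hg : ContDiff ℝ 1 g) {a b : ℝ} (hab : a < b)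
    (hind : ∀ t ∈ Set.Icc a b, LinearIndependent ℝ ![g t, deriv g t]) :
    ∃ C ≥ 0, ∀ r ℓ : ℝ, 0 ≤ r → 0 < ℓ →
      μH[((m + 1 : ℕ) : ℝ)] {ω : E | ‖ω‖ = 1 ∧ ∃ p q, a ≤ p ∧ q ≤ b ∧ ℓ < q - p ∧
        ∀ t ∈ Set.Icc p q, |⟪ω, g t⟫| ≤ r} ≤ ENNReal.ofReal (C * (r ^ 2 / ℓ ^ 2)) := by
  obtain ⟨δ, hδ, C, hC, h⟩ := exists_hausdorffMeasure_sphere_near_le hm hg hind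
  have hba : 0 < b - a := sub_pos.2 hab
  set κ : ℝ := min (1 / 2) (δ / (b - a)) with hκ
  have hκ0 : 0 < κ := lt_min (by norm_num) (by positivity)
  have hκ1 : κ ≤ 1 / 2 := min_le_left _ _
  have hκ2 : κ * (b - a) ≤ δ := by
    rw [← le_div_iff₀ hba]; exact min_le_right _ _
  refine ⟨2 * (b - a) * C / κ ^ 2, by positivity, fun r ℓ hr hℓ => ?_⟩
  rcases le_or_gt (b - a) ℓ with hlarge | hsmall
  · refine (measure_mono_null ?_ measure_empty).le.trans zero_le
    rintro ω ⟨-, p, q, hp, hq, hpq, -⟩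
    exact absurd hpq (by linarith)
  set η := κ * ℓ with hη
  have hη0 : 0 < η := by positivity
  have hηδ : η ≤ δ := by
    refine le_trans ?_ hκ2
    rw [hη]; gcongr
  set M := ⌈(b - a) / η⌉₊ with hM
  have hMle : (M : ℝ) ≤ 2 * (b - a) / η := by
    have h1 : (1 : ℝ) ≤ (b - a) / η := by rw [one_le_div hη0, hη]; nlinarith
    have h2 := (Nat.ceil_lt_add_one (zero_le_one.trans h1)).le
    rw [mul_div_assoc]; linarith
  set A : ℕ → Set E := fun j => if a + j * η ∈ Set.Icc a b then
    {ω | ‖ω‖ = 1 ∧ |⟪ω, g (a + j * η)⟫| ≤ r ∧ |⟪ω, g (a + j * η + η)⟫| ≤ r} else ∅ with hA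
  have hcover : {ω : E | ‖ω‖ = 1 ∧ ∃ p q, a ≤ p ∧ q ≤ b ∧ ℓ < q - p ∧
      ∀ t ∈ Set.Icc p q, |⟪ω, g t⟫| ≤ r} ⊆ ⋃ j ∈ Finset.range M, A j := by
    rintro ω ⟨hω, p, q, hp, hq, hpq, hpr⟩
    set j := ⌈(p - a) / η⌉₊ with hj
    have hj1 : p ≤ a + j * η := by
      have := Nat.le_ceil ((p - a) / η)
      rw [div_le_iff₀ hη0] at this
      linarith
    have hj2 : a + j * η < p + η := by
      have := Nat.ceil_lt_add_one (div_nonneg (sub_nonneg.2 hp) hη0.le)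
      rw [← hj, ← sub_lt_iff_lt_add, lt_div_iff₀ hη0] at this
      linarith
    have hηℓ : 2 * η ≤ ℓ := by rw [hη]; nlinarith
    have hjM : j < M := by
      have h1 : (j : ℝ) < (b - a) / η := by rw [lt_div_iff₀ hη0]; linarith
      exact_mod_cast h1.trans_le (Nat.le_ceil _)
    refine Set.mem_iUnion₂.2 ⟨j, Finset.mem_range.2 hjM, ?_⟩
    have hmem : a + j * η ∈ Set.Icc a b := ⟨by linarith, by linarith⟩
    simp only [hA, if_pos hmem]
    exact ⟨hω, hpr _ ⟨hj1, by linarith⟩, hpr _ ⟨by linarith, by linarith⟩⟩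
  have hpiece : ∀ j ∈ Finset.range M, μH[((m + 1 : ℕ) : ℝ)] (A j) ≤
      ENNReal.ofReal (C * (r ^ 2 / η)) := by
    intro j _
    simp only [hA]
    split_ifs with hj
    · simpa using h _ hj (a + j * η + η) (by linarith) (by linarith) r hr
    · simp
  refine (measure_mono hcover).trans ((measure_biUnion_finset_le _ _).trans
    ((Finset.sum_le_card_nsmul _ _ _ hpiece).trans ?_))
  rw [Finset.card_range, nsmul_eq_mul, ← ENNReal.ofReal_natCast,
    ← ENNReal.ofReal_mul (Nat.cast_nonneg _)]
  apply ENNReal.ofReal_le_ofReal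
  calc (M : ℝ) * (C * (r ^ 2 / η)) ≤ 2 * (b - a) / η * (C * (r ^ 2 / η)) := by gcongr
    _ = _ := by rw [hη]; field_simp

/-- `f` does not take both positive and negative values on `S`. -/
def HasConstantSignOn (f : ℝ → ℝ) (S : Set ℝ) : Prop :=
  (∀ t ∈ S, 0 ≤ f t) ∨ (∀ t ∈ S, f t ≤ 0)

theorem exists_mul_neg_of_not_hasConstantSignOn {f : ℝ → ℝ} {S : Set ℝ}
    (h : ¬ HasConstantSignOn f S) : ∃ x ∈ S, ∃ y ∈ S, x < y ∧ f x * f y < 0 := by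
  simp only [HasConstantSignOn, not_or, not_forall, not_le] at h
  obtain ⟨⟨u, hu, hfu⟩, v, hv, hfv⟩ := h
  rcases lt_trichotomy u v with huv | rfl | hvu
  · exact ⟨u, hu, v, hv, huv, mul_neg_of_neg_of_pos hfu hfv⟩
  · exact absurd hfu hfv.not_gt
  · exact ⟨v, hv, u, hu, hvu, mul_neg_of_pos_of_neg hfv hfu⟩

theorem HasConstantSignOn.mul_nonneg {f : ℝ → ℝ} {S : Set ℝ} (h : HasConstantSignOn f S)
    {x y : ℝ} (hx : x ∈ S) (hy : y ∈ S) : 0 ≤ f x * f y := by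
  rcases h with h | h
  · exact _root_.mul_nonneg (h x hx) (h y hy)
  · exact mul_nonneg_of_nonpos_of_nonpos (h x hx) (h y hy)

theorem HasConstantSignOn.union_of_mem {f : ℝ → ℝ} {S T : Set ℝ} (hS : HasConstantSignOn f S)
    (hT : HasConstantSignOn f T) {c : ℝ} (hcS : c ∈ S) (hcT : c ∈ T) (hc : f c ≠ 0) :
    HasConstantSignOn f (S ∪ T) := by
  rcases hS with hS | hS <;> rcases hT with hT | hT
  · exact Or.inl fun t ht => ht.elim (hS t) (hT t)
  · exact absurd (le_antisymm (hT c hcT) (hS c hcS)) hc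
  · exact absurd (le_antisymm (hS c hcS) (hT c hcT)) hc
  · exact Or.inr fun t ht => ht.elim (hS t) (hT t)

/-- There is a longest initial interval on which a continuous function has constant sign. -/
theorem exists_isGreatest_hasConstantSignOn {f : ℝ → ℝ} (hf : Continuous f) {a b : ℝ}
    (hab : a ≤ b) : ∃ c, IsGreatest {t | t ∈ Set.Icc a b ∧ HasConstantSignOn f (Set.Icc a t)} c := by
  set S := {t | t ∈ Set.Icc a b ∧ HasConstantSignOn f (Set.Icc a t)} with hS
  have haS : a ∈ S := by
    refine ⟨⟨le_rfl, hab⟩, ?_⟩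
    simp only [HasConstantSignOn, Set.Icc_self, Set.mem_singleton_iff, forall_eq]
    exact le_total _ _
  have hbdd : BddAbove S := ⟨b, fun t ht => ht.1.2⟩
  refine ⟨sSup S, ⟨⟨le_csSup hbdd haS, csSup_le ⟨a, haS⟩ fun t ht => ht.1.2⟩, ?_⟩,
    fun t ht => le_csSup hbdd ht⟩
  by_contra hcon
  obtain ⟨x, hx, y, hy, hxy, hneg⟩ := exists_mul_neg_of_not_hasConstantSignOn hcon
  have hev : ∀ᶠ z in nhds y, f x * f z < 0 :=
    (continuous_const.mul hf).continuousAt.eventually_lt continuousAt_const hneg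
  obtain ⟨z, hz, hxz, hzy⟩ := ((hev.filter_mono nhdsWithin_le_nhds).and
    (Ioo_mem_nhdsLT hxy)).exists
  obtain ⟨t, ht, hzt⟩ := exists_lt_of_lt_csSup ⟨a, haS⟩ (hzy.trans_le hy.2)
  exact (ht.2.mul_nonneg ⟨hx.1, hxz.le.trans hzt.le⟩ ⟨hx.1.trans hxz.le, hzt.le⟩).not_gt hz

theorem hasConstantSignOn_of_changesSignAtMost_zero {f : ℝ → ℝ} {S : Set ℝ}
    (h : ChangesSignAtMost f S 0) : HasConstantSignOn f S := by
  by_contra hcon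
  obtain ⟨x, hx, y, hy, hxy, hneg⟩ := exists_mul_neg_of_not_hasConstantSignOn hcon
  refine h ⟨![x, y], ?_, ?_, ?_⟩
  · rw [Fin.strictMono_iff_lt_succ]
    intro i
    fin_cases i
    exact hxy
  · intro i
    fin_cases i
    exacts [hx, hy]
  · intro i
    fin_cases i
    exact hneg

theorem ChangesSignAtMost.of_isGreatest {f : ℝ → ℝ} (hf : Continuous f) {a b c : ℝ} {N : ℕ}
    (h : ChangesSignAtMost f (Set.Icc a b) (N + 1))
    (hc : IsGreatest {t | t ∈ Set.Icc a b ∧ HasConstantSignOn f (Set.Icc a t)} c) (hcb : c < b) :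
    ChangesSignAtMost f (Set.Icc c b) N := by
  rintro ⟨t, ht, htI, hsgn⟩
  have hac : a ≤ c := hc.1.1.1
  have hmax : ∀ y, c < y → y ≤ b → ¬ HasConstantSignOn f (Set.Icc a y) := fun y hcy hyb hy =>
    (hc.2 ⟨⟨hac.trans hcy.le, hyb⟩, hy⟩).not_gt hcy
  have hneg0 : f (t 0) * f (t 1) < 0 := hsgn 0
  have ht0 : f (t 0) ≠ 0 := left_ne_zero_of_mul hneg0.ne
  have hct0 : c < t 0 := by
    refine (htI 0).1.lt_of_ne fun hct => ?_
    rw [← hct] at ht0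
    have hev : ∀ᶠ z in nhds c, 0 < f c * f z :=
      continuousAt_const.eventually_lt (continuous_const.mul hf).continuousAt
        (mul_self_pos.2 ht0)
    obtain ⟨y, hy, hball⟩ := mem_nhdsGE_iff_exists_Icc_subset.1
      (hev.filter_mono nhdsWithin_le_nhds)
    set y' := min y b
    have hcy' : c < y' := lt_min hy hcb
    refine hmax y' hcy' (min_le_right _ _) ?_
    rw [← Set.Icc_union_Icc_eq_Icc hac hcy'.le]
    refine hc.1.2.union_of_mem ?_ ⟨hac, le_rfl⟩ ⟨le_rfl, hcy'.le⟩ ht0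
    have hpos : ∀ z ∈ Set.Icc c y', 0 < f c * f z := fun z hz =>
      hball ⟨hz.1, hz.2.trans (min_le_left _ _)⟩
    rcases ht0.lt_or_gt with h0 | h0
    · exact Or.inr fun z hz => (neg_of_mul_pos_right (hpos z hz) h0.le).le
    · exact Or.inl fun z hz => (pos_of_mul_pos_right (hpos z hz) h0.le).le
  obtain ⟨x, hx, y, hy, hxy, hxyneg⟩ :=
    exists_mul_neg_of_not_hasConstantSignOn (hmax _ hct0 (htI 0).2)
  obtain ⟨z, haz, hzt, hz⟩ : ∃ z, a ≤ z ∧ z < t 0 ∧ f z * f (t 0) < 0 := by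
    rcases lt_or_ge (f x * f (t 0)) 0 with hxt | hxt
    · exact ⟨x, hx.1, hxy.trans_le hy.2, hxt⟩
    · have hyt : f y * f (t 0) < 0 := by
        have hx0 : f x ≠ 0 := left_ne_zero_of_mul hxyneg.ne
        have hpos : 0 < f x * f (t 0) := hxt.lt_of_ne (mul_ne_zero hx0 ht0).symm
        have h1 : (f x * f y) * (f x * f (t 0)) < 0 := mul_neg_of_neg_of_pos hxyneg hpos
        have h2 : 0 < f x * f x := mul_self_pos.2 hx0
        by_contra hcon
        nlinarith [mul_nonneg h2.le (not_lt.1 hcon)]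
      refine ⟨y, hy.1, hy.2.lt_of_ne ?_, hyt⟩
      rintro rfl
      exact (mul_self_nonneg (f (t 0))).not_gt hyt
  refine h ⟨Fin.cons z t, ?_, ?_, ?_⟩
  · rw [Fin.strictMono_iff_lt_succ]
    refine Fin.cases ?_ fun i => ?_
    · simpa using hzt
    · rw [← Fin.succ_castSucc, Fin.cons_succ, Fin.cons_succ]
      exact ht Fin.castSucc_lt_succ
  · refine Fin.cases ?_ fun i => ?_
    · exact ⟨haz, hzt.le.trans (htI 0).2⟩
    · exact ⟨hac.trans (htI i).1, (htI i).2⟩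
  · refine Fin.cases ?_ fun i => ?_
    · simpa using hz
    · rw [← Fin.succ_castSucc, Fin.cons_succ, Fin.cons_succ]
      exact hsgn i

theorem norm_integral_le_of_changesSignAtMost {f : ℝ → ℝ} (hf : Continuous f) {F : ℝ → ℂ}
    (hF : Continuous F) {B b : ℝ} {N : ℕ} {a : ℝ} (hab : a ≤ b)
    (hB : ∀ p q, a ≤ p → p ≤ q → q ≤ b → HasConstantSignOn f (Set.Icc p q) →
      ‖∫ t in p..q, F t‖ ≤ B)
    (h : ChangesSignAtMost f (Set.Icc a b) N) :
    ‖∫ t in a..b, F t‖ ≤ (N + 1) * B := by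
  induction N generalizing a with
  | zero => simpa using hB a b le_rfl hab le_rfl (hasConstantSignOn_of_changesSignAtMost_zero h)
  | succ N ih =>
    obtain ⟨c, hc⟩ := exists_isGreatest_hasConstantSignOn hf hab
    have hac : a ≤ c := hc.1.1.1
    have hB1 := hB a c le_rfl hac hc.1.1.2 hc.1.2
    have hB0 : 0 ≤ B := (norm_nonneg _).trans hB1
    rcases hc.1.1.2.eq_or_lt with rfl | hcb
    · refine hB1.trans (le_mul_of_one_le_left hB0 ?_)
      push_cast
      linarith [(Nat.cast_nonneg N : (0 : ℝ) ≤ N)]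
    · have hB2 := ih hcb.le (fun p q hp => hB p q (hac.trans hp)) (h.of_isGreatest hf hc hcb)
      rw [← intervalIntegral.integral_add_adjacent_intervals (hF.intervalIntegrable a c)
        (hF.intervalIntegrable c b)]
      refine (norm_add_le _ _).trans ?_
      push_cast
      linarith

/-- The first derivative van der Corput estimate for `C²` phases with monotone derivative. -/
theorem norm_integral_exp_mul_le_of_le_deriv {φ : ℝ → ℝ} (hφ : ContDiff ℝ 2 φ) {χ : ℝ → ℂ}
    (hχ : ContDiff ℝ 1 χ) {X Y : ℝ} {p q r : ℝ} (hpq : p ≤ q) (hr : 0 < r)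
    (hX : ∀ t ∈ Set.Icc p q, ‖χ t‖ ≤ X) (hY : ∀ t ∈ Set.Icc p q, ‖deriv χ t‖ ≤ Y)
    (hsign : HasConstantSignOn (deriv (deriv φ)) (Set.Icc p q))
    (hφr : ∀ t ∈ Set.Ioo p q, r ≤ |deriv φ t|) :
    ‖∫ t in p..q, Complex.exp (-Complex.I * (φ t : ℂ)) * χ t‖ ≤ (4 * X + Y * (q - p)) / r := by
  have hX0 : 0 ≤ X := (norm_nonneg _).trans (hX p ⟨le_rfl, hpq⟩)
  have hY0 : 0 ≤ Y := (norm_nonneg _).trans (hY p ⟨le_rfl, hpq⟩)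
  rcases hpq.eq_or_lt with rfl | hlt
  · simp; positivity
  have hφ1 : ContDiff ℝ 1 (deriv φ) := hφ.deriv' (n := 1)
  have hφ2 : Continuous (deriv (deriv φ)) := hφ1.continuous_deriv le_rfl
  have hφ' : ∀ t, HasDerivAt φ (deriv φ t) t := fun t =>
    (hφ.differentiable two_ne_zero t).hasDerivAt
  have hφ'' : ∀ t, HasDerivAt (deriv φ) (deriv (deriv φ) t) t := fun t =>
    (hφ1.differentiable one_ne_zero t).hasDerivAt
  have hχ' : ∀ t, HasDerivAt χ (deriv χ t) t := fun t =>
    (hχ.differentiable one_ne_zero t).hasDerivAt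
  have hlow : ∀ t ∈ Set.Icc p q, r ≤ |deriv φ t| := by
    have hclosed : IsClosed {t | r ≤ |deriv φ t|} :=
      isClosed_le continuous_const hφ1.continuous.abs
    intro t ht
    rw [← closure_Ioo hlt.ne] at ht
    exact closure_minimal hφr hclosed ht
  have hne : ∀ t ∈ Set.Icc p q, deriv φ t ≠ 0 := fun t ht =>
    abs_pos.1 (hr.trans_le (hlow t ht))
  set h : ℝ → ℝ := fun t => (deriv φ t)⁻¹ with hh
  set h' : ℝ → ℝ := fun t => -deriv (deriv φ) t / deriv φ t ^ 2 with hh'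
  have hhderiv : ∀ t ∈ Set.Icc p q, HasDerivAt h (h' t) t := fun t ht =>
    (hφ'' t).inv (hne t ht)
  have hhle : ∀ t ∈ Set.Icc p q, |h t| ≤ r⁻¹ := fun t ht => by
    rw [hh, abs_inv]; exact inv_anti₀ hr (hlow t ht)
  have hhcont : ContinuousOn h (Set.Icc p q) := fun t ht =>
    (hhderiv t ht).continuousAt.continuousWithinAt
  have hh'cont : ContinuousOn h' (Set.Icc p q) :=
    hφ2.neg.continuousOn.div (hφ1.continuous.pow 2).continuousOn fun t ht =>
      pow_ne_zero 2 (hne t ht)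
  have huIcc : Set.uIcc p q = Set.Icc p q := Set.uIcc_of_le hpq
  have hh'int : IntervalIntegrable h' volume p q := (huIcc ▸ hh'cont).intervalIntegrable
  have habs : ∫ t in p..q, |h' t| ≤ 2 / r := by
    have hFTC : ∫ t in p..q, h' t = h q - h p :=
      intervalIntegral.integral_eq_sub_of_hasDerivAt (huIcc ▸ hhderiv) hh'int
    have hq := abs_le.1 (hhle q ⟨hpq, le_rfl⟩)
    have hp := abs_le.1 (hhle p ⟨le_rfl, hpq⟩)
    rw [div_eq_mul_inv]
    rcases hsign with hs | hs
    · have : ∫ t in p..q, |h' t| = ∫ t in p..q, -h' t :=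
        intervalIntegral.integral_congr fun t ht => abs_of_nonpos (by
          rw [hh']; dsimp only; rw [neg_div, neg_nonpos]
          exact div_nonneg (hs t (huIcc ▸ ht)) (sq_nonneg _))
      rw [this, intervalIntegral.integral_neg, hFTC]
      linarith
    · have : ∫ t in p..q, |h' t| = ∫ t in p..q, h' t :=
        intervalIntegral.integral_congr fun t ht => abs_of_nonneg (by
          rw [hh']; dsimp only
          exact div_nonneg (neg_nonneg.2 (hs t (huIcc ▸ ht))) (sq_nonneg _))
      rw [this, hFTC]
      linarith
  set u : ℝ → ℂ := fun t => Complex.I * ((h t : ℂ) * χ t) with hu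
  set u' : ℝ → ℂ := fun t => Complex.I * ((h' t : ℂ) * χ t + (h t : ℂ) * deriv χ t) with hu'
  set v : ℝ → ℂ := fun t => Complex.exp (-Complex.I * (φ t : ℂ)) with hv
  set v' : ℝ → ℂ := fun t => v t * (-Complex.I * ((deriv φ t : ℝ) : ℂ)) with hv'
  have hvnorm : ∀ t, ‖v t‖ = 1 := fun t => by
    simp only [hv]
    rw [show -Complex.I * (φ t : ℂ) = ((-φ t : ℝ) : ℂ) * Complex.I by push_cast; ring]
    exact Complex.norm_exp_ofReal_mul_I _
  have hvcont : Continuous v := by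
    have := hφ.continuous
    fun_prop
  have huderiv : ∀ t ∈ Set.uIcc p q, HasDerivAt u (u' t) t := fun t ht =>
    ((hhderiv t (huIcc ▸ ht)).ofReal_comp.mul (hχ' t)).const_mul Complex.I
  have hvderiv : ∀ t ∈ Set.uIcc p q, HasDerivAt v (v' t) t := fun t _ =>
    ((hφ' t).ofReal_comp.const_mul (-Complex.I)).cexp
  have hu'int : IntervalIntegrable u' volume p q := by
    refine ContinuousOn.intervalIntegrable ?_
    rw [huIcc]
    exact continuousOn_const.mul (((Complex.continuous_ofReal.comp_continuousOn hh'cont).mul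
      hχ.continuous.continuousOn).add ((Complex.continuous_ofReal.comp_continuousOn hhcont).mul
      (hχ.continuous_deriv le_rfl).continuousOn))
  have hv'int : IntervalIntegrable v' volume p q :=
    (hvcont.mul (continuous_const.mul
      (Complex.continuous_ofReal.comp hφ1.continuous))).intervalIntegrable p q
  have hparts := intervalIntegral.integral_mul_deriv_eq_deriv_mul huderiv hvderiv hu'int hv'int
  have hintegrand : ∫ t in p..q, Complex.exp (-Complex.I * (φ t : ℂ)) * χ t =
      ∫ t in p..q, u t * v' t := by
    refine intervalIntegral.integral_congr fun t ht => ?_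
    have hne' : ((deriv φ t : ℝ) : ℂ) ≠ 0 := Complex.ofReal_ne_zero.2 (hne t (huIcc ▸ ht))
    simp only [hu, hv', hh, hv, Complex.ofReal_inv]
    field_simp
    rw [Complex.I_sq]
    ring
  have hunorm : ∀ t ∈ Set.Icc p q, ‖u t‖ ≤ X / r := fun t ht => by
    rw [hu, norm_mul, norm_mul, Complex.norm_I, one_mul, Complex.norm_real, div_eq_inv_mul]
    exact mul_le_mul (hhle t ht) (hX t ht) (norm_nonneg _) (inv_pos.2 hr).le
  have hrest : ‖∫ t in p..q, u' t * v t‖ ≤ 2 * X / r + Y * (q - p) / r := by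
    have hbound : IntervalIntegrable (fun t => X * |h' t| + Y / r) volume p q :=
      (hh'int.abs.const_mul X).add intervalIntegrable_const
    refine (intervalIntegral.norm_integral_le_of_norm_le hpq (Filter.Eventually.of_forall
      fun t ht => ?_) hbound).trans ?_
    · have ht' : t ∈ Set.Icc p q := ⟨ht.1.le, ht.2⟩
      rw [norm_mul, hvnorm, mul_one, hu', norm_mul, Complex.norm_I, one_mul]
      refine (norm_add_le _ _).trans ?_
      rw [norm_mul, norm_mul, Complex.norm_real, Complex.norm_real, mul_comm X, div_eq_inv_mul]
      exact add_le_add (mul_le_mul_of_nonneg_left (hX t ht') (abs_nonneg _))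
        (mul_le_mul (hhle t ht') (hY t ht') (norm_nonneg _) (inv_pos.2 hr).le)
    · rw [intervalIntegral.integral_add (hh'int.abs.const_mul X) intervalIntegrable_const,
        intervalIntegral.integral_const_mul, intervalIntegral.integral_const, smul_eq_mul]
      have := mul_le_mul_of_nonneg_left habs hX0
      calc X * (∫ t in p..q, |h' t|) + (q - p) * (Y / r)
          ≤ X * (2 / r) + (q - p) * (Y / r) := by linarith
        _ = _ := by ring
  rw [hintegrand, hparts]
  have hq := hunorm q ⟨hpq, le_rfl⟩
  have hp := hunorm p ⟨le_rfl, hpq⟩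
  have hnq : ‖u q * v q‖ = ‖u q‖ := by rw [norm_mul, hvnorm, mul_one]
  have hnp : ‖u p * v p‖ = ‖u p‖ := by rw [norm_mul, hvnorm, mul_one]
  have h1 := norm_sub_le (u q * v q - u p * v p) (∫ t in p..q, u' t * v t)
  have h2 := norm_sub_le (u q * v q) (u p * v p)
  calc _ ≤ X / r + X / r + (2 * X / r + Y * (q - p) / r) := by linarith
    _ = _ := by ring

/-- Splitting an interval of monotonicity of `φ'` at the sublevel set `{|φ'| ≤ r}`. -/
theorem norm_integral_exp_mul_le_of_sublevel {φ : ℝ → ℝ} (hφ : ContDiff ℝ 2 φ) {χ : ℝ → ℂ}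
    (hχ : ContDiff ℝ 1 χ) {X Y : ℝ} {p q r ℓ : ℝ} (hpq : p ≤ q) (hr : 0 < r) (hℓ : 0 ≤ ℓ)
    (hX : ∀ t ∈ Set.Icc p q, ‖χ t‖ ≤ X) (hY : ∀ t ∈ Set.Icc p q, ‖deriv χ t‖ ≤ Y)
    (hsign : HasConstantSignOn (deriv (deriv φ)) (Set.Icc p q))
    (hshort : ∀ s₀ s₁, p ≤ s₀ → s₁ ≤ q → (∀ t ∈ Set.Icc s₀ s₁, |deriv φ t| ≤ r) → s₁ - s₀ ≤ ℓ) :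
    ‖∫ t in p..q, Complex.exp (-Complex.I * (φ t : ℂ)) * χ t‖ ≤
      2 * ((4 * X + Y * (q - p)) / r) + X * ℓ := by
  have hX0 : 0 ≤ X := (norm_nonneg _).trans (hX p ⟨le_rfl, hpq⟩)
  have hY0 : 0 ≤ Y := (norm_nonneg _).trans (hY p ⟨le_rfl, hpq⟩)
  have hA0 : 0 ≤ (4 * X + Y * (q - p)) / r :=
    div_nonneg (add_nonneg (by positivity) (mul_nonneg hY0 (sub_nonneg.2 hpq))) hr.le
  have hφ1 : ContDiff ℝ 1 (deriv φ) := hφ.deriv' (n := 1)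
  have hvdc : ∀ x y, p ≤ x → x ≤ y → y ≤ q → (∀ t ∈ Set.Ioo x y, r ≤ |deriv φ t|) →
      ‖∫ t in x..y, Complex.exp (-Complex.I * (φ t : ℂ)) * χ t‖ ≤
        (4 * X + Y * (q - p)) / r := by
    intro x y hpx hxy hyq hlow
    have hsub : Set.Icc x y ⊆ Set.Icc p q := Set.Icc_subset_Icc hpx hyq
    refine (norm_integral_exp_mul_le_of_le_deriv hφ hχ hxy hr (fun t ht => hX t (hsub ht))
      (fun t ht => hY t (hsub ht)) (hsign.imp (fun h t ht => h t (hsub ht))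
      fun h t ht => h t (hsub ht)) hlow).trans ?_
    gcongr
  set E : Set ℝ := Set.Icc p q ∩ {t | |deriv φ t| ≤ r} with hE
  have hmono : MonotoneOn (deriv φ) (Set.Icc p q) ∨ AntitoneOn (deriv φ) (Set.Icc p q) := by
    have hc := hφ1.continuous.continuousOn (s := Set.Icc p q)
    have hd := (hφ1.differentiable one_ne_zero).differentiableOn (s := interior (Set.Icc p q))
    exact hsign.imp
      (fun h => monotoneOn_of_deriv_nonneg (convex_Icc p q) hc hd
        fun t ht => h t (interior_subset ht))
      (fun h => antitoneOn_of_deriv_nonpos (convex_Icc p q) hc hd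
        fun t ht => h t (interior_subset ht))
  have hEconv : ∀ x ∈ E, ∀ y ∈ E, ∀ t ∈ Set.Icc x y, |deriv φ t| ≤ r := by
    intro x hx y hy t ht
    have htpq : t ∈ Set.Icc p q := ⟨hx.1.1.trans ht.1, ht.2.trans hy.1.2⟩
    have hx' := abs_le.1 (show |deriv φ x| ≤ r from hx.2)
    have hy' := abs_le.1 (show |deriv φ y| ≤ r from hy.2)
    rw [abs_le]
    rcases hmono with h | h
    · exact ⟨hx'.1.trans (h hx.1 htpq ht.1), (h htpq hy.1 ht.2).trans hy'.2⟩
    · exact ⟨hy'.1.trans (h htpq hy.1 ht.2), (h hx.1 htpq ht.1).trans hx'.2⟩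
  rcases E.eq_empty_or_nonempty with hempty | hne
  · have hlow : ∀ t ∈ Set.Ioo p q, r ≤ |deriv φ t| := fun t ht => by
      by_contra hcon
      exact (hempty ▸ Set.notMem_empty t : t ∉ E) ⟨⟨ht.1.le, ht.2.le⟩, (not_le.1 hcon).le⟩
    have := hvdc p q le_rfl hpq le_rfl hlow
    have := mul_nonneg hX0 hℓ
    linarith
  have hEcompact : IsCompact E :=
    isCompact_Icc.inter_right (isClosed_le hφ1.continuous.abs continuous_const)
  have h₀ := hEcompact.sInf_mem hne
  have h₁ := hEcompact.sSup_mem hne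
  set s₀ := sInf E
  set s₁ := sSup E
  have h₀₁ : s₀ ≤ s₁ := csInf_le hEcompact.bddBelow h₁
  have hlen := hshort s₀ s₁ h₀.1.1 h₁.1.2 (hEconv s₀ h₀ s₁ h₁)
  have hcont : Continuous fun t => Complex.exp (-Complex.I * (φ t : ℂ)) * χ t := by
    have := hφ.continuous
    have := hχ.continuous
    fun_prop
  have hleft := hvdc p s₀ le_rfl h₀.1.1 h₀.1.2 fun t ht => by
    by_contra hcon
    exact (csInf_le hEcompact.bddBelow
      ⟨⟨ht.1.le, ht.2.le.trans h₀.1.2⟩, (not_le.1 hcon).le⟩).not_gt ht.2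
  have hright := hvdc s₁ q h₁.1.1 h₁.1.2 le_rfl fun t ht => by
    by_contra hcon
    exact (le_csSup hEcompact.bddAbove
      ⟨⟨h₁.1.1.trans ht.1.le, ht.2.le⟩, (not_le.1 hcon).le⟩).not_gt ht.1
  have hmid : ‖∫ t in s₀..s₁, Complex.exp (-Complex.I * (φ t : ℂ)) * χ t‖ ≤ X * ℓ := by
    refine (intervalIntegral.norm_integral_le_of_norm_le_const (C := X) fun t ht => ?_).trans ?_
    · rw [Set.uIoc_of_le h₀₁] at ht
      rw [norm_mul, show -Complex.I * (φ t : ℂ) = ((-φ t : ℝ) : ℂ) * Complex.I by push_cast; ring,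
        Complex.norm_exp_ofReal_mul_I, one_mul]
      exact hX t ⟨h₀.1.1.trans ht.1.le, ht.2.trans h₁.1.2⟩
    · rw [abs_of_nonneg (sub_nonneg.2 h₀₁)]
      gcongr
  have hsum : ∫ t in p..q, Complex.exp (-Complex.I * (φ t : ℂ)) * χ t =
      (∫ t in p..s₀, Complex.exp (-Complex.I * (φ t : ℂ)) * χ t) +
      (∫ t in s₀..s₁, Complex.exp (-Complex.I * (φ t : ℂ)) * χ t) +
      ∫ t in s₁..q, Complex.exp (-Complex.I * (φ t : ℂ)) * χ t := by
    rw [intervalIntegral.integral_add_adjacent_intervals (hcont.intervalIntegrable _ _)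
      (hcont.intervalIntegrable _ _), intervalIntegral.integral_add_adjacent_intervals
      (hcont.intervalIntegrable _ _) (hcont.intervalIntegrable _ _)]
  rw [hsum]
  have h1 := norm_add_le ((∫ t in p..s₀, Complex.exp (-Complex.I * (φ t : ℂ)) * χ t) +
    (∫ t in s₀..s₁, Complex.exp (-Complex.I * (φ t : ℂ)) * χ t))
    (∫ t in s₁..q, Complex.exp (-Complex.I * (φ t : ℂ)) * χ t)
  have h2 := norm_add_le (∫ t in p..s₀, Complex.exp (-Complex.I * (φ t : ℂ)) * χ t)
    (∫ t in s₀..s₁, Complex.exp (-Complex.I * (φ t : ℂ)) * χ t)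
  linarith

/-- A weak `L⁴` bound on a finite measure space controls the `L^q` integral for `q < 4`. -/
theorem integral_rpow_le_of_weak_four {α : Type*} [MeasurableSpace α] {μ : Measure α} {f : α → ℝ}
    (hf : ∀ x, 0 ≤ f x) {C D q : ℝ} (hC : 0 ≤ C) (hD : 0 ≤ D) (hq0 : 0 < q) (hq4 : q < 4)
    (huniv : μ Set.univ ≤ ENNReal.ofReal D)
    (hweak : ∀ A : ℝ, 0 < A → μ {x | A < f x} ≤ ENNReal.ofReal (C / A ^ 4)) :
    ∫ x, f x ^ q ∂μ ≤ D + C / (4 / q - 1) := by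
  have hexp : 1 < 4 / q := (one_lt_div hq0).2 hq4
  have htail0 : 0 ≤ C / (4 / q - 1) := div_nonneg hC (by linarith)
  by_cases hint : Integrable (fun x => f x ^ q) μ
  swap
  · rw [integral_undef hint]; positivity
  have hnonneg : 0 ≤ᵐ[μ] fun x => f x ^ q :=
    Filter.Eventually.of_forall fun x => Real.rpow_nonneg (hf x) q
  rw [← ENNReal.ofReal_le_ofReal_iff (by positivity),
    ofReal_integral_eq_lintegral_ofReal hint hnonneg,
    lintegral_eq_lintegral_meas_lt μ hnonneg hint.aemeasurable,
    ← Set.Ioc_union_Ioi_eq_Ioi zero_le_one,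
    lintegral_union measurableSet_Ioi (Set.Ioc_disjoint_Ioi le_rfl),
    ENNReal.ofReal_add hD htail0]
  refine add_le_add ?_ ?_
  · calc ∫⁻ t in Set.Ioc (0 : ℝ) 1, μ {x | t < f x ^ q}
        ≤ ∫⁻ _ in Set.Ioc (0 : ℝ) 1, ENNReal.ofReal D :=
          lintegral_mono fun t => (measure_mono (Set.subset_univ _)).trans huniv
      _ = ENNReal.ofReal D := by simp
  · have hpow : IntegrableOn (fun t : ℝ => C * t ^ (-(4 / q))) (Set.Ioi 1) :=
      (integrableOn_Ioi_rpow_of_lt (by linarith) one_pos).const_mul C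
    have hpow0 : 0 ≤ᵐ[volume.restrict (Set.Ioi 1)] fun t : ℝ => C * t ^ (-(4 / q)) := by
      filter_upwards [ae_restrict_mem measurableSet_Ioi] with t ht
      exact mul_nonneg hC (Real.rpow_nonneg (zero_le_one.trans (le_of_lt ht)) _)
    calc ∫⁻ t in Set.Ioi (1 : ℝ), μ {x | t < f x ^ q}
        ≤ ∫⁻ t in Set.Ioi (1 : ℝ), ENNReal.ofReal (C * t ^ (-(4 / q))) := by
          refine setLIntegral_mono' measurableSet_Ioi fun t ht => ?_
          have ht0 : 0 < t := one_pos.trans ht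
          have hA : 0 < t ^ q⁻¹ := Real.rpow_pos_of_pos ht0 _
          refine (measure_mono fun x hx => ?_).trans ((hweak (t ^ q⁻¹) hA).trans (le_of_eq ?_))
          · exact (Real.rpow_inv_lt_iff_of_pos ht0.le (hf x) hq0).2 hx
          · rw [div_eq_mul_inv, ← Real.rpow_natCast, ← Real.rpow_mul ht0.le,
              ← Real.rpow_neg ht0.le]
            congr 3
            push_cast
            ring
      _ = ENNReal.ofReal (C / (4 / q - 1)) := by
          rw [← ofReal_integral_eq_lintegral_ofReal hpow hpow0, integral_const_mul,
            integral_Ioi_rpow_of_lt (by linarith) one_pos, Real.one_rpow]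
          congr 1
          have : 4 / q - 1 ≠ 0 := by linarith
          rw [show -(4 / q) + 1 = -(4 / q - 1) by ring, neg_div_neg_eq]
          ring

/-- Pointwise decay of the Fourier transform in a direction `ω` for which `⟪ω, γ'⟫` is small only
on short intervals. -/
theorem norm_integral_exp_inner_le {E : Type*} [NormedAddCommGroup E] [InnerProductSpace ℝ E]
    {γ : ℝ → E} (hγ : ContDiff ℝ 2 γ) {χ : ℝ → ℂ} (hχ : ContDiff ℝ 1 χ) {a b : ℝ} (hab : a ≤ b)
    {X Y : ℝ} (hX : ∀ t ∈ Set.Icc a b, ‖χ t‖ ≤ X) (hY : ∀ t ∈ Set.Icc a b, ‖deriv χ t‖ ≤ Y)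
    {N : ℕ} {ω : E}
    (hsign : ChangesSignAtMost (fun s => ⟪ω, deriv (deriv γ) s⟫) (Set.Icc a b) N)
    {R r ℓ : ℝ} (hR : 0 < R) (hr : 0 < r) (hℓ : 0 ≤ ℓ)
    (hshort : ¬ ∃ p q, a ≤ p ∧ q ≤ b ∧ ℓ < q - p ∧ ∀ t ∈ Set.Icc p q, |⟪ω, deriv γ t⟫| ≤ r) :
    ‖∫ t in a..b, Complex.exp (-Complex.I * ((⟪R • ω, γ t⟫ : ℝ) : ℂ)) * χ t‖ ≤
      (N + 1) * (2 * ((4 * X + Y * (b - a)) / (R * r)) + X * ℓ) := by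
  have hY0 : 0 ≤ Y := (norm_nonneg _).trans (hY a ⟨le_rfl, hab⟩)
  have hγ1 : ContDiff ℝ 1 (deriv γ) := hγ.deriv' (n := 1)
  have hγ2 : Continuous (deriv (deriv γ)) := hγ1.continuous_deriv le_rfl
  set φ : ℝ → ℝ := fun t => ⟪R • ω, γ t⟫ with hφ
  have hφC : ContDiff ℝ 2 φ := contDiff_const.inner ℝ hγ
  have hφ' : deriv φ = fun t => R * ⟪ω, deriv γ t⟫ := by
    funext t
    rw [← real_inner_smul_left]
    exact ((innerSL ℝ (R • ω)).hasFDerivAt.comp_hasDerivAt t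
      (hγ.differentiable two_ne_zero t).hasDerivAt).deriv
  have hφ'' : deriv (deriv φ) = fun t => R * ⟪ω, deriv (deriv γ) t⟫ := by
    rw [hφ']
    funext t
    rw [← real_inner_smul_left]
    simp only [← real_inner_smul_left]
    exact ((innerSL ℝ (R • ω)).hasFDerivAt.comp_hasDerivAt t
      (hγ1.differentiable one_ne_zero t).hasDerivAt).deriv
  have hF : Continuous fun t => Complex.exp (-Complex.I * (φ t : ℂ)) * χ t := by
    have := hφC.continuous
    have := hχ.continuous
    fun_prop
  refine norm_integral_le_of_changesSignAtMost (continuous_const.inner hγ2) hF hab ?_ hsign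
  intro p q hap hpq hqb hs
  have hsub : Set.Icc p q ⊆ Set.Icc a b := Set.Icc_subset_Icc hap hqb
  refine (norm_integral_exp_mul_le_of_sublevel hφC hχ hpq (mul_pos hR hr) hℓ
    (fun t ht => hX t (hsub ht)) (fun t ht => hY t (hsub ht)) ?_ ?_).trans ?_
  · rw [hφ'']
    exact hs.imp (fun h t ht => mul_nonneg hR.le (h t ht))
      fun h t ht => mul_nonpos_of_nonneg_of_nonpos hR.le (h t ht)
  · intro s₀ s₁ hs₀ hs₁ h
    by_contra hcon
    refine hshort ⟨s₀, s₁, hap.trans hs₀, hs₁.trans hqb, not_le.1 hcon, fun t ht => ?_⟩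
    have := h t ht
    rw [hφ', abs_mul, abs_of_pos hR] at this
    exact le_of_mul_le_mul_left this hR
  · gcongr

/-- The weak `L⁴` estimate for the spherical restriction of the Fourier transform. -/
theorem exists_hausdorffMeasure_large_fourier_le {E : Type*} [NormedAddCommGroup E]
    [InnerProductSpace ℝ E] [FiniteDimensional ℝ E] [MeasurableSpace E] [BorelSpace E] {m : ℕ}
    (hm : Module.finrank ℝ E = m + 2) {γ : ℝ → E} (hγ : ContDiff ℝ 2 γ) {a b : ℝ} (hab : a < b)
    (hind : ∀ t ∈ Set.Icc a b, LinearIndependent ℝ ![deriv γ t, deriv (deriv γ) t])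
    {N : ℕ} (hsign : ∀ ω : E, ‖ω‖ = 1 →
      ChangesSignAtMost (fun s => ⟪ω, deriv (deriv γ) s⟫) (Set.Icc a b) N)
    {χ : ℝ → ℂ} (hχ : ContDiff ℝ 1 χ) :
    ∃ C ≥ 0, ∀ R A : ℝ, 0 < R → 0 < A → μH[((m + 1 : ℕ) : ℝ)] {ω : E | ‖ω‖ = 1 ∧
      A < √R * ‖∫ t in a..b, Complex.exp (-Complex.I * ((⟪R • ω, γ t⟫ : ℝ) : ℂ)) * χ t‖} ≤
        ENNReal.ofReal (C / A ^ 4) := by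
  obtain ⟨C, hC, hlong⟩ := exists_hausdorffMeasure_sphere_long_sublevel_le hm
    (hγ.deriv' (n := 1)) hab hind
  obtain ⟨X, hX⟩ := isCompact_Icc.exists_bound_of_continuousOn
    (hχ.continuous.continuousOn (s := Set.Icc a b))
  obtain ⟨Y, hY⟩ := isCompact_Icc.exists_bound_of_continuousOn
    ((hχ.continuous_deriv le_rfl).continuousOn (s := Set.Icc a b))
  have hX0 : 0 ≤ X := (norm_nonneg _).trans (hX a ⟨le_rfl, hab.le⟩)
  have hY0 : 0 ≤ Y := (norm_nonneg _).trans (hY a ⟨le_rfl, hab.le⟩)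
  have hba : 0 < b - a := sub_pos.2 hab
  set P : ℝ := (N + 1) * X + 1 with hP
  set Q : ℝ := (N + 1) * (2 * (4 * X + Y * (b - a))) + 1 with hQ
  have hP0 : 0 < P := by positivity
  have hQ0 : 0 < Q := by positivity
  refine ⟨16 * C * P ^ 2 * Q ^ 2, by positivity, fun R A hR hA => ?_⟩
  have hS : 0 < √R := Real.sqrt_pos.2 hR
  set r : ℝ := 2 * Q / (A * √R) with hr
  set ℓ : ℝ := A / (2 * P * √R) with hℓ
  have hr0 : 0 < r := by positivity
  have hℓ0 : 0 < ℓ := by positivity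
  refine (measure_mono ?_).trans ((hlong r ℓ hr0.le hℓ0).trans
    (ENNReal.ofReal_le_ofReal (le_of_eq ?_)))
  · rintro ω ⟨hω, hlarge⟩
    refine ⟨hω, ?_⟩
    by_contra hshort
    have hbound := norm_integral_exp_inner_le hγ hχ hab.le hX hY (hsign ω hω) hR hr0 hℓ0.le hshort
    refine hlarge.not_ge ?_
    have hRr : √R * (Q / (R * r)) = A / 2 := by
      nth_rewrite 2 [← Real.sq_sqrt hR.le]
      rw [hr]; field_simp
    have hPℓ : √R * (P * ℓ) = A / 2 := by rw [hℓ]; field_simp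
    calc _ ≤ √R * ((N + 1) * (2 * ((4 * X + Y * (b - a)) / (R * r)) + X * ℓ)) := by gcongr
      _ = √R * (((N + 1) * (2 * (4 * X + Y * (b - a)))) / (R * r) + ((N + 1) * X) * ℓ) := by ring
      _ ≤ √R * (Q / (R * r) + P * ℓ) := by
          gcongr
          · exact (lt_add_one _).le
          · exact (lt_add_one _).le
      _ = A := by rw [mul_add, hRr, hPℓ]; ring
  · rw [hr, hℓ]
    field_simp
    ring

/-- Sharp average decay `G_q(R) ≲ R^{-1/2}` for `2 ≤ q < 4`, for a `C²` curve
with nonvanishing curvature such that `⟨ω,γ''(·)⟩` has a bounded number of sign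
changes for every direction `ω`. -/
theorem stmt13 (d : ℕ) (hd : 2 < d) (a b : ℝ) (hab : a < b)
    (γ : ℝ → EuclideanSpace ℝ (Fin d)) (hγ : ContDiff ℝ 2 γ)
    (hind : ∀ t ∈ Set.Icc a b, LinearIndependent ℝ ![deriv γ t, deriv (deriv γ) t])
    (N : ℕ)
    (hsign : ∀ ω : EuclideanSpace ℝ (Fin d), ‖ω‖ = 1 →
      ChangesSignAtMost (fun s => ⟪ω, deriv (deriv γ) s⟫) (Set.Icc a b) N)
    (χ : ℝ → ℂ) (hχ : ContDiff ℝ (⊤ : ℕ∞) χ) (hχs : Function.support χ ⊆ Set.Ioo a b)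
    (q : ℝ) (hq2 : 2 ≤ q) (hq4 : q < 4) :
    ∃ C > 0, ∀ R : ℝ, 2 ≤ R →
      (∫ ω in Metric.sphere (0 : EuclideanSpace ℝ (Fin d)) 1,
          ‖∫ t : ℝ, Complex.exp (-Complex.I * ((⟪R • ω, γ t⟫ : ℝ) : ℂ)) * χ t‖ ^ q
        ∂μH[(d:ℝ)-1]) ^ (1/q) ≤ C * R ^ (-(1:ℝ)/2) := by
  obtain ⟨m, rfl⟩ : ∃ m, d = m + 2 := ⟨d - 2, by omega⟩
  have hdim : (((m + 2 : ℕ) : ℝ) - 1) = ((m + 1 : ℕ) : ℝ) := by push_cast; ring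
  rw [hdim]
  have hq0 : 0 < q := by linarith
  have hm : Module.finrank ℝ (EuclideanSpace ℝ (Fin (m + 2))) = m + 2 := by simp
  obtain ⟨C, hC, hweak⟩ := exists_hausdorffMeasure_large_fourier_le hm hγ hab hind hsign
    (hχ.of_le (by exact_mod_cast le_top))
  obtain ⟨ε, hε, C₁, hC₁, hslabs⟩ :=
    exists_hausdorffMeasure_sphere_slabs_le hm (hind a ⟨le_rfl, hab.le⟩)
  set D : ℝ := C₁ * (‖deriv γ a‖ * ‖deriv (deriv γ) a‖) with hD
  have hD0 : 0 ≤ D := by positivity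
  have hsphere : μH[((m + 1 : ℕ) : ℝ)] (Metric.sphere (0 : EuclideanSpace ℝ (Fin (m + 2))) 1) ≤
      ENNReal.ofReal D := by
    refine (measure_mono fun ω hω => ?_).trans (hslabs (deriv γ a) (deriv (deriv γ) a)
      (by simpa using hε.le) (by simpa using hε.le) _ _ (norm_nonneg _) (norm_nonneg _))
    have hω1 : ‖ω‖ = 1 := mem_sphere_zero_iff_norm.1 hω
    refine ⟨hω1, ?_, ?_⟩ <;> simpa [hω1] using abs_real_inner_le_norm ω _
  set M : ℝ := D + C / (4 / q - 1) + 1 with hM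
  have hM0 : 0 < M := by
    have : 0 < 4 / q - 1 := sub_pos.2 ((one_lt_div hq0).2 hq4)
    positivity
  refine ⟨M ^ (1 / q), Real.rpow_pos_of_pos hM0 _, fun R hR => ?_⟩
  have hR0 : 0 < R := by linarith
  have hinterval : ∀ ω, ∫ t : ℝ, Complex.exp (-Complex.I * ((⟪R • ω, γ t⟫ : ℝ) : ℂ)) * χ t =
      ∫ t in a..b, Complex.exp (-Complex.I * ((⟪R • ω, γ t⟫ : ℝ) : ℂ)) * χ t := fun ω =>
    (intervalIntegral.integral_eq_integral_of_support_subset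
      ((Function.support_mul_subset_right _ _).trans (hχs.trans Set.Ioo_subset_Ioc_self))).symm
  simp only [hinterval]
  set F : EuclideanSpace ℝ (Fin (m + 2)) → ℝ := fun ω =>
    ‖∫ t in a..b, Complex.exp (-Complex.I * ((⟪R • ω, γ t⟫ : ℝ) : ℂ)) * χ t‖ with hF
  have hscaled := integral_rpow_le_of_weak_four
    (μ := μH[((m + 1 : ℕ) : ℝ)].restrict (Metric.sphere (0 : EuclideanSpace ℝ (Fin (m + 2))) 1))
    (f := fun ω => √R * F ω) (fun ω => by positivity) hC hD0 hq0 hq4 (by simpa using hsphere) (by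
      intro A hA
      rw [Measure.restrict_apply' Metric.isClosed_sphere.measurableSet]
      refine (measure_mono ?_).trans (hweak R A hR0 hA)
      rintro ω ⟨hω, hωS⟩
      exact ⟨mem_sphere_zero_iff_norm.1 hωS, hω⟩)
  have hpull : ∀ ω, (√R * F ω) ^ q = √R ^ q * F ω ^ q := fun ω =>
    Real.mul_rpow (Real.sqrt_nonneg R) (norm_nonneg _)
  simp only [hpull, integral_const_mul] at hscaled
  have hSq : 0 < √R ^ q := Real.rpow_pos_of_pos (Real.sqrt_pos.2 hR0) q
  have hint0 : 0 ≤ ∫ ω in Metric.sphere (0 : EuclideanSpace ℝ (Fin (m + 2))) 1, F ω ^ q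
      ∂μH[((m + 1 : ℕ) : ℝ)] := integral_nonneg fun ω => Real.rpow_nonneg (norm_nonneg _) q
  have hle : ∫ ω in Metric.sphere (0 : EuclideanSpace ℝ (Fin (m + 2))) 1, F ω ^ q
      ∂μH[((m + 1 : ℕ) : ℝ)] ≤ M * (√R ^ q)⁻¹ := by
    rw [← div_eq_mul_inv, le_div_iff₀ hSq, mul_comm]
    linarith
  calc _ ≤ (M * (√R ^ q)⁻¹) ^ (1 / q) := Real.rpow_le_rpow hint0 hle (by positivity)
    _ = M ^ (1 / q) * R ^ (-(1 : ℝ) / 2) := by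
        rw [Real.mul_rpow hM0.le (by positivity), ← Real.rpow_neg (Real.sqrt_nonneg R),
          ← Real.rpow_mul (Real.sqrt_nonneg R), Real.sqrt_eq_rpow, ← Real.rpow_mul hR0.le]
        congr 2
        field_simp
end

section
/- Under the same hypotheses (γ ∈ C² with γ', γ'' linearly independent everywhere, ⟨ω,γ''(·)⟩ having at most N sign changes for every ω ∈ S^{d-1}, χ smooth compactly supported in the interior of I), for 4 < q ≤ ∞ there is C such that (∫_{S^{d-1}} |μ̂(Rω)|^q dω)^{1/q} ≤ C R^{-2/q} for all R ≥ 2. -/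
open Real MeasureTheory
open scoped RealInnerProductSpace

theorem norm_integral_exp_mul_le_div {φ φ' φ'' : ℝ → ℝ} {χ χ' : ℝ → ℂ}
    (hφ : ∀ t, HasDerivAt φ (φ' t) t) (hφ' : ∀ t, HasDerivAt φ' (φ'' t) t)
    (hφ'' : Continuous φ'') (hχ : ∀ t, HasDerivAt χ (χ' t) t) (hχ' : Continuous χ')
    {X X' A c d : ℝ} (hX : ∀ t, ‖χ t‖ ≤ X) (hX' : ∀ t, ‖χ' t‖ ≤ X') (hA : 0 < A) (hcd : c ≤ d)
    (hlow : c < d → ∀ t ∈ Set.Icc c d, A ≤ |φ' t|)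
    (hsign : (∀ t ∈ Set.Icc c d, 0 ≤ φ'' t) ∨ (∀ t ∈ Set.Icc c d, φ'' t ≤ 0)) :
    ‖∫ t in c..d, Complex.exp (-Complex.I * (φ t : ℂ)) * χ t‖ ≤ (4 * X + X' * (d - c)) / A := by
  have hX0 : 0 ≤ X := (norm_nonneg _).trans (hX 0)
  have hX'0 : 0 ≤ X' := (norm_nonneg _).trans (hX' 0)
  rcases hcd.eq_or_lt with rfl | hlt
  · simp only [intervalIntegral.integral_same, norm_zero]
    positivity
  have hlow := hlow hlt
  have hne : ∀ t ∈ Set.Icc c d, φ' t ≠ 0 := fun t ht h0 => by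
    have := hlow t ht
    rw [h0, abs_zero] at this
    linarith
  have hcφ' : Continuous φ' := continuous_iff_continuousAt.2 fun t => (hφ' t).continuousAt
  have hcφ : Continuous φ := continuous_iff_continuousAt.2 fun t => (hφ t).continuousAt
  have hcχ : Continuous χ := continuous_iff_continuousAt.2 fun t => (hχ t).continuousAt
  have huIcc : Set.uIcc c d = Set.Icc c d := Set.uIcc_of_le hcd
  let u : ℝ → ℂ := fun t => χ t / (φ' t : ℂ)
  let u' : ℝ → ℂ := fun t => (χ' t * (φ' t : ℂ) - χ t * (φ'' t : ℂ)) / (φ' t : ℂ) ^ 2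
  let v : ℝ → ℂ := fun t => Complex.I * Complex.exp (-Complex.I * (φ t : ℂ))
  let v' : ℝ → ℂ := fun t => (φ' t : ℂ) * Complex.exp (-Complex.I * (φ t : ℂ))
  have hexp : ∀ t, ‖Complex.exp (-Complex.I * (φ t : ℂ))‖ = 1 := fun t => by
    rw [show -Complex.I * (φ t : ℂ) = ((-φ t : ℝ) : ℂ) * Complex.I by push_cast; ring]
    exact Complex.norm_exp_ofReal_mul_I _
  have hu : ∀ t ∈ Set.uIcc c d, HasDerivAt u (u' t) t := fun t ht => by
    rw [huIcc] at ht
    exact (hχ t).div (hφ' t).ofReal_comp (by exact_mod_cast hne t ht)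
  have hv : ∀ t ∈ Set.uIcc c d, HasDerivAt v (v' t) t := fun t _ => by
    have h := (((hφ t).ofReal_comp.const_mul (-Complex.I)).cexp).const_mul Complex.I
    refine h.congr_deriv ?_
    linear_combination (-(φ' t : ℂ) * Complex.exp (-Complex.I * (φ t : ℂ))) * Complex.I_sq
  have hu'c : ContinuousOn u' (Set.Icc c d) := by
    refine ContinuousOn.div (by fun_prop) (by fun_prop) fun t ht => ?_
    have := hne t ht
    exact_mod_cast pow_ne_zero 2 this
  have hu'i : IntervalIntegrable u' volume c d := by
    apply ContinuousOn.intervalIntegrable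
    rwa [huIcc]
  have hv'i : IntervalIntegrable v' volume c d := by
    apply Continuous.intervalIntegrable
    fun_prop
  have hparts := intervalIntegral.integral_mul_deriv_eq_deriv_mul hu hv hu'i hv'i
  have heq : ∫ t in c..d, Complex.exp (-Complex.I * (φ t : ℂ)) * χ t = ∫ t in c..d, u t * v' t := by
    apply intervalIntegral.integral_congr
    intro t ht
    rw [huIcc] at ht
    have : (φ' t : ℂ) ≠ 0 := by exact_mod_cast hne t ht
    simp only [u, v']
    field_simp
  have hvn : ∀ t, ‖v t‖ = 1 := fun t => by simp only [v, norm_mul, Complex.norm_I, hexp, one_mul]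
  have hun : ∀ t ∈ Set.Icc c d, ‖u t‖ ≤ X / A := fun t ht => by
    simp only [u, norm_div, Complex.norm_real, Real.norm_eq_abs]
    exact div_le_div₀ hX0 (hX t) hA (hlow t ht)
  have hinv : ∀ t ∈ Set.Icc c d, |1 / φ' t| ≤ 1 / A := fun t ht => by
    rw [abs_div, abs_one]
    exact one_div_le_one_div_of_le hA (hlow t ht)
  have hc_mem : c ∈ Set.Icc c d := ⟨le_rfl, hcd⟩
  have hd_mem : d ∈ Set.Icc c d := ⟨hcd, le_rfl⟩
  have hgc : ContinuousOn (fun t => φ'' t / φ' t ^ 2) (Set.Icc c d) :=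
    ContinuousOn.div (by fun_prop) (by fun_prop) fun t ht => pow_ne_zero 2 (hne t ht)
  have hgi : IntervalIntegrable (fun t => φ'' t / φ' t ^ 2) volume c d := by
    apply ContinuousOn.intervalIntegrable
    rwa [huIcc]
  have hftc : ∫ t in c..d, φ'' t / φ' t ^ 2 = 1 / φ' c - 1 / φ' d := by
    have h := intervalIntegral.integral_eq_sub_of_hasDerivAt (f := fun t => -(1 / φ' t))
      (f' := fun t => φ'' t / φ' t ^ 2) (a := c) (b := d) (fun t ht => by
        rw [huIcc] at ht
        have := ((hφ' t).inv (hne t ht)).neg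
        convert this using 1
        · ext; simp
        · ring) hgi
    rw [h]; ring
  have habs : ∫ t in c..d, |φ'' t| / φ' t ^ 2 ≤ 2 / A := by
    have h1 := abs_le.1 (hinv c hc_mem)
    have h2 := abs_le.1 (hinv d hd_mem)
    have h3 : 2 / A = 1 / A + 1 / A := by ring
    rcases hsign with hs | hs
    · have : ∫ t in c..d, |φ'' t| / φ' t ^ 2 = ∫ t in c..d, φ'' t / φ' t ^ 2 := by
        apply intervalIntegral.integral_congr
        intro t ht
        rw [huIcc] at ht
        simp only [abs_of_nonneg (hs t ht)]
      rw [this, hftc]; linarith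
    · have : ∫ t in c..d, |φ'' t| / φ' t ^ 2 = -∫ t in c..d, φ'' t / φ' t ^ 2 := by
        rw [← intervalIntegral.integral_neg]
        apply intervalIntegral.integral_congr
        intro t ht
        rw [huIcc] at ht
        simp only [abs_of_nonpos (hs t ht), neg_div]
      rw [this, hftc]; linarith
  have hagi : IntervalIntegrable (fun t => |φ'' t| / φ' t ^ 2) volume c d := by
    apply ContinuousOn.intervalIntegrable
    rw [huIcc]
    exact ContinuousOn.div (by fun_prop) (by fun_prop) fun t ht => pow_ne_zero 2 (hne t ht)
  have hmain : ‖∫ t in c..d, u' t * v t‖ ≤ X' / A * (d - c) + X * (2 / A) := by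
    calc ‖∫ t in c..d, u' t * v t‖
        ≤ ∫ t in c..d, (X' / A + X * (|φ'' t| / φ' t ^ 2)) := by
          refine intervalIntegral.norm_integral_le_of_norm_le hcd ?_
            ((intervalIntegrable_const).add (hagi.const_mul X))
          refine Filter.Eventually.of_forall fun t ht => ?_
          have ht : t ∈ Set.Icc c d := Set.Ioc_subset_Icc_self ht
          have h0 : (φ' t : ℂ) ≠ 0 := by exact_mod_cast hne t ht
          have hsplit : u' t = χ' t / (φ' t : ℂ) - χ t * ((φ'' t : ℂ) / (φ' t : ℂ) ^ 2) := by
            simp only [u']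
            field_simp
          rw [norm_mul, hvn, mul_one, hsplit]
          refine (norm_sub_le _ _).trans (add_le_add ?_ ?_)
          · rw [norm_div, Complex.norm_real, Real.norm_eq_abs]
            exact div_le_div₀ hX'0 (hX' t) hA (hlow t ht)
          · rw [norm_mul, norm_div, norm_pow, Complex.norm_real, Complex.norm_real,
              Real.norm_eq_abs, Real.norm_eq_abs, sq_abs]
            exact mul_le_mul_of_nonneg_right (hX t) (by positivity)
      _ = X' / A * (d - c) + X * ∫ t in c..d, |φ'' t| / φ' t ^ 2 := by
          rw [intervalIntegral.integral_add intervalIntegrable_const (hagi.const_mul X),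
            intervalIntegral.integral_const, intervalIntegral.integral_const_mul]
          simp only [smul_eq_mul]; ring
      _ ≤ _ := by gcongr
  rw [heq, hparts]
  calc ‖u d * v d - u c * v c - ∫ t in c..d, u' t * v t‖
      ≤ ‖u d * v d‖ + ‖u c * v c‖ + ‖∫ t in c..d, u' t * v t‖ :=
        (norm_sub_le _ _).trans (add_le_add (norm_sub_le _ _) le_rfl)
    _ ≤ X / A + X / A + (X' / A * (d - c) + X * (2 / A)) := by
        refine add_le_add (add_le_add ?_ ?_) hmain
        · rw [norm_mul, hvn, mul_one]; exact hun d hd_mem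
        · rw [norm_mul, hvn, mul_one]; exact hun c hc_mem
    _ = _ := by ring

theorem exists_level_split {g : ℝ → ℝ} (hg : Continuous g) {c d : ℝ} (hcd : c ≤ d)
    (hm : MonotoneOn g (Set.Icc c d)) (y : ℝ) :
    ∃ p ∈ Set.Icc c d, (c < p → ∀ t ∈ Set.Icc c p, g t ≤ y) ∧
      (p < d → ∀ t ∈ Set.Icc p d, y ≤ g t) := by
  have hc : c ∈ Set.Icc c d := ⟨le_rfl, hcd⟩
  have hd : d ∈ Set.Icc c d := ⟨hcd, le_rfl⟩
  rcases le_total y (g c) with h | h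
  · exact ⟨c, hc, fun h => absurd h (lt_irrefl _), fun _ t ht => h.trans (hm hc ht ht.1)⟩
  rcases le_total (g d) y with h' | h'
  · exact ⟨d, hd, fun _ t ht => (hm ht hd ht.2).trans h', fun h => absurd h (lt_irrefl _)⟩
  obtain ⟨p, hp, rfl⟩ := intermediate_value_Icc hcd hg.continuousOn ⟨h, h'⟩
  exact ⟨p, hp, fun _ t ht => hm ⟨ht.1, ht.2.trans hp.2⟩ hp ht.2,
    fun _ t ht => hm hp ⟨hp.1.trans ht.1, ht.2⟩ ht.1⟩

theorem exists_band_split {g : ℝ → ℝ} (hg : Continuous g) {c d A : ℝ} (hcd : c ≤ d)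
    (hm : MonotoneOn g (Set.Icc c d) ∨ AntitoneOn g (Set.Icc c d)) :
    ∃ p r, c ≤ p ∧ p ≤ r ∧ r ≤ d ∧ (c < p → ∀ t ∈ Set.Icc c p, A ≤ |g t|) ∧
      (p < r → ∀ t ∈ Set.Icc p r, |g t| ≤ A) ∧ (r < d → ∀ t ∈ Set.Icc r d, A ≤ |g t|) := by
  wlog hmono : MonotoneOn g (Set.Icc c d) generalizing g
  · have hanti := hm.resolve_left hmono
    have := this (g := fun t => -g t) hg.neg (Or.inl hanti.neg) hanti.neg
    simpa only [abs_neg] using this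
  obtain ⟨p, hp, hp1, hp2⟩ := exists_level_split hg hcd hmono (-A)
  obtain ⟨r, hr, hr1, hr2⟩ := exists_level_split hg hp.2
    (hmono.mono (Set.Icc_subset_Icc_left hp.1)) A
  refine ⟨p, r, hp.1, hr.1, hr.2, fun h t ht => ?_, fun h t ht => ?_, fun h t ht => ?_⟩
  · have := hp1 h t ht
    exact le_abs.2 (Or.inr (by linarith))
  · exact abs_le.2 ⟨hp2 (h.trans_le hr.2) t ⟨ht.1, ht.2.trans hr.2⟩, hr1 h t ht⟩
  · exact (hr2 h t ht).trans (le_abs_self _)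

/-- `g` takes alternating strict signs, starting with the sign of `σ`, at `n` successive points
of `[c, d]`. -/
def Alternates (g : ℝ → ℝ) (d : ℝ) : ℕ → ℝ → ℝ → Prop
  | 0, _, _ => True
  | n + 1, σ, c => ∃ t ∈ Set.Icc c d, 0 < σ * g t ∧ Alternates g d n (-σ) t

theorem Alternates.exists_strictMono {g : ℝ → ℝ} {d : ℝ} : ∀ {n : ℕ} {σ c : ℝ},
    Alternates g d (n + 1) σ c → ∃ t : Fin (n + 1) → ℝ, StrictMono t ∧ (∀ i, t i ∈ Set.Icc c d) ∧
      0 < σ * g (t 0) ∧ ∀ i : Fin n, g (t i.castSucc) * g (t i.succ) < 0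
  | 0, σ, c, ⟨t, ht, hpos, _⟩ =>
    ⟨fun _ => t, fun i j hij => absurd hij (by lia), fun _ => ht, hpos, fun i => i.elim0⟩
  | n + 1, σ, c, ⟨t, ht, hpos, halt⟩ => by
    obtain ⟨s, hs, hmem, hs0, hneg⟩ := halt.exists_strictMono
    have hprod : g t * g (s 0) < 0 := by
      by_contra! h
      nlinarith [mul_pos hpos hs0, mul_nonneg (sq_nonneg σ) h]
    have hts : t < s 0 := by
      refine lt_of_le_of_ne (hmem 0).1 fun h => ?_
      rw [← h] at hprod
      nlinarith [mul_self_nonneg (g t)]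
    refine ⟨Fin.cons t s, ?_, ?_, by simpa using hpos, ?_⟩
    · refine Fin.strictMono_iff_lt_succ.2 fun i => ?_
      refine Fin.cases ?_ (fun j => ?_) i
      · simpa using hts
      · rw [← Fin.succ_castSucc, Fin.cons_succ, Fin.cons_succ]
        exact hs (Fin.castSucc_lt_succ)
    · refine fun i => Fin.cases ?_ (fun j => ?_) i
      · simpa using ht
      · simpa using ⟨ht.1.trans (hmem j).1, (hmem j).2⟩
    · refine fun i => Fin.cases ?_ (fun j => ?_) i
      · simpa using hprod
      · rw [← Fin.succ_castSucc, Fin.cons_succ, Fin.cons_succ]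
        exact hneg j

theorem norm_integral_le_of_not_alternates {g : ℝ → ℝ} (hg : Continuous g) {F : ℝ → ℂ}
    (hF : Continuous F) {a d B : ℝ} (hB0 : 0 ≤ B)
    (hB : ∀ x y, a ≤ x → x ≤ y → y ≤ d →
      ((∀ t ∈ Set.Icc x y, 0 ≤ g t) ∨ (∀ t ∈ Set.Icc x y, g t ≤ 0)) → ‖∫ t in x..y, F t‖ ≤ B) :
    ∀ (n : ℕ) (σ c : ℝ), σ ^ 2 = 1 → a ≤ c → c ≤ d → ¬ Alternates g d n σ c →
      ‖∫ t in c..d, F t‖ ≤ n * B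
  | 0, σ, c, _, _, _, h => absurd trivial h
  | n + 1, σ, c, hσ, hac, hcd, h => by
    have hσ' : σ = 1 ∨ σ = -1 := sq_eq_one_iff.1 hσ
    have hone : ∀ y, c ≤ y → y ≤ d → (∀ t ∈ Set.Icc c y, σ * g t ≤ 0) →
        ‖∫ t in c..y, F t‖ ≤ B := fun y hy hyd hs => by
      refine hB c y hac hy hyd ?_
      rcases hσ' with rfl | rfl
      · exact Or.inr fun t ht => by linarith [hs t ht]
      · exact Or.inl fun t ht => by linarith [hs t ht]
    let P : Set ℝ := {t | t ∈ Set.Icc c d ∧ 0 < σ * g t}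
    rcases P.eq_empty_or_nonempty with hP | hP
    · have := hone d hcd le_rfl fun t ht => by
        by_contra! hc
        exact (Set.eq_empty_iff_forall_notMem.1 hP t) ⟨ht, hc⟩
      push_cast
      nlinarith [mul_nonneg (Nat.cast_nonneg (α := ℝ) n) hB0]
    have hbdd : BddBelow P := ⟨c, fun t ht => ht.1.1⟩
    set s := sInf P with hs
    have hcs : c ≤ s := le_csInf hP fun t ht => ht.1.1
    have hsd : s ≤ d := (csInf_le hbdd hP.some_mem).trans hP.some_mem.1.2
    have hσg : Continuous fun t => σ * g t := by fun_prop
    have hs0 : 0 ≤ σ * g s := by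
      have hcl : s ∈ closure P := csInf_mem_closure hP hbdd
      have : P ⊆ {t | 0 ≤ σ * g t} := fun t ht => ht.2.le
      exact (closure_minimal this (isClosed_le continuous_const hσg)) hcl
    have hleft : ∀ t, c ≤ t → t < s → σ * g t ≤ 0 := fun t hct hts => by
      by_contra! hc
      exact absurd (csInf_le hbdd (show t ∈ P from ⟨⟨hct, hts.le.trans hsd⟩, hc⟩)) (not_le.2 hts)
    have hleft' : ‖∫ t in c..s, F t‖ ≤ B := by
      rcases hcs.eq_or_lt with hcs' | hcs'
      · rw [← hcs']; simpa using hB0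
      · refine hone s hcs hsd fun t ht => ?_
        have hcl : t ∈ closure (Set.Ico c s) := by rwa [closure_Ico hcs'.ne]
        exact (closure_minimal (fun t ht => hleft t ht.1 ht.2 : Set.Ico c s ⊆ {t | σ * g t ≤ 0})
          (isClosed_le hσg continuous_const)) hcl
    have hright : ¬ Alternates g d n (-σ) s := by
      intro halt
      cases n with
      | zero =>
        obtain ⟨t, ht, hpos⟩ := hP
        exact h ⟨t, ht, hpos, trivial⟩
      | succ m =>
        obtain ⟨t', ht', hpos', halt'⟩ := halt
        have hst : s < t' := by
          refine lt_of_le_of_ne ht'.1 fun he => ?_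
          rw [← he] at hpos'
          linarith
        obtain ⟨t, ht, htt'⟩ := exists_lt_of_csInf_lt hP (hs ▸ hst)
        exact h ⟨t, ht.1, ht.2, t', ⟨htt'.le, ht'.2⟩, hpos', halt'⟩
    have hrec := norm_integral_le_of_not_alternates hg hF hB0 hB n (-σ) s (by simpa using hσ)
      (hac.trans hcs) hsd hright
    rw [← intervalIntegral.integral_add_adjacent_intervals (hF.intervalIntegrable c s)
      (hF.intervalIntegrable s d)]
    push_cast
    linarith [norm_add_le (∫ t in c..s, F t) (∫ t in s..d, F t)]

open NormedSpace in
theorem norm_normalize_sub_normalize_le {E : Type*} [NormedAddCommGroup E] [NormedSpace ℝ E]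
    {x y : E} (hx : 1 ≤ ‖x‖) (hy : y ≠ 0) : ‖normalize x - normalize y‖ ≤ 2 * ‖x - y‖ := by
  have hx0 : 0 < ‖x‖ := by linarith
  have h : ‖x‖ • (normalize x - normalize y) = (x - y) + (‖y‖ - ‖x‖) • normalize y := by
    rw [smul_sub, norm_smul_normalize, sub_smul, norm_smul_normalize]
    abel
  have h2 : ‖x‖ * ‖normalize x - normalize y‖ ≤ 2 * ‖x - y‖ := by
    calc ‖x‖ * ‖normalize x - normalize y‖ = ‖‖x‖ • (normalize x - normalize y)‖ := by
          rw [norm_smul, norm_norm]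
      _ ≤ ‖x - y‖ + ‖(‖y‖ - ‖x‖) • normalize y‖ := by rw [h]; exact norm_add_le _ _
      _ ≤ ‖x - y‖ + ‖x - y‖ := by
          rw [norm_smul, norm_normalize_eq_one_iff.2 hy, mul_one, Real.norm_eq_abs, abs_sub_comm]
          gcongr
          exact abs_norm_sub_norm_le x y
      _ = 2 * ‖x - y‖ := by ring
  nlinarith [norm_nonneg (normalize x - normalize y)]

section SphereBox

variable {E : Type*} [NormedAddCommGroup E] [InnerProductSpace ℝ E] [MeasurableSpace E]
  [BorelSpace E] {n : ℕ}

open NormedSpace in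
theorem hausdorffMeasure_sphere_box_face_le (b : OrthonormalBasis (Fin (n + 1)) ℝ E)
    {r : Fin (n + 1) → ℝ} (hr : ∀ i, 0 ≤ r i) (j : Fin (n + 1)) {σ : ℝ} (hσ : σ ^ 2 = 1) :
    μH[n] {ω : E | ‖ω‖ = 1 ∧ (∀ i, |⟪b i, ω⟫| ≤ r i) ∧ 1 / ((n : ℝ) + 1) ≤ σ * ⟪b j, ω⟫} ≤
      ENNReal.ofReal ((2 * n) ^ n * (2 * (n + 1)) ^ n * (n + 1) * ∏ i, r i) := by
  set T := {ω : E | ‖ω‖ = 1 ∧ (∀ i, |⟪b i, ω⟫| ≤ r i) ∧ 1 / ((n : ℝ) + 1) ≤ σ * ⟪b j, ω⟫} with hT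
  have hn : (0 : ℝ) < n + 1 := by positivity
  rcases T.eq_empty_or_nonempty with h0 | ⟨ω₀, hω₀⟩
  · rw [h0]; simp
  have habsσ : |σ| = 1 := by
    rcases sq_eq_one_iff.1 hσ with rfl | rfl <;> simp
  have hrj : 1 / ((n : ℝ) + 1) ≤ r j := by
    refine hω₀.2.2.trans ((le_abs_self _).trans ?_)
    rw [abs_mul, habsσ, one_mul]
    exact hω₀.2.1 j
  let L : (Fin n → ℝ) → E := fun y => σ • b j + ∑ i, y i • b (j.succAbove i)
  have hLinner : ∀ y, ⟪b j, L y⟫ = σ := fun y => by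
    simp only [L, inner_add_right, inner_sum, inner_smul_right, b.inner_eq_ite]
    simp
  have hLnorm : ∀ y, 1 ≤ ‖L y‖ := fun y => by
    have := abs_real_inner_le_norm (b j) (L y)
    rwa [hLinner, habsσ, b.norm_eq_one, one_mul] at this
  let B : Set (Fin n → ℝ) := Set.Icc (fun i => -((n + 1) * r (j.succAbove i)))
    (fun i => (n + 1) * r (j.succAbove i))
  have hsub : T ⊆ (fun y => normalize (L y)) '' B := by
    rintro ω ⟨hω, hbox, hj⟩
    have hs : 0 < σ * ⟪b j, ω⟫ := lt_of_lt_of_le (by positivity) hj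
    refine ⟨fun i => (σ * ⟪b j, ω⟫)⁻¹ * ⟪b (j.succAbove i), ω⟫, ?_, ?_⟩
    · have hinv : (σ * ⟪b j, ω⟫)⁻¹ ≤ n + 1 := by
        rw [inv_le_comm₀ hs hn]; simpa using hj
      have : ∀ i, |(σ * ⟪b j, ω⟫)⁻¹ * ⟪b (j.succAbove i), ω⟫| ≤ (n + 1) * r (j.succAbove i) :=
        fun i => by
          rw [abs_mul, abs_of_pos (inv_pos.2 hs)]
          exact mul_le_mul hinv (hbox _) (abs_nonneg _) hn.le
      exact ⟨fun i => (abs_le.1 (this i)).1, fun i => (abs_le.1 (this i)).2⟩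
    · have hL : L (fun i => (σ * ⟪b j, ω⟫)⁻¹ * ⟪b (j.succAbove i), ω⟫) = (σ * ⟪b j, ω⟫)⁻¹ • ω := by
        have h1 : ⟪b j, ω⟫ ≠ 0 := fun h => by rw [h] at hs; simp at hs
        have h2 : σ ≠ 0 := fun h => by rw [h] at hs; simp at hs
        have h3 : (σ * ⟪b j, ω⟫)⁻¹ * ⟪b j, ω⟫ = σ := by
          field_simp
          exact hσ.symm
        trans (σ * ⟪b j, ω⟫)⁻¹ • ∑ i, ⟪b i, ω⟫ • b i
        · rw [Fin.sum_univ_succAbove _ j, smul_add, Finset.smul_sum]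
          simp only [L, smul_smul, h3]
        · rw [b.sum_repr']
      simp only [hL]
      rw [normalize_smul_of_pos (inv_pos.2 hs), normalize_eq_self_of_norm_eq_one hω]
  have hlip : LipschitzOnWith (2 * n) (fun y => normalize (L y)) B := by
    refine LipschitzOnWith.of_dist_le_mul fun x _ y _ => ?_
    rw [dist_eq_norm, dist_eq_norm]
    have hy0 : L y ≠ 0 := norm_pos_iff.1 (by linarith [hLnorm y])
    refine (norm_normalize_sub_normalize_le (hLnorm x) hy0).trans ?_
    have : ‖L x - L y‖ ≤ n * ‖x - y‖ := by
      have : L x - L y = ∑ i, (x i - y i) • b (j.succAbove i) := by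
        simp only [L, sub_smul, Finset.sum_sub_distrib]; abel
      rw [this]
      refine (norm_sum_le_of_le _ (n := fun _ => ‖x - y‖) fun i _ => ?_).trans (by simp)
      rw [norm_smul, b.norm_eq_one, mul_one]
      exact norm_le_pi_norm (x - y) i
    push_cast
    nlinarith
  calc μH[n] T ≤ μH[n] ((fun y => normalize (L y)) '' B) := measure_mono hsub
    _ ≤ ((2 * n : NNReal) : ENNReal) ^ (n : ℝ) * μH[n] B :=
        hlip.hausdorffMeasure_image_le (Nat.cast_nonneg n)
    _ = ENNReal.ofReal ((2 * n) ^ n * ∏ i, (2 * (n + 1) * r (j.succAbove i))) := by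
        have hvol : (μH[n] : Measure (Fin n → ℝ)) = volume := by
          have := hausdorffMeasure_pi_real (ι := Fin n)
          rwa [Fintype.card_fin] at this
        rw [hvol, Real.volume_Icc_pi, ENNReal.rpow_natCast, ENNReal.ofReal_mul (by positivity),
          ENNReal.ofReal_prod_of_nonneg (fun i _ => mul_nonneg (by positivity) (hr _))]
        congr 1
        · rw [ENNReal.ofReal_pow (by positivity)]
          congr 1
          rw [ENNReal.ofReal_mul (by norm_num)]
          simp
        · refine Finset.prod_congr rfl fun i _ => ?_
          congr 1; ring
    _ ≤ _ := by
        apply ENNReal.ofReal_le_ofReal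
        rw [Finset.prod_mul_distrib, Finset.prod_const, Finset.card_univ, Fintype.card_fin,
          Fin.prod_univ_succAbove r j, mul_assoc ((2 * (n : ℝ)) ^ n), mul_assoc ((2 * (n : ℝ)) ^ n),
          mul_assoc ((2 * ((n : ℝ) + 1)) ^ n)]
        gcongr
        have hp : 0 ≤ ∏ i, r (j.succAbove i) := Finset.prod_nonneg fun i _ => hr _
        have : 1 ≤ ((n : ℝ) + 1) * r j := by rwa [div_le_iff₀' hn] at hrj
        nlinarith

theorem hausdorffMeasure_sphere_box_le_s14 (b : OrthonormalBasis (Fin (n + 1)) ℝ E)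
    {r : Fin (n + 1) → ℝ} (hr : ∀ i, 0 ≤ r i) :
    μH[n] {ω : E | ‖ω‖ = 1 ∧ ∀ i, |⟪b i, ω⟫| ≤ r i} ≤
      ENNReal.ofReal (2 * (n + 1) * ((2 * n) ^ n * (2 * (n + 1)) ^ n * (n + 1)) * ∏ i, r i) := by
  let σ : Bool → ℝ := fun s => cond s 1 (-1)
  have hσ : ∀ s, σ s ^ 2 = 1 := fun s => by cases s <;> simp [σ]
  have hn : (0 : ℝ) < n + 1 := by positivity
  have hsub : {ω : E | ‖ω‖ = 1 ∧ ∀ i, |⟪b i, ω⟫| ≤ r i} ⊆ ⋃ p : Fin (n + 1) × Bool,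
      {ω : E | ‖ω‖ = 1 ∧ (∀ i, |⟪b i, ω⟫| ≤ r i) ∧ 1 / ((n : ℝ) + 1) ≤ σ p.2 * ⟪b p.1, ω⟫} := by
    rintro ω ⟨hω, hbox⟩
    obtain ⟨j, hj⟩ : ∃ j, 1 / ((n : ℝ) + 1) ≤ |⟪b j, ω⟫| := by
      by_contra! hlt
      have hsum := b.sum_sq_norm_inner_right ω
      have : ∑ i, ‖⟪b i, ω⟫‖ ^ 2 < ∑ _i : Fin (n + 1), 1 / ((n : ℝ) + 1) := by
        refine Finset.sum_lt_sum_of_nonempty Finset.univ_nonempty fun i _ => ?_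
        have h1 := hlt i
        rw [Real.norm_eq_abs]
        have h2 : 1 / ((n : ℝ) + 1) ≤ 1 := by
          rw [div_le_one hn]; linarith [Nat.cast_nonneg (α := ℝ) n]
        nlinarith [abs_nonneg ⟪b i, ω⟫]
      rw [hsum, hω, Finset.sum_const, Finset.card_univ, Fintype.card_fin] at this
      simp only [nsmul_eq_mul, Nat.cast_add, Nat.cast_one] at this
      rw [mul_one_div_cancel hn.ne'] at this
      norm_num at this
    rw [Set.mem_iUnion]
    rcases le_total 0 ⟪b j, ω⟫ with h | h
    · exact ⟨(j, true), hω, hbox, by simpa [σ, abs_of_nonneg h] using hj⟩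
    · exact ⟨(j, false), hω, hbox, by simpa [σ, abs_of_nonpos h] using hj⟩
  refine (measure_mono hsub).trans ((measure_iUnion_fintype_le _ _).trans ?_)
  refine (Finset.sum_le_sum fun p _ =>
    hausdorffMeasure_sphere_box_face_le b hr p.1 (hσ p.2)).trans (le_of_eq ?_)
  rw [Finset.sum_const, Finset.card_univ, nsmul_eq_mul, Fintype.card_prod, Fintype.card_fin,
    Fintype.card_bool, ← ENNReal.ofReal_natCast, ← ENNReal.ofReal_mul (by positivity)]
  congr 1
  push_cast
  ring

end SphereBox

section Strip

variable {E : Type*} [NormedAddCommGroup E] [InnerProductSpace ℝ E] [MeasurableSpace E]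
  [BorelSpace E] [FiniteDimensional ℝ E]

theorem hausdorffMeasure_sphere_strip_le {m : ℕ} (hE : Module.finrank ℝ E = m + 2) {v w : E}
    {c M α β : ℝ} (hc : 0 < c) (hv : c ≤ ‖v‖) (hw : ‖w‖ ≤ M)
    (hvw : ∀ s : ℝ, c ≤ ‖w - s • v‖) (hα : 0 ≤ α) (hβ : 0 ≤ β) :
    μH[(m + 1 : ℕ)] {ω : E | ‖ω‖ = 1 ∧ |⟪ω, v⟫| ≤ α ∧ |⟪ω, w⟫| ≤ β} ≤
      ENNReal.ofReal (2 * ((m + 1 : ℕ) + 1) * ((2 * (m + 1 : ℕ)) ^ (m + 1) *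
        (2 * ((m + 1 : ℕ) + 1)) ^ (m + 1) * ((m + 1 : ℕ) + 1)) *
          ((α / c) * ((β + M / c * α) / c))) := by
  have hM : 0 ≤ M := (norm_nonneg w).trans hw
  have hv0 : 0 < ‖v‖ := hc.trans_le hv
  set s : ℝ := ⟪v, w⟫ / ‖v‖ ^ 2 with hs
  set u : E := w - s • v with hu
  have hu0 : 0 < ‖u‖ := hc.trans_le (hvw s)
  have hvu : ⟪v, u⟫ = 0 := by
    rw [hu, inner_sub_right, inner_smul_right, real_inner_self_eq_norm_sq, hs]
    field_simp
    ring
  have hs_le : |s| ≤ M / c := by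
    rw [hs, abs_div, abs_of_pos (by positivity : 0 < ‖v‖ ^ 2), div_le_div_iff₀ (by positivity) hc]
    have h1 := abs_real_inner_le_norm v w
    calc |⟪v, w⟫| * c ≤ (‖v‖ * ‖w‖) * ‖v‖ := by gcongr
      _ ≤ (‖v‖ * M) * ‖v‖ := by gcongr
      _ = M * ‖v‖ ^ 2 := by ring
  let e : Fin (m + 2) → E := fun i => if i = 0 then ‖v‖⁻¹ • v else ‖u‖⁻¹ • u
  have he : Orthonormal ℝ (({0, 1} : Set (Fin (m + 2))).domRestrict e) := by
    constructor
    · rintro ⟨i, hi⟩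
      rcases hi with rfl | rfl
      · simp [Set.domRestrict, e, norm_smul, hv0.ne']
      · simp [Set.domRestrict, e, norm_smul, hu0.ne']
    · rintro ⟨i, hi⟩ ⟨j, hj⟩ hij
      rcases hi with rfl | rfl <;> rcases hj with rfl | rfl
      · exact absurd rfl hij
      · simp [Set.domRestrict, e, inner_smul_left, inner_smul_right, hvu]
      · simp [Set.domRestrict, e, inner_smul_left, inner_smul_right, real_inner_comm, hvu]
      · exact absurd rfl hij
  obtain ⟨b, hb⟩ := he.exists_orthonormalBasis_extension_of_card_eq (by simpa using hE)
  have hb0 : b 0 = ‖v‖⁻¹ • v := by simpa [e] using hb 0 (by simp)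
  have hb1 : b 1 = ‖u‖⁻¹ • u := by simpa [e] using hb 1 (by simp)
  let r : Fin (m + 2) → ℝ := Fin.cons (α / c) (Fin.cons ((β + M / c * α) / c) fun _ => 1)
  have hr0 : 0 ≤ α / c := by positivity
  have hr1 : 0 ≤ (β + M / c * α) / c := by positivity
  have hr : ∀ i, 0 ≤ r i := by
    refine Fin.cases ?_ (Fin.cases ?_ fun i => ?_)
    · simpa [r] using hr0
    · simpa [r] using hr1
    · simp [r]
  have hprod : ∏ i, r i = (α / c) * ((β + M / c * α) / c) := by
    rw [Fin.prod_univ_succ, Fin.prod_univ_succ]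
    simp [r]
  have hmain := hausdorffMeasure_sphere_box_le_s14 b hr
  rw [hprod] at hmain
  refine (measure_mono ?_).trans hmain
  rintro ω ⟨hω, h1, h2⟩
  refine ⟨hω, Fin.cases ?_ (Fin.cases ?_ fun i => ?_)⟩
  · have : |⟪b 0, ω⟫| ≤ α / c := by
      rw [hb0, inner_smul_left, abs_mul, real_inner_comm]
      simp only [conj_trivial, abs_inv, abs_norm]
      rw [inv_mul_eq_div]
      exact div_le_div₀ hα h1 hc hv
    simpa [r] using this
  · have hin : |⟪ω, u⟫| ≤ β + M / c * α := by
      rw [hu, inner_sub_right, inner_smul_right]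
      refine (abs_sub _ _).trans (add_le_add h2 ?_)
      rw [abs_mul]
      exact mul_le_mul hs_le h1 (abs_nonneg _) (by positivity)
    have : |⟪b 1, ω⟫| ≤ (β + M / c * α) / c := by
      rw [hb1, inner_smul_left, abs_mul, real_inner_comm]
      simp only [conj_trivial, abs_inv, abs_norm]
      rw [inv_mul_eq_div]
      exact div_le_div₀ (by positivity) hin hc (hvw s)
    simpa [r] using this
  · have h := abs_real_inner_le_norm (b i.succ.succ) ω
    rw [hω, b.norm_eq_one] at h
    simpa [r] using h

end Strip

theorem exists_uniform_transversality {E : Type*} [NormedAddCommGroup E] [NormedSpace ℝ E]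
    {g g' : ℝ → E} (hg : ∀ t, HasDerivAt g (g' t) t) (hg' : Continuous g') {a b : ℝ} (hab : a < b)
    (hind : ∀ t ∈ Set.Icc a b, LinearIndependent ℝ ![g t, g' t]) :
    ∃ c > 0, ∃ M, ∃ h₀ > 0, ∀ t h, a ≤ t → 0 < h → h ≤ h₀ → t + h ≤ b →
      c ≤ ‖g t‖ ∧ ‖h⁻¹ • (g (t + h) - g t)‖ ≤ M ∧
        ∀ s : ℝ, c ≤ ‖h⁻¹ • (g (t + h) - g t) - s • g t‖ := by
  have hgc : Continuous g := continuous_iff_continuousAt.2 fun t => (hg t).continuousAt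
  obtain ⟨c, hc, hcle⟩ : ∃ c > 0, ∀ t ∈ Set.Icc a b, ∀ x y : ℝ, ‖(x, y)‖ = 1 →
      c ≤ ‖x • g t + y • g' t‖ := by
    have hK : IsCompact (Set.Icc a b ×ˢ Metric.sphere (0 : ℝ × ℝ) 1) :=
      isCompact_Icc.prod (isCompact_sphere _ _)
    have hne : (Set.Icc a b ×ˢ Metric.sphere (0 : ℝ × ℝ) 1).Nonempty :=
      ⟨(a, (1, 0)), ⟨le_rfl, hab.le⟩, by simp [Prod.norm_def]⟩
    obtain ⟨p, hp, hmin⟩ := hK.exists_isMinOn hne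
      (f := fun p : ℝ × (ℝ × ℝ) => ‖p.2.1 • g p.1 + p.2.2 • g' p.1‖) (by fun_prop)
    refine ⟨‖p.2.1 • g p.1 + p.2.2 • g' p.1‖, ?_, fun t ht x y hxy => ?_⟩
    · refine norm_pos_iff.2 fun h => ?_
      have := LinearIndependent.pair_iff.1 (hind p.1 hp.1) _ _ h
      have h0 : p.2 = 0 := Prod.ext this.1 this.2
      have h1 := hp.2
      rw [h0] at h1
      simp at h1
    · exact hmin (show (t, (x, y)) ∈ Set.Icc a b ×ˢ Metric.sphere (0 : ℝ × ℝ) 1 from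
        ⟨ht, by simpa using hxy⟩)
  have hcv : ∀ t ∈ Set.Icc a b, c ≤ ‖g t‖ := fun t ht => by
    simpa using hcle t ht 1 0 (by simp [Prod.norm_def])
  have hcw : ∀ t ∈ Set.Icc a b, ∀ s : ℝ, c ≤ ‖g' t - s • g t‖ := fun t ht s => by
    have hpos : 0 < ‖((-s : ℝ), (1 : ℝ))‖ := norm_pos_iff.2 (by simp)
    have hone : 1 ≤ ‖((-s : ℝ), (1 : ℝ))‖ := by
      simp [Prod.norm_def]
    have h := hcle t ht (‖((-s : ℝ), (1 : ℝ))‖⁻¹ * -s) (‖((-s : ℝ), (1 : ℝ))‖⁻¹ * 1) (by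
      have : ((‖((-s : ℝ), (1 : ℝ))‖⁻¹ * -s, ‖((-s : ℝ), (1 : ℝ))‖⁻¹ * 1) : ℝ × ℝ) =
        ‖((-s : ℝ), (1 : ℝ))‖⁻¹ • ((-s : ℝ), (1 : ℝ)) := rfl
      rw [this, norm_smul, norm_inv, norm_norm, inv_mul_cancel₀ hpos.ne'])
    rw [mul_smul, mul_smul, ← smul_add, norm_smul, norm_inv, norm_norm, inv_mul_eq_div,
      le_div_iff₀ hpos] at h
    calc c ≤ c * ‖((-s : ℝ), (1 : ℝ))‖ := le_mul_of_one_le_right hc.le hone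
      _ ≤ _ := h
      _ = _ := by
        congr 1
        module
  obtain ⟨M, hM⟩ := isCompact_Icc.exists_bound_of_continuousOn (s := Set.Icc a b) hg'.continuousOn
  obtain ⟨δ, hδ, hunif⟩ := Metric.uniformContinuousOn_iff.1
    (isCompact_Icc.uniformContinuousOn_of_continuous (s := Set.Icc a b) hg'.continuousOn)
      (c / 2) (by positivity)
  refine ⟨c / 2, by positivity, M + c / 2, δ / 2, by positivity, fun t h hat hh hhδ htb => ?_⟩
  have ht : t ∈ Set.Icc a b := ⟨hat, by linarith⟩
  have hdiff : ‖h⁻¹ • (g (t + h) - g t) - g' t‖ ≤ c / 2 := by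
    have hmv := (convex_Icc t (t + h)).norm_image_sub_le_of_norm_hasDerivWithin_le
      (f := fun x => g x - x • g' t) (f' := fun x => g' x - (1 : ℝ) • g' t) (C := c / 2)
      (x := t) (y := t + h)
      (fun x _ => ((hg x).sub ((hasDerivAt_id x).smul_const (g' t))).hasDerivWithinAt)
      (fun x hx => by
        rw [one_smul, ← dist_eq_norm]
        refine (hunif x ⟨by linarith [hx.1], by linarith [hx.2]⟩ t ht ?_).le
        rw [Real.dist_eq, abs_of_nonneg (by linarith [hx.1])]
        linarith [hx.2]) ⟨le_rfl, by linarith⟩ ⟨by linarith, le_rfl⟩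
    have heq : h⁻¹ • (g (t + h) - g t) - g' t =
        h⁻¹ • (g (t + h) - (t + h) • g' t - (g t - t • g' t)) := by
      have : h⁻¹ • (g (t + h) - (t + h) • g' t - (g t - t • g' t)) =
        h⁻¹ • (g (t + h) - g t) - (h⁻¹ * h) • g' t := by module
      rw [this, inv_mul_cancel₀ hh.ne', one_smul]
    rw [heq, norm_smul, norm_inv, Real.norm_of_nonneg hh.le, inv_mul_le_iff₀ hh]
    refine hmv.trans (le_of_eq ?_)
    rw [add_sub_cancel_left, Real.norm_of_nonneg hh.le]
    ring
  refine ⟨by linarith [hcv t ht], ?_, fun s => ?_⟩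
  · have := norm_add_le (h⁻¹ • (g (t + h) - g t) - g' t) (g' t)
    rw [sub_add_cancel] at this
    linarith [hM t ht]
  · have h1 := hcw t ht s
    have h2 := norm_sub_le (h⁻¹ • (g (t + h) - g t) - s • g t)
      (h⁻¹ • (g (t + h) - g t) - g' t)
    have h3 : h⁻¹ • (g (t + h) - g t) - s • g t - (h⁻¹ • (g (t + h) - g t) - g' t) =
      g' t - s • g t := by abel
    rw [h3] at h2
    linarith

theorem norm_integral_exp_mul_le_of_grid {φ φ' φ'' : ℝ → ℝ} {χ χ' : ℝ → ℂ}
    (hφ : ∀ t, HasDerivAt φ (φ' t) t) (hφ' : ∀ t, HasDerivAt φ' (φ'' t) t)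
    (hφ'' : Continuous φ'') (hχ : ∀ t, HasDerivAt χ (χ' t) t) (hχ' : Continuous χ')
    {X X' A a b h : ℝ} {N : ℕ} (hX : ∀ t, ‖χ t‖ ≤ X) (hX' : ∀ t, ‖χ' t‖ ≤ X') (hA : 0 < A)
    (hab : a ≤ b) (hh : 0 < h)
    (hgrid : ∀ j : ℕ, a + j * h + h ≤ b → A < |φ' (a + j * h)| ∨ A < |φ' (a + j * h + h)|)
    (hsign : ChangesSignAtMost φ'' (Set.Icc a b) N) :
    ‖∫ t in a..b, Complex.exp (-Complex.I * (φ t : ℂ)) * χ t‖ ≤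
      (N + 2) * (2 * ((4 * X + X' * (b - a)) / A) + X * (2 * h)) := by
  have hX0 : 0 ≤ X := (norm_nonneg _).trans (hX 0)
  have hX'0 : 0 ≤ X' := (norm_nonneg _).trans (hX' 0)
  have hcφ' : Continuous φ' := continuous_iff_continuousAt.2 fun t => (hφ' t).continuousAt
  have hcφ : Continuous φ := continuous_iff_continuousAt.2 fun t => (hφ t).continuousAt
  have hcχ : Continuous χ := continuous_iff_continuousAt.2 fun t => (hχ t).continuousAt
  let F : ℝ → ℂ := fun t => Complex.exp (-Complex.I * (φ t : ℂ)) * χ t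
  have hF : Continuous F := by fun_prop
  have hFX : ∀ t, ‖F t‖ ≤ X := fun t => by
    simp only [F, norm_mul]
    rw [show -Complex.I * (φ t : ℂ) = ((-φ t : ℝ) : ℂ) * Complex.I by push_cast; ring,
      Complex.norm_exp_ofReal_mul_I, one_mul]
    exact hX t
  have hba : 0 ≤ b - a := by linarith
  have hB0 : 0 ≤ 2 * ((4 * X + X' * (b - a)) / A) + X * (2 * h) := by positivity
  have halt : ¬ Alternates φ'' b (N + 2) 1 a := fun halt => by
    obtain ⟨t, h1, h2, -, h3⟩ := halt.exists_strictMono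
    exact hsign ⟨t, h1, h2, h3⟩
  have key := norm_integral_le_of_not_alternates hφ'' hF hB0 (a := a) (d := b) ?_ (N + 2) 1 a
    (by norm_num) le_rfl hab halt
  · exact_mod_cast key
  intro x y hax hxy hyb hs
  have hmono : MonotoneOn φ' (Set.Icc x y) ∨ AntitoneOn φ' (Set.Icc x y) := by
    rcases hs with hs | hs
    · exact Or.inl (monotoneOn_of_deriv_nonneg (convex_Icc x y) hcφ'.continuousOn
        (fun t _ => (hφ' t).differentiableAt.differentiableWithinAt)
        fun t ht => by rw [(hφ' t).deriv]; exact hs t (interior_subset ht))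
    · exact Or.inr (antitoneOn_of_deriv_nonpos (convex_Icc x y) hcφ'.continuousOn
        (fun t _ => (hφ' t).differentiableAt.differentiableWithinAt)
        fun t ht => by rw [(hφ' t).deriv]; exact hs t (interior_subset ht))
  obtain ⟨p, r, hxp, hpr, hry, h1, h2, h3⟩ := exists_band_split (A := A) hcφ' hxy hmono
  have hI1 : ‖∫ t in x..p, F t‖ ≤ (4 * X + X' * (b - a)) / A := by
    refine (norm_integral_exp_mul_le_div hφ hφ' hφ'' hχ hχ' hX hX' hA hxp h1 ?_).trans ?_
    · exact hs.imp (fun hs t ht => hs t ⟨ht.1, by linarith [ht.2]⟩)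
        (fun hs t ht => hs t ⟨ht.1, by linarith [ht.2]⟩)
    · gcongr; linarith
  have hI3 : ‖∫ t in r..y, F t‖ ≤ (4 * X + X' * (b - a)) / A := by
    refine (norm_integral_exp_mul_le_div hφ hφ' hφ'' hχ hχ' hX hX' hA hry h3 ?_).trans ?_
    · exact hs.imp (fun hs t ht => hs t ⟨by linarith [ht.1], ht.2⟩)
        (fun hs t ht => hs t ⟨by linarith [ht.1], ht.2⟩)
    · gcongr; linarith
  have hlen : r - p ≤ 2 * h := by
    by_contra! hlt
    have hp0 : 0 ≤ (p - a) / h := div_nonneg (by linarith) hh.le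
    have hj1 := Nat.le_ceil ((p - a) / h)
    have hj2 := Nat.ceil_lt_add_one hp0
    rw [div_le_iff₀ hh] at hj1
    have hj3 : (⌈(p - a) / h⌉₊ : ℝ) * h < (p - a) + h := by
      have := mul_lt_mul_of_pos_right hj2 hh
      rwa [add_mul, div_mul_cancel₀ _ hh.ne', one_mul] at this
    have hband := h2 (by linarith)
    rcases hgrid ⌈(p - a) / h⌉₊ (by linarith) with hg | hg
    · exact absurd (hband _ ⟨by linarith, by linarith⟩) (not_le.2 hg)
    · exact absurd (hband _ ⟨by linarith, by linarith⟩) (not_le.2 hg)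
  have hI2 : ‖∫ t in p..r, F t‖ ≤ X * (2 * h) := by
    refine (intervalIntegral.norm_integral_le_of_norm_le_const fun t _ => hFX t).trans ?_
    rw [abs_of_nonneg (by linarith)]
    gcongr
  rw [← intervalIntegral.integral_add_adjacent_intervals (hF.intervalIntegrable x p)
      (hF.intervalIntegrable p y), ← intervalIntegral.integral_add_adjacent_intervals
      (hF.intervalIntegrable p r) (hF.intervalIntegrable r y)]
  linarith [norm_add_le (∫ t in x..p, F t) ((∫ t in p..r, F t) + ∫ t in r..y, F t),
    norm_add_le (∫ t in p..r, F t) (∫ t in r..y, F t)]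

theorem lintegral_rpow_le_of_weak_type {Ω : Type*} [MeasurableSpace Ω] {μ : Measure Ω} {f : Ω → ℝ}
    (hf : Measurable f) (hf0 : ∀ x, 0 ≤ f x) {L D p q : ℝ} (hL : 0 < L) (hD : 0 ≤ D)
    (hfL : ∀ᵐ x ∂μ, f x ≤ L) (hp : 0 < p) (hpq : p < q)
    (hweak : ∀ s, 0 < s → s ≤ L → μ {x | s < f x} ≤ ENNReal.ofReal (D * s ^ (-p))) :
    ∫⁻ x, ENNReal.ofReal (f x ^ q) ∂μ ≤ ENNReal.ofReal (q * (D * (L ^ (q - p) / (q - p)))) := by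
  have hq0 : 0 < q := hp.trans hpq
  rw [lintegral_rpow_eq_lintegral_meas_lt_mul μ (Filter.Eventually.of_forall hf0) hf.aemeasurable hq0,
    ENNReal.ofReal_mul hq0.le]
  gcongr
  have hpt : ∀ t ∈ Set.Ioi (0 : ℝ), μ {x | t < f x} * ENNReal.ofReal (t ^ (q - 1)) ≤
      (Set.Ioc 0 L).indicator (fun t => ENNReal.ofReal (D * t ^ (q - p - 1))) t := by
    intro t ht
    have ht : 0 < t := ht
    by_cases htL : t ≤ L
    · rw [Set.indicator_of_mem (show t ∈ Set.Ioc 0 L from ⟨ht, htL⟩)]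
      calc _ ≤ ENNReal.ofReal (D * t ^ (-p)) * ENNReal.ofReal (t ^ (q - 1)) := by
            gcongr
            exact hweak t ht htL
        _ = _ := by
            rw [← ENNReal.ofReal_mul (by positivity), mul_assoc, ← Real.rpow_add ht]
            congr 3
            ring
    · have : μ {x | t < f x} = 0 :=
        measure_mono_null (fun x (hx : t < f x) => not_le.2 ((not_le.1 htL).trans hx)) hfL
      rw [this, zero_mul]
      exact bot_le
  have hint : IntegrableOn (fun t : ℝ => D * t ^ (q - p - 1)) (Set.Ioc 0 L) := by
    have := (intervalIntegral.intervalIntegrable_rpow' (a := 0) (b := L)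
      (by linarith : -1 < q - p - 1)).const_mul D
    rwa [intervalIntegrable_iff_integrableOn_Ioc_of_le hL.le] at this
  calc ∫⁻ t in Set.Ioi 0, μ {x | t < f x} * ENNReal.ofReal (t ^ (q - 1))
      ≤ ∫⁻ t in Set.Ioi 0,
          (Set.Ioc 0 L).indicator (fun t => ENNReal.ofReal (D * t ^ (q - p - 1))) t :=
        setLIntegral_mono' measurableSet_Ioi hpt
    _ ≤ ∫⁻ t, (Set.Ioc 0 L).indicator (fun t => ENNReal.ofReal (D * t ^ (q - p - 1))) t :=
        setLIntegral_le_lintegral _ _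
    _ = ∫⁻ t in Set.Ioc 0 L, ENNReal.ofReal (D * t ^ (q - p - 1)) :=
        lintegral_indicator measurableSet_Ioc _
    _ = ENNReal.ofReal (∫ t in Set.Ioc 0 L, D * t ^ (q - p - 1)) := by
        rw [ofReal_integral_eq_lintegral_ofReal hint]
        filter_upwards [ae_restrict_mem measurableSet_Ioc] with t ht
        have := ht.1
        positivity
    _ ≤ _ := by
        rw [← intervalIntegral.integral_of_le hL.le, intervalIntegral.integral_const_mul,
          integral_rpow (Or.inl (by linarith)), sub_add_cancel,
          Real.zero_rpow (by linarith : q - p ≠ 0), sub_zero]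

theorem ChangesSignAtMost.const_mul {f : ℝ → ℝ} {I : Set ℝ} {N : ℕ} (hf : ChangesSignAtMost f I N)
    (R : ℝ) : ChangesSignAtMost (fun s => R * f s) I N := by
  rintro ⟨t, ht, hI, hneg⟩
  refine hf ⟨t, ht, hI, fun i => ?_⟩
  by_contra! h
  nlinarith [hneg i, mul_nonneg (sq_nonneg R) h]

theorem exists_hausdorffMeasure_levelSet_le {m : ℕ} {a b : ℝ} (hab : a < b)
    {γ : ℝ → EuclideanSpace ℝ (Fin (m + 2))} (hγ : ContDiff ℝ 2 γ)
    (hind : ∀ t ∈ Set.Icc a b, LinearIndependent ℝ ![deriv γ t, deriv (deriv γ) t]) {N : ℕ}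
    (hsign : ∀ ω : EuclideanSpace ℝ (Fin (m + 2)), ‖ω‖ = 1 →
      ChangesSignAtMost (fun s => ⟪ω, deriv (deriv γ) s⟫) (Set.Icc a b) N)
    {χ χ' : ℝ → ℂ} (hχ : ∀ t, HasDerivAt χ (χ' t) t) (hχ' : Continuous χ')
    {X X' L : ℝ} (hX : ∀ t, ‖χ t‖ ≤ X) (hX' : ∀ t, ‖χ' t‖ ≤ X') (hL : 0 < L) :
    ∃ C, 0 ≤ C ∧ ∀ R s : ℝ, 0 < R → 0 < s → s ≤ L →
      μH[(m + 1 : ℕ)] {ω : EuclideanSpace ℝ (Fin (m + 2)) | ‖ω‖ = 1 ∧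
        s < ‖∫ t in a..b, Complex.exp (-Complex.I * ((⟪R • ω, γ t⟫ : ℝ) : ℂ)) * χ t‖} ≤
        ENNReal.ofReal (C * (R ^ 2 * s ^ 4)⁻¹) := by
  have hγ1 : ContDiff ℝ 1 (deriv γ) := hγ.deriv' (n := 1)
  have hdγ : ∀ t, HasDerivAt γ (deriv γ t) t := fun t =>
    (hγ.differentiable (by norm_num) t).hasDerivAt
  have hddγ : ∀ t, HasDerivAt (deriv γ) (deriv (deriv γ) t) t := fun t =>
    (hγ1.differentiable (by norm_num) t).hasDerivAt
  have hcγ : Continuous (deriv (deriv γ)) := hγ1.continuous_deriv le_rfl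
  obtain ⟨c, hc, M, h₀, hh₀, htrans⟩ := exists_uniform_transversality hddγ hcγ hab hind
  have hX0 : 0 ≤ X := (norm_nonneg _).trans (hX 0)
  have hX'0 : 0 ≤ X' := (norm_nonneg _).trans (hX' 0)
  have hba : 0 < b - a := by linarith
  have hM : 0 ≤ M := by
    have h := (htrans a (min h₀ (b - a)) le_rfl (lt_min hh₀ hba) (min_le_left _ _)
      (by linarith [min_le_right h₀ (b - a)])).2.1
    exact (norm_nonneg _).trans h
  set V : ℝ := 4 * X + X' * (b - a) with hV
  have hV0 : 0 ≤ V := by positivity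
  set κ : ℝ := min (1 / (8 * ((N : ℝ) + 2) * (X + 1))) (h₀ / L) with hκ
  have hκ0 : 0 < κ := by positivity
  have hκ1 : ((N : ℝ) + 2) * (X * (2 * κ)) ≤ 1 / 4 := by
    have h1 : κ ≤ 1 / (8 * ((N : ℝ) + 2) * (X + 1)) := min_le_left _ _
    rw [le_div_iff₀ (by positivity)] at h1
    have h2 : 0 ≤ ((N : ℝ) + 2) * κ := by positivity
    nlinarith
  have hκ2 : κ * L ≤ h₀ := by
    have h1 : κ ≤ h₀ / L := min_le_right _ _
    rwa [le_div_iff₀ hL] at h1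
  set K : ℝ := 8 * ((N : ℝ) + 2) * (V + 1) with hK
  have hK0 : 0 < K := by positivity
  set Q : ℝ := 2 * ((m + 1 : ℕ) + 1) * ((2 * (m + 1 : ℕ)) ^ (m + 1) *
        (2 * ((m + 1 : ℕ) + 1)) ^ (m + 1) * ((m + 1 : ℕ) + 1)) with hQ
  have hQ0 : 0 ≤ Q := by positivity
  refine ⟨(b - a) / κ * (Q / c ^ 2 * (2 * K ^ 2 / κ * (1 + M * h₀ / (2 * c)))), by positivity,
    fun R s hR hs hsL => ?_⟩
  set h : ℝ := κ * s with hh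
  have hh0 : 0 < h := by positivity
  have hhh₀ : h ≤ h₀ := (mul_le_mul_of_nonneg_left hsL hκ0.le).trans hκ2
  set A : ℝ := K / s with hA
  have hA0 : 0 < A := by positivity
  set α : ℝ := A / R with hα
  have hα0 : 0 < α := by positivity
  set β : ℝ := 2 * α / h with hβ
  have hβ0 : 0 < β := by positivity
  set J : ℕ := ⌊(b - a) / h⌋₊ with hJ
  have hJle : (J : ℝ) ≤ (b - a) / h := Nat.floor_le (by positivity)
  have hJiff : ∀ j : ℕ, a + j * h + h ≤ b ↔ j < J := fun j => by
    rw [hJ, ← Nat.succ_le_iff, Nat.le_floor_iff (by positivity), le_div_iff₀ hh0]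
    push_cast
    constructor <;> intro _ <;> linarith
  let S : ℕ → Set (EuclideanSpace ℝ (Fin (m + 2))) := fun j => {ω | ‖ω‖ = 1 ∧
    |⟪ω, deriv γ (a + j * h)⟫| ≤ α ∧
    |⟪ω, h⁻¹ • (deriv γ (a + j * h + h) - deriv γ (a + j * h))⟫| ≤ β}
  have hsub : {ω : EuclideanSpace ℝ (Fin (m + 2)) | ‖ω‖ = 1 ∧
        s < ‖∫ t in a..b, Complex.exp (-Complex.I * ((⟪R • ω, γ t⟫ : ℝ) : ℂ)) * χ t‖} ⊆
      ⋃ j ∈ Finset.range J, S j := by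
    rintro ω ⟨hω, hlt⟩
    by_contra hnot
    have hgrid : ∀ j : ℕ, a + j * h + h ≤ b → A < |⟪R • ω, deriv γ (a + j * h)⟫| ∨
        A < |⟪R • ω, deriv γ (a + j * h + h)⟫| := by
      intro j hj
      by_contra! hle
      refine hnot (Set.mem_biUnion (Finset.mem_coe.2 (Finset.mem_range.2 ((hJiff j).1 hj))) ?_)
      have hsc : ∀ x : EuclideanSpace ℝ (Fin (m + 2)), |⟪R • ω, x⟫| ≤ A → |⟪ω, x⟫| ≤ α :=
        fun x hx => by
          rw [real_inner_smul_left, abs_mul, abs_of_pos hR] at hx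
          rwa [hα, le_div_iff₀' hR]
      have h1 := hsc _ hle.1
      have h2 := hsc _ hle.2
      refine ⟨hω, h1, ?_⟩
      rw [real_inner_smul_right, abs_mul, abs_of_pos (inv_pos.2 hh0), inner_sub_right,
        inv_mul_eq_div, hβ]
      gcongr
      exact (abs_sub _ _).trans (by linarith)
    have hosc := norm_integral_exp_mul_le_of_grid (φ := fun t => ⟪R • ω, γ t⟫)
      (φ' := fun t => ⟪R • ω, deriv γ t⟫) (φ'' := fun t => ⟪R • ω, deriv (deriv γ) t⟫)
      (fun t => by simpa using (hasDerivAt_const t (R • ω)).inner ℝ (hdγ t))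
      (fun t => by simpa using (hasDerivAt_const t (R • ω)).inner ℝ (hddγ t))
      (by fun_prop) hχ hχ' hX hX' hA0 hab.le hh0 hgrid (N := N)
      (by simpa only [real_inner_smul_left] using (hsign ω hω).const_mul R)
    have h1 : ((N : ℝ) + 2) * (2 * (V / A)) ≤ s / 4 := by
      have : ((N : ℝ) + 2) * (2 * (V / A)) = (8 * ((N : ℝ) + 2) * V) / K * (s / 4) := by
        rw [hA]; field_simp; ring
      rw [this]
      refine mul_le_of_le_one_left (by positivity) ?_
      rw [div_le_one hK0, hK]
      gcongr
      linarith
    have h2 : ((N : ℝ) + 2) * (X * (2 * h)) ≤ s / 4 := by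
      have : ((N : ℝ) + 2) * (X * (2 * h)) = ((N : ℝ) + 2) * (X * (2 * κ)) * s := by
        rw [hh]; ring
      rw [this]
      nlinarith
    rw [mul_add] at hosc
    linarith
  have hαβ : α ≤ h₀ / 2 * β := by
    have : α = h / 2 * β := by rw [hβ]; field_simp
    rw [this]
    gcongr
  calc _ ≤ μH[(m + 1 : ℕ)] (⋃ j ∈ Finset.range J, S j) := measure_mono hsub
    _ ≤ ∑ j ∈ Finset.range J, μH[(m + 1 : ℕ)] (S j) := measure_biUnion_finset_le _ _
    _ ≤ ∑ j ∈ Finset.range J, ENNReal.ofReal (Q * ((α / c) * ((β + M / c * α) / c))) := by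
        refine Finset.sum_le_sum fun j hj => ?_
        obtain ⟨hv, hw, hvw⟩ := htrans (a + j * h) h (by linarith [mul_nonneg j.cast_nonneg hh0.le])
          hh0 hhh₀ ((hJiff j).2 (Finset.mem_range.1 hj))
        exact hausdorffMeasure_sphere_strip_le (by simp) hc hv hw hvw hα0.le hβ0.le
    _ = ENNReal.ofReal (J * (Q * ((α / c) * ((β + M / c * α) / c)))) := by
        rw [Finset.sum_const, Finset.card_range, nsmul_eq_mul, ENNReal.ofReal_mul (Nat.cast_nonneg J),
          ENNReal.ofReal_natCast]
    _ ≤ _ := by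
        apply ENNReal.ofReal_le_ofReal
        calc _ ≤ (b - a) / h * (Q * ((α / c) * ((β + M / c * (h₀ / 2 * β)) / c))) := by gcongr
          _ = _ := by
              rw [hβ, hα, hA, hh]
              field_simp

/-- Sharp average decay `G_q(R) ≲ R^{-2/q}` for `4 < q ≤ ∞` (the `q = ∞` case
being the sup bound with exponent `2/∞ = 0`), for a `C²` curve with
nonvanishing curvature such that `⟨ω,γ''(·)⟩` has a bounded number of sign
changes for every direction `ω`. -/
theorem stmt14 (d : ℕ) (hd : 2 < d) (a b : ℝ) (hab : a < b)
    (γ : ℝ → EuclideanSpace ℝ (Fin d)) (hγ : ContDiff ℝ 2 γ)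
    (hind : ∀ t ∈ Set.Icc a b, LinearIndependent ℝ ![deriv γ t, deriv (deriv γ) t])
    (N : ℕ)
    (hsign : ∀ ω : EuclideanSpace ℝ (Fin d), ‖ω‖ = 1 →
      ChangesSignAtMost (fun s => ⟪ω, deriv (deriv γ) s⟫) (Set.Icc a b) N)
    (χ : ℝ → ℂ) (hχ : ContDiff ℝ (⊤ : ℕ∞) χ) (hχs : Function.support χ ⊆ Set.Ioo a b)
    (q : ℝ) (hq4 : 4 < q) :
    ∃ C > 0, ∀ R : ℝ, 2 ≤ R →
      ((∫ ω in Metric.sphere (0 : EuclideanSpace ℝ (Fin d)) 1,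
          ‖∫ t : ℝ, Complex.exp (-Complex.I * ((⟪R • ω, γ t⟫ : ℝ) : ℂ)) * χ t‖ ^ q
        ∂μH[(d:ℝ)-1]) ^ (1/q) ≤ C * R ^ (-2/q)) ∧
      (∀ ω : EuclideanSpace ℝ (Fin d), ‖ω‖ = 1 →
        ‖∫ t : ℝ, Complex.exp (-Complex.I * ((⟪R • ω, γ t⟫ : ℝ) : ℂ)) * χ t‖ ≤ C) := by
  obtain ⟨m, rfl⟩ : ∃ m, d = m + 2 := ⟨d - 2, by lia⟩
  have hdim : ((m + 2 : ℕ) : ℝ) - 1 = ((m + 1 : ℕ) : ℝ) := by push_cast; ring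
  rw [hdim]
  have hcompact : HasCompactSupport χ :=
    HasCompactSupport.of_support_subset_isCompact isCompact_Icc (hχs.trans Set.Ioo_subset_Icc_self)
  have hχ' : Continuous (deriv χ) := hχ.continuous_deriv (by exact_mod_cast le_top)
  obtain ⟨X, hX⟩ := hcompact.exists_bound_of_continuous hχ.continuous
  obtain ⟨X', hX'⟩ := hcompact.deriv.exists_bound_of_continuous hχ'
  have hint : Integrable χ := hχ.continuous.integrable_of_hasCompactSupport hcompact
  have hχd : ∀ t, HasDerivAt χ (deriv χ t) t := fun t =>
    (hχ.differentiable (by simp) t).hasDerivAt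
  have hnorm : ∀ x t : ℝ, ‖Complex.exp (-Complex.I * (x : ℂ)) * χ t‖ = ‖χ t‖ := fun x t => by
    rw [show -Complex.I * (x : ℂ) = ((-x : ℝ) : ℂ) * Complex.I by push_cast; ring, norm_mul,
      Complex.norm_exp_ofReal_mul_I, one_mul]
  set L : ℝ := (∫ t, ‖χ t‖) + 1 with hLdef
  have hL0 : 0 < L := by
    have : 0 ≤ ∫ t, ‖χ t‖ := integral_nonneg fun t => norm_nonneg _
    linarith
  let f : ℝ → EuclideanSpace ℝ (Fin (m + 2)) → ℝ := fun R ω =>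
    ‖∫ t : ℝ, Complex.exp (-Complex.I * ((⟪R • ω, γ t⟫ : ℝ) : ℂ)) * χ t‖
  have hfL : ∀ R ω, f R ω ≤ L := fun R ω => by
    refine (norm_integral_le_integral_norm _).trans ?_
    simp only [hnorm]
    linarith
  have hγc : Continuous γ := hγ.continuous
  have hχc : Continuous χ := hχ.continuous
  have hfc : ∀ R, Continuous (f R) := fun R => by
    refine (continuous_of_dominated (bound := fun t => ‖χ t‖) (fun ω => ?_) (fun ω => ?_)
      hint.norm ?_).norm
    · exact Continuous.aestronglyMeasurable (by fun_prop)
    · exact Filter.Eventually.of_forall fun t => (hnorm _ _).le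
    · exact Filter.Eventually.of_forall fun t => by fun_prop
  obtain ⟨C, hC0, hC⟩ := exists_hausdorffMeasure_levelSet_le hab hγ hind hsign hχd hχ' hX hX' hL0
  set G : ℝ := q * (C * (L ^ (q - 4) / (q - 4))) with hG
  have hq0 : 0 < q := by linarith
  have hG0 : 0 ≤ G := by
    have : 0 < q - 4 := by linarith
    positivity
  refine ⟨max L (G ^ (1 / q)), lt_max_of_lt_left hL0, fun R hR => ⟨?_, fun ω _ =>
    (hfL R ω).trans (le_max_left _ _)⟩⟩
  have hR0 : 0 < R := by linarith
  have hlint := lintegral_rpow_le_of_weak_type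
    (μ := (μH[((m + 1 : ℕ) : ℝ)]).restrict (Metric.sphere (0 : EuclideanSpace ℝ (Fin (m + 2))) 1))
    (hfc R).measurable (fun ω => norm_nonneg _) (D := C * (R ^ 2)⁻¹) (p := 4) hL0 (by positivity)
    (Filter.Eventually.of_forall (hfL R)) (by norm_num) hq4 (fun s hs hsL => by
      rw [Measure.restrict_apply' Metric.isClosed_sphere.measurableSet]
      refine (measure_mono ?_).trans ((hC R s hR0 hs hsL).trans (le_of_eq ?_))
      · rintro ω ⟨h1, h2⟩
        refine ⟨by simpa using h2, ?_⟩
        rwa [intervalIntegral.integral_eq_integral_of_support_subset]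
        refine fun t ht => Set.Ioo_subset_Ioc_self (hχs fun h0 => ht ?_)
        simp [h0]
      · congr 1
        rw [Real.rpow_neg hs.le, mul_inv, ← mul_assoc]
        norm_cast)
  have hreal : ∫ ω in Metric.sphere (0 : EuclideanSpace ℝ (Fin (m + 2))) 1, f R ω ^ q
      ∂μH[((m + 1 : ℕ) : ℝ)] ≤ G * R ^ (-2 : ℝ) := by
    rw [integral_eq_lintegral_of_nonneg_ae
      (Filter.Eventually.of_forall fun ω => Real.rpow_nonneg (norm_nonneg _) _)
      (((hfc R).measurable.pow_const q).aestronglyMeasurable)]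
    refine (ENNReal.toReal_le_of_le_ofReal (by positivity) hlint).trans (le_of_eq ?_)
    have hpow : R ^ (-2 : ℝ) = (R ^ 2)⁻¹ := by
      rw [Real.rpow_neg hR0.le]; norm_cast
    rw [hG, hpow]
    ring
  calc _ ≤ (G * R ^ (-2 : ℝ)) ^ (1 / q) :=
        Real.rpow_le_rpow (integral_nonneg fun ω => Real.rpow_nonneg (norm_nonneg _) _) hreal
          (by positivity)
    _ = G ^ (1 / q) * R ^ (-2 / q) := by
        rw [Real.mul_rpow hG0 (by positivity), ← Real.rpow_mul hR0.le]
        congr 2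
        ring
    _ ≤ _ := by gcongr; exact le_max_right _ _
end
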